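/- arXiv:1402.1809 — 10 statements merged into one kernel-verified Lean document; each statement's English description precedes it below -/
import Mathlib

section
/- Let ε > 0. The function 𝔭(w) := (1/ε)·ln(1 + (e^ε − 1)·((c − r w)/(c − r b))^{R/r + 1}) defined on [b, w_s] satisfies: 𝔭 is C¹ on [b, w_s] and C² on [b, w_s); 𝔭(b) = 1 and 𝔭(w_s) = 0; 𝔭'(w) < 0 and ε·𝔭'(w)² + 𝔭''(w) > 0 for all w ∈ [b, w_s); and 𝔭 solves the ordinary differential equation 0 = − R·𝔭'(w)²/(ε·𝔭'(w)² + 𝔭''(w)) + (r w − c)·𝔭'(w) for all w ∈ (b, w_s). -/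
/-- Explicit solution of the robust lifetime-ruin HJB boundary value
problem in the zero hazard-rate case (λ = 0). -/
theorem stmt_0 (r μ σ c b ws R eps : ℝ)
    (hr : 0 < r) (hμ : r < μ) (hσ : 0 < σ) (hc : 0 < c)
    (hws : ws = c / r) (hb : b < ws)
    (hR : R = (1 / 2) * ((μ - r) / σ) ^ 2)
    (heps : 0 < eps)
    (p : ℝ → ℝ)
    (hp : ∀ w, p w = (1 / eps) *
      Real.log (1 + (Real.exp eps - 1) * ((c - r * w) / (c - r * b)) ^ (R / r + 1))) :
    ContDiffOn ℝ 1 p (Set.Icc b ws) ∧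
    ContDiffOn ℝ 2 p (Set.Ico b ws) ∧
    p b = 1 ∧ p ws = 0 ∧
    (∀ w ∈ Set.Ico b ws,
      deriv p w < 0 ∧ 0 < eps * (deriv p w) ^ 2 + deriv (deriv p) w) ∧
    (∀ w ∈ Set.Ioo b ws,
      0 = - R * (deriv p w) ^ 2 / (eps * (deriv p w) ^ 2 + deriv (deriv p) w)
        + (r * w - c) * deriv p w) := by
  have hD : 0 < c - r * b := by
    rw [hws, lt_div_iff₀ hr] at hb; linarith
  have hRpos : 0 < R := by
    rw [hR]
    have : 0 < (μ - r) / σ := div_pos (by linarith) hσ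
    positivity
  have hK : 0 < Real.exp eps - 1 := by
    have := Real.add_one_lt_exp heps.ne'
    linarith
  have hn : 0 < R / r := div_pos hRpos hr
  obtain ⟨D, hDe⟩ : ∃ D, D = c - r * b := ⟨_, rfl⟩
  obtain ⟨K, hKe⟩ : ∃ K, K = Real.exp eps - 1 := ⟨_, rfl⟩
  rw [← hDe] at hD
  rw [← hKe] at hK
  have hpf : p = fun w => (1 / eps) *
      Real.log (1 + K * ((c - r * w) / D) ^ (R / r + 1)) := by
    funext w; rw [hp, hDe, hKe]
  have hx0 : ∀ w, w ≤ ws → 0 ≤ (c - r * w) / D := by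
    intro w hw
    rw [hws, le_div_iff₀ hr] at hw
    exact div_nonneg (by linarith) hD.le
  have hx : ∀ w, w < ws → 0 < (c - r * w) / D := by
    intro w hw
    rw [hws, lt_div_iff₀ hr] at hw
    exact div_pos (by linarith) hD
  have hG : ∀ w, w ≤ ws → 0 < 1 + K * ((c - r * w) / D) ^ (R / r + 1) := by
    intro w hw
    have := Real.rpow_nonneg (hx0 w hw) (R / r + 1)
    positivity
  have hxd : ∀ w, HasDerivAt (fun w => (c - r * w) / D) (-r / D) w := by
    intro w
    have := (((hasDerivAt_id w).const_mul r).const_sub c).div_const D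
    simpa using this
  have hGd : ∀ w, w < ws → HasDerivAt (fun w => 1 + K * ((c - r * w) / D) ^ (R / r + 1))
      (K * ((-r / D) * (R / r + 1) * ((c - r * w) / D) ^ (R / r))) w := by
    intro w hw
    have := (((hxd w).rpow_const (p := R / r + 1) (Or.inl (hx w hw).ne')).const_mul K).const_add 1
    simpa using this
  have hGd2 : ∀ w, w < ws → HasDerivAt
      (fun w => K * ((-r / D) * (R / r + 1) * ((c - r * w) / D) ^ (R / r)))
      (K * ((-r / D) * (R / r + 1) * ((-r / D) * (R / r) * ((c - r * w) / D) ^ (R / r - 1)))) w := by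
    intro w hw
    exact (((hxd w).rpow_const (p := R / r) (Or.inl (hx w hw).ne')).const_mul _).const_mul K
  have hpd : ∀ w, w < ws → HasDerivAt p
      ((1 / eps) * ((K * ((-r / D) * (R / r + 1) * ((c - r * w) / D) ^ (R / r))) /
        (1 + K * ((c - r * w) / D) ^ (R / r + 1)))) w := by
    intro w hw
    rw [hpf]
    exact ((hGd w hw).log (hG w hw.le).ne').const_mul _
  have hpd2 : ∀ w, w < ws → HasDerivAt (deriv p)
      ((1 / eps) * (((K * ((-r / D) * (R / r + 1) * ((-r / D) * (R / r) *
          ((c - r * w) / D) ^ (R / r - 1)))) * (1 + K * ((c - r * w) / D) ^ (R / r + 1)) -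
        (K * ((-r / D) * (R / r + 1) * ((c - r * w) / D) ^ (R / r))) *
        (K * ((-r / D) * (R / r + 1) * ((c - r * w) / D) ^ (R / r)))) /
        (1 + K * ((c - r * w) / D) ^ (R / r + 1)) ^ 2)) w := by
    intro w hw
    have h := (((hGd2 w hw).div (hGd w hw) (hG w hw.le).ne').const_mul (1 / eps))
    refine h.congr_of_eventuallyEq ?_
    filter_upwards [Iio_mem_nhds hw] with v hv
    exact (hpd v hv).deriv
  have hsum : ∀ w, w < ws → eps * (deriv p w) ^ 2 + deriv (deriv p) w =
      (K * ((r / D) ^ 2 * (R / r + 1) * (R / r) * ((c - r * w) / D) ^ (R / r - 1))) /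
        (eps * (1 + K * ((c - r * w) / D) ^ (R / r + 1))) := by
    intro w hw
    rw [(hpd w hw).deriv, (hpd2 w hw).deriv]
    have h1 := (hG w hw.le).ne'
    generalize 1 + K * ((c - r * w) / D) ^ (R / r + 1) = G at *
    generalize ((c - r * w) / D) ^ (R / r) = y at *
    generalize ((c - r * w) / D) ^ (R / r - 1) = z at *
    field_simp
    ring
  refine ⟨?_, ?_, ?_, ?_, ?_, ?_⟩
  · rw [hpf]
    refine contDiffOn_const.mul (ContDiffOn.log ?_ fun w hw => (hG w hw.2).ne')
    refine ContDiff.contDiffOn ?_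
    refine contDiff_const.add (contDiff_const.mul ?_)
    have hlin : ContDiff ℝ 1 (fun w : ℝ => (c - r * w) / D) := by fun_prop
    exact hlin.rpow_const_of_le (m := 1) (by push_cast; linarith)
  · rw [hpf]
    refine contDiffOn_const.mul (ContDiffOn.log ?_ fun w hw => (hG w hw.2.le).ne')
    refine contDiffOn_const.add (contDiffOn_const.mul ?_)
    have hlin : ContDiff ℝ 2 (fun w : ℝ => (c - r * w) / D) := by fun_prop
    exact hlin.contDiffOn.rpow_const_of_ne fun w hw => (hx w hw.2).ne'
  · rw [hp, ← hDe, div_self hD.ne', Real.one_rpow, mul_one, add_sub_cancel, Real.log_exp]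
    field_simp
  · have h0 : c - r * ws = 0 := by rw [hws]; field_simp; ring
    rw [hp, h0, zero_div, Real.zero_rpow (by linarith)]
    simp
  · intro w hw
    have h1 := hG w hw.2.le
    have h2 := Real.rpow_pos_of_pos (hx w hw.2) (R / r)
    have h3 := Real.rpow_pos_of_pos (hx w hw.2) (R / r - 1)
    constructor
    · rw [(hpd w hw.2).deriv]
      have : 0 < (1 / eps) * ((K * ((r / D) * (R / r + 1) * ((c - r * w) / D) ^ (R / r))) /
        (1 + K * ((c - r * w) / D) ^ (R / r + 1))) := by positivity
      rw [← neg_pos]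
      convert this using 1
      ring
    · rw [hsum w hw.2]
      positivity
  · intro w hw
    rw [hsum w hw.2, (hpd w hw.2).deriv]
    have h1 := hG w hw.2.le
    have h3 := Real.rpow_pos_of_pos (hx w hw.2) (R / r - 1)
    have h4 : ((c - r * w) / D) ^ (R / r) = ((c - r * w) / D) ^ (R / r - 1) * ((c - r * w) / D) := by
      rw [← Real.rpow_add_one (hx w hw.2).ne', sub_add_cancel]
    rw [h4]
    generalize 1 + K * ((c - r * w) / D) ^ (R / r + 1) = G at *
    generalize ((c - r * w) / D) ^ (R / r - 1) = z at *
    have h5 : R + r ≠ 0 := by positivity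
    field_simp
    ring
end

section
/- Let ε > 0 and let 𝔭(w) := (1/ε)·ln(1 + (e^ε − 1)·((c − r w)/(c − r b))^{R/r + 1}) on [b, w_s]. Then for every w ∈ (b, w_s): (i) the optimal investment feedback satisfies −((μ − r)/σ²)·𝔭'(w)/(ε·𝔭'(w)² + 𝔭''(w)) = 2(c − r w)/(μ − r); and (ii) the optimal drift-distortion feedback satisfies −((μ − r)/σ)·ε·𝔭'(w)²/(ε·𝔭'(w)² + 𝔭''(w)) = −(2σ(R + r)/(μ − r))·(e^ε − 1)·x^{R/r+1}/(1 + (e^ε − 1)·x^{R/r+1}), where x := (c − r w)/(c − r b). -/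
/-- The optimal investment and drift-distortion feedback forms obtained
from the explicit zero hazard-rate solution 𝔭. -/
theorem stmt_1 (r μ σ c b ws R eps : ℝ)
    (hr : 0 < r) (hμ : r < μ) (hσ : 0 < σ) (hc : 0 < c)
    (hws : ws = c / r) (hb : b < ws)
    (hR : R = (1 / 2) * ((μ - r) / σ) ^ 2)
    (heps : 0 < eps)
    (p : ℝ → ℝ)
    (hp : ∀ w, p w = (1 / eps) *
      Real.log (1 + (Real.exp eps - 1) * ((c - r * w) / (c - r * b)) ^ (R / r + 1))) :
    ∀ w ∈ Set.Ioo b ws,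
      (-((μ - r) / σ ^ 2) * deriv p w /
          (eps * (deriv p w) ^ 2 + deriv (deriv p) w)
        = 2 * (c - r * w) / (μ - r)) ∧
      (-((μ - r) / σ) * (eps * (deriv p w) ^ 2) /
          (eps * (deriv p w) ^ 2 + deriv (deriv p) w)
        = -(2 * σ * (R + r) / (μ - r)) *
            ((Real.exp eps - 1) * ((c - r * w) / (c - r * b)) ^ (R / r + 1)) /
            (1 + (Real.exp eps - 1) * ((c - r * w) / (c - r * b)) ^ (R / r + 1))) := by
  intro w hw
  have hKpos : 0 < Real.exp eps - 1 := by
    have := Real.add_one_lt_exp heps.ne'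
    linarith
  have hu : ∀ v, v < ws → 0 < c - r * v := by
    intro v hv
    rw [hws, lt_div_iff₀ hr] at hv
    linarith
  have hd : 0 < c - r * b := hu b hb
  have hRpos : 0 < R := by
    have : 0 < (μ - r) / σ := div_pos (by linarith) hσ
    rw [hR]; positivity
  set K := Real.exp eps - 1 with hK
  set a := R / r + 1 with ha
  set d := c - r * b with hdd
  have hXpos : ∀ v, v < ws → 0 < ((c - r * v) / d) ^ a := fun v hv =>
    Real.rpow_pos_of_pos (div_pos (hu v hv) hd) a
  have hU : ∀ v, HasDerivAt (fun v => c - r * v) (-r) v := by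
    intro v
    simpa using ((hasDerivAt_id v).const_mul r).const_sub c
  have hX : ∀ v, v < ws → HasDerivAt (fun v => ((c - r * v) / d) ^ a)
      (-(a * r) * ((c - r * v) / d) ^ a / (c - r * v)) v := by
    intro v hv
    have h0 := hu v hv
    have hx : 0 < (c - r * v) / d := div_pos h0 hd
    have h := ((hU v).div_const d).rpow_const (p := a) (Or.inl hx.ne')
    convert h using 1
    rw [Real.rpow_sub_one hx.ne']
    field_simp
  have hP : ∀ v, v < ws → HasDerivAt p
      (-(K * a * r) / eps * (((c - r * v) / d) ^ a /
        ((c - r * v) * (1 + K * ((c - r * v) / d) ^ a)))) v := by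
    intro v hv
    have h0 := hu v hv
    have hg : 0 < 1 + K * ((c - r * v) / d) ^ a := by
      have := hXpos v hv
      positivity
    have h := ((((hX v hv).const_mul K).const_add 1).log hg.ne').const_mul (1 / eps)
    rw [show p = _ from funext hp]
    refine HasDerivAt.congr_deriv h ?_
    field_simp
  have hev : deriv p =ᶠ[nhds w] fun v => (-(K * a * r) / eps * (((c - r * v) / d) ^ a /
        ((c - r * v) * (1 + K * ((c - r * v) / d) ^ a)))) := by
    filter_upwards [Iio_mem_nhds hw.2] with v hv
    exact (hP v hv).deriv
  have h0 := hu w hw.2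
  have hXw := hXpos w hw.2
  have hg : 0 < 1 + K * ((c - r * w) / d) ^ a := by positivity
  have hP2 := ((hX w hw.2).div ((hU w).mul (((hX w hw.2).const_mul K).const_add 1))
    (mul_pos h0 hg).ne').const_mul (-(K * a * r) / eps)
  have e2 : deriv (deriv p) w = _ := hev.deriv_eq.trans hP2.deriv
  have e1 := (hP w hw.2).deriv
  have hapos : 0 < a := by positivity
  have haR : a * r = R + r := by rw [ha]; field_simp
  simp only [Pi.mul_apply] at e2
  generalize ((c - r * w) / d) ^ a = X at *
  generalize c - r * w = u at *
  have hR2 : R * (2 * σ ^ 2) = (μ - r) ^ 2 := by rw [hR]; field_simp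
  have hm : 0 < μ - r := by linarith
  have e3 : eps * deriv p w ^ 2 + deriv (deriv p) w
      = K * a * r * R * X / (eps * u ^ 2 * (1 + K * X)) := by
    rw [e2, e1, show R = a * r - r by linarith]
    field_simp
    ring
  rw [e3, e1]
  constructor
  · field_simp
    linear_combination -hR2
  · rw [← haR]
    field_simp
    linear_combination hR2
end

section
/- Let ε > 0 and let 𝔭(w) := (1/ε)·ln(1 + (e^ε − 1)·((c − r w)/(c − r b))^{R/r + 1}) on [b, w_s]. Then 𝔭 has (left) derivative 0 at w_s, i.e. lim_{w → w_s−} 𝔭(w)/(w − w_s) = 0. Consequently, every function ψ : [b, w_s] → ℝ with 0 ≤ ψ(w) ≤ 𝔭(w) for all w ∈ [b, w_s] and ψ(w_s) = 0 also satisfies lim_{w → w_s−} ψ(w)/(w − w_s) = 0. -/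
/-- The explicit zero hazard-rate solution 𝔭 has zero (left) derivative at
the safe level `w_s`, and therefore so does every function squeezed between 0 and 𝔭
that vanishes at `w_s`. -/
theorem stmt_2 (r μ σ c b ws R eps : ℝ)
    (hr : 0 < r) (hμ : r < μ) (hσ : 0 < σ) (hc : 0 < c)
    (hws : ws = c / r) (hb : b < ws)
    (hR : R = (1 / 2) * ((μ - r) / σ) ^ 2)
    (heps : 0 < eps)
    (p : ℝ → ℝ)
    (hp : ∀ w, p w = (1 / eps) *
      Real.log (1 + (Real.exp eps - 1) * ((c - r * w) / (c - r * b)) ^ (R / r + 1))) :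
    Filter.Tendsto (fun w => p w / (w - ws)) (nhdsWithin ws (Set.Iio ws)) (nhds 0) ∧
    ∀ ψ : ℝ → ℝ, (∀ w ∈ Set.Icc b ws, 0 ≤ ψ w ∧ ψ w ≤ p w) → ψ ws = 0 →
      Filter.Tendsto (fun w => ψ w / (w - ws)) (nhdsWithin ws (Set.Ico b ws)) (nhds 0) := by
  have hR0 : 0 < R := by
    rw [hR]
    have : 0 < (μ - r) / σ := div_pos (by linarith) hσ
    positivity
  have ha : 0 < R / r := div_pos hR0 hr
  have hcw : c - r * ws = 0 := by
    rw [hws]; field_simp; ring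
  have hpws : p ws = 0 := by
    rw [hp, hcw, zero_div, Real.zero_rpow (by linarith)]
    simp
  have hder : HasDerivAt p 0 ws := by
    have h1 : HasDerivAt (fun w : ℝ => (c - r * w) / (c - r * b)) (-(r * 1) / (c - r * b)) ws :=
      (((hasDerivAt_id ws).const_mul r).const_sub c).div_const _
    have h2 := h1.rpow_const (p := R / r + 1) (Or.inr (by linarith))
    have h3 := (h2.const_mul (Real.exp eps - 1)).const_add 1
    have h4 := (h3.log (by
      rw [hcw, zero_div, Real.zero_rpow (by linarith)]
      simp)).const_mul (1 / eps)
    have h5 : p = fun w => (1 / eps) *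
      Real.log (1 + (Real.exp eps - 1) * ((c - r * w) / (c - r * b)) ^ (R / r + 1)) := funext hp
    rw [h5]
    rw [hcw, zero_div, add_sub_cancel_right, Real.zero_rpow ha.ne', mul_zero, mul_zero, zero_div,
      mul_zero] at h4
    exact h4
  have hmain : Filter.Tendsto (fun w => p w / (w - ws)) (nhdsWithin ws (Set.Iio ws)) (nhds 0) := by
    have h := (hasDerivAt_iff_tendsto_slope.1 hder).mono_left
      (nhdsWithin_mono ws (fun x (hx : x < ws) => (ne_of_lt hx : x ≠ ws)))
    refine h.congr (fun w => ?_)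
    rw [slope_def_field, hpws, sub_zero]
  refine ⟨hmain, fun ψ hψ _ => ?_⟩
  have hm2 := hmain.mono_left (nhdsWithin_mono ws (Set.Ico_subset_Iio_self (a := b) (b := ws)))
  refine tendsto_of_tendsto_of_tendsto_of_le_of_le' hm2 tendsto_const_nhds ?_ ?_
  · filter_upwards [self_mem_nhdsWithin] with w hw
    have h := hψ w ⟨hw.1, hw.2.le⟩
    exact div_le_div_of_nonpos_of_le (by linarith [hw.2]) h.2
  · filter_upwards [self_mem_nhdsWithin] with w hw
    have h := hψ w ⟨hw.1, hw.2.le⟩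
    exact div_nonpos_of_nonneg_of_nonpos h.1 (by linarith [hw.2])
end

section
/- Let λ > 0. The function ψ₀(w) := ((c − r w)/(c − r b))^d on [b, w_s] satisfies: ψ₀(b) = 1, ψ₀(w_s) = 0; ψ₀'(w) < 0 and ψ₀''(w) > 0 for all w ∈ [b, w_s); and ψ₀ solves the ordinary differential equation λ·ψ₀(w) = − R·ψ₀'(w)²/ψ₀''(w) + (r w − c)·ψ₀'(w) for all w ∈ (b, w_s). -/
/-- The non-robust value function ψ₀(w) = ((c-rw)/(c-rb))^d solves the
non-robust lifetime-ruin HJB boundary value problem. -/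
theorem stmt_3 (r μ σ c b ws R lam d : ℝ)
    (hr : 0 < r) (hμ : r < μ) (hσ : 0 < σ) (hc : 0 < c)
    (hws : ws = c / r) (hb : b < ws)
    (hR : R = (1 / 2) * ((μ - r) / σ) ^ 2)
    (hlam : 0 < lam)
    (hd : d = (1 / (2 * r)) *
      ((r + lam + R) + Real.sqrt ((r + lam + R) ^ 2 - 4 * r * lam)))
    (ψ₀ : ℝ → ℝ)
    (hψ₀ : ∀ w, ψ₀ w = ((c - r * w) / (c - r * b)) ^ d) :
    ψ₀ b = 1 ∧ ψ₀ ws = 0 ∧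
    (∀ w ∈ Set.Ico b ws, deriv ψ₀ w < 0 ∧ 0 < deriv (deriv ψ₀) w) ∧
    (∀ w ∈ Set.Ioo b ws,
      lam * ψ₀ w = - R * (deriv ψ₀ w) ^ 2 / deriv (deriv ψ₀) w
        + (r * w - c) * deriv ψ₀ w) := by
  have hRpos : 0 < R := by
    have : 0 < (μ - r) / σ := div_pos (by linarith) hσ
    rw [hR]; positivity
  have hdisc : (r - lam - R) ^ 2 < (r + lam + R) ^ 2 - 4 * r * lam := by
    nlinarith [mul_pos hr hRpos]
  have hs1 : r - lam - R < Real.sqrt ((r + lam + R) ^ 2 - 4 * r * lam) :=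
    Real.lt_sqrt_of_sq_lt hdisc
  have hs2 : Real.sqrt ((r + lam + R) ^ 2 - 4 * r * lam) ^ 2
      = (r + lam + R) ^ 2 - 4 * r * lam :=
    Real.sq_sqrt (le_of_lt (lt_of_le_of_lt (sq_nonneg _) hdisc))
  generalize Real.sqrt ((r + lam + R) ^ 2 - 4 * r * lam) = s at hd hs1 hs2
  have hd2 : s = 2 * r * d - (r + lam + R) := by
    rw [hd]; field_simp; ring
  have hd1 : 1 < d := by
    rw [hd2] at hs1
    by_contra h
    nlinarith [mul_nonneg hr.le (sub_nonneg.2 (not_lt.1 h))]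
  have hquad : r * d ^ 2 - (r + lam + R) * d + lam = 0 := by
    rw [hd2] at hs2
    have h4 : 4 * r * (r * d ^ 2 - (r + lam + R) * d + lam) = 0 := by linarith
    rcases mul_eq_zero.1 h4 with h | h
    · linarith
    · exact h
  have hlt : ∀ w, w < ws → 0 < c - r * w := by
    intro w hw
    rw [hws, lt_div_iff₀ hr] at hw
    linarith
  have hK : 0 < c - r * b := hlt b hb
  have hb1 : ψ₀ b = 1 := by rw [hψ₀, div_self hK.ne', Real.one_rpow]
  have hψ : ψ₀ = fun w => ((c - r * w) / (c - r * b)) ^ d := funext hψ₀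
  generalize c - r * b = K at hK hψ hψ₀
  have hx : ∀ w, HasDerivAt (fun w => (c - r * w) / K) (-r / K) w := by
    intro w
    have h := (((hasDerivAt_id w).const_mul r).const_sub c).div_const K
    simpa using h
  have hD1 : deriv ψ₀ = fun w => -r / K * d * ((c - r * w) / K) ^ (d - 1) := by
    funext w
    rw [hψ]
    exact ((hx w).rpow_const (Or.inr hd1.le)).deriv
  have hD2 : ∀ w, w < ws → deriv (deriv ψ₀) w
      = -r / K * d * (-r / K * (d - 1) * ((c - r * w) / K) ^ (d - 1 - 1)) := by
    intro w hw
    rw [hD1]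
    exact (((hx w).rpow_const (Or.inl (div_pos (hlt w hw) hK).ne')).const_mul _).deriv
  have hd0 : 0 < d := by linarith
  have hd10 : 0 < d - 1 := by linarith
  refine ⟨?_, ?_, ?_, ?_⟩
  · exact hb1
  · rw [hψ₀, hws, mul_div_cancel₀ _ hr.ne', sub_self, zero_div, Real.zero_rpow hd0.ne']
  · rintro w ⟨-, hw⟩
    have hp := div_pos (hlt w hw) hK
    rw [hD2 w hw, hD1]
    constructor
    · have : 0 < r / K * d * ((c - r * w) / K) ^ (d - 1) := by positivity
      have e : -r / K * d * ((c - r * w) / K) ^ (d - 1)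
        = -(r / K * d * ((c - r * w) / K) ^ (d - 1)) := by ring
      simp only [e]; linarith
    · have : 0 < r / K * d * (r / K * (d - 1) * ((c - r * w) / K) ^ (d - 1 - 1)) := by
        positivity
      have e : -r / K * d * (-r / K * (d - 1) * ((c - r * w) / K) ^ (d - 1 - 1))
        = r / K * d * (r / K * (d - 1) * ((c - r * w) / K) ^ (d - 1 - 1)) := by ring
      rw [e]; exact this
  · rintro w ⟨-, hw⟩
    have hp := div_pos (hlt w hw) hK
    rw [hD2 w hw, hD1, hψ₀]
    beta_reduce
    have hcw : r * w - c = - (K * ((c - r * w) / K)) := by field_simp; ring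
    rw [hcw]
    generalize (c - r * w) / K = x at hp
    have e1 : x ^ (d - 1) = x ^ (d - 1 - 1) * x := by
      rw [← Real.rpow_add_one hp.ne']; congr 1; ring
    have e2 : x ^ d = x ^ (d - 1 - 1) * x * x := by
      rw [← e1, ← Real.rpow_add_one hp.ne']; congr 1; ring
    simp only [e1, e2]
    have hq : 0 < x ^ (d - 1 - 1) := Real.rpow_pos_of_pos hp _
    generalize x ^ (d - 1 - 1) = q at hq
    have hl : lam = (r * d * (d - 1) - R * d) / (d - 1) := by
      rw [eq_div_iff hd10.ne']; linarith
    rw [hl]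
    field_simp
    ring
end

section
/- Let λ > 0 and ε > 0. Let ψ₀(w) := ((c − r w)/(c − r b))^d and 𝔭(w) := (1/ε)·ln(1 + (e^ε − 1)·((c − r w)/(c − r b))^{R/r + 1}) on [b, w_s]. Then for all w ∈ (b, w_s): (i) ψ₀ is a classical subsolution of the robust HJB equation, i.e. λ·ψ₀(w) + R·ψ₀'(w)²/(ε·ψ₀'(w)² + ψ₀''(w)) − (r w − c)·ψ₀'(w) ≤ 0; and (ii) 𝔭 is a classical supersolution, i.e. λ·𝔭(w) + R·𝔭'(w)²/(ε·𝔭'(w)² + 𝔭''(w)) − (r w − c)·𝔭'(w) = λ·𝔭(w) ≥ 0. -/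
lemma aux_pow (r c k e w : ℝ) (hk : 0 < k) (hs : 0 < c - r * w) :
    HasDerivAt (fun w => ((c - r * w) / k) ^ e)
      (-(r * e * ((c - r * w) / k) ^ e / (c - r * w))) w := by
  have hx : 0 < (c - r * w) / k := div_pos hs hk
  have h1 : HasDerivAt (fun w => (c - r * w) / k) (-r / k) w := by
    have := (((hasDerivAt_id w).const_mul r).const_sub c).div_const k
    simpa using this
  have h2 := h1.rpow_const (p := e) (Or.inl hx.ne')
  convert h2 using 1
  rw [Real.rpow_sub_one hx.ne']
  field_simp

lemma aux_lin (r c w : ℝ) : HasDerivAt (fun w => c - r * w) (-r) w := by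
  simpa using ((hasDerivAt_id w).const_mul r).const_sub c

lemma aux_ev (r c w : ℝ) (hs : 0 < c - r * w) : ∀ᶠ v in nhds w, 0 < c - r * v := by
  have : Continuous fun v : ℝ => c - r * v := by fun_prop
  exact this.continuousAt.eventually (lt_mem_nhds hs)

/-- ψ₀ is a classical subsolution and 𝔭 a classical supersolution of the
robust HJB equation. -/
theorem stmt_4 (r μ σ c b ws R lam d eps : ℝ)
    (hr : 0 < r) (hμ : r < μ) (hσ : 0 < σ) (hc : 0 < c)
    (hws : ws = c / r) (hb : b < ws)
    (hR : R = (1 / 2) * ((μ - r) / σ) ^ 2)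
    (hlam : 0 < lam) (heps : 0 < eps)
    (hd : d = (1 / (2 * r)) *
      ((r + lam + R) + Real.sqrt ((r + lam + R) ^ 2 - 4 * r * lam)))
    (ψ₀ : ℝ → ℝ)
    (hψ₀ : ∀ w, ψ₀ w = ((c - r * w) / (c - r * b)) ^ d)
    (p : ℝ → ℝ)
    (hp : ∀ w, p w = (1 / eps) *
      Real.log (1 + (Real.exp eps - 1) * ((c - r * w) / (c - r * b)) ^ (R / r + 1))) :
    ∀ w ∈ Set.Ioo b ws,
      (lam * ψ₀ w + R * (deriv ψ₀ w) ^ 2 / (eps * (deriv ψ₀ w) ^ 2 + deriv (deriv ψ₀) w)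
        - (r * w - c) * deriv ψ₀ w ≤ 0) ∧
      (lam * p w + R * (deriv p w) ^ 2 / (eps * (deriv p w) ^ 2 + deriv (deriv p) w)
        - (r * w - c) * deriv p w = lam * p w) ∧
      0 ≤ lam * p w := by
  intro w hw
  obtain ⟨hw1, hw2⟩ := hw
  have hk : 0 < c - r * b := by
    rw [hws, lt_div_iff₀ hr] at hb; linarith
  have hs : 0 < c - r * w := by
    rw [hws, lt_div_iff₀ hr] at hw2; linarith
  have hRpos : 0 < R := by
    have : 0 < (μ - r) / σ := div_pos (by linarith) hσ
    rw [hR]; positivity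
  have hev := aux_ev r c w hs
  have hx : 0 < (c - r * w) / (c - r * b) := div_pos hs hk
  -- facts on d
  have hdisc : 0 ≤ (r + lam + R) ^ 2 - 4 * r * lam := by
    nlinarith [sq_nonneg (r - lam), mul_pos hr hRpos, mul_pos hlam hRpos]
  have hquad : lam * (d - 1) + R * d - r * d * (d - 1) = 0 := by
    have hS := Real.sq_sqrt hdisc
    set S := Real.sqrt ((r + lam + R) ^ 2 - 4 * r * lam)
    have h2 : S = 2 * r * d - (r + lam + R) := by rw [hd]; field_simp; ring
    rw [h2] at hS
    have : 4 * r * (lam * (d - 1) + R * d - r * d * (d - 1)) = 0 := by linarith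
    rcases mul_eq_zero.1 this with h | h
    · linarith
    · exact h
  have hd1 : 1 < d := by
    have h1 : lam + R - r < Real.sqrt ((r + lam + R) ^ 2 - 4 * r * lam) ∧ 
        r - lam - R < Real.sqrt ((r + lam + R) ^ 2 - 4 * r * lam) := by
      constructor <;> apply Real.lt_sqrt_of_sq_lt <;> nlinarith [mul_pos hr hRpos]
    rw [hd, one_div, ← div_eq_inv_mul, lt_div_iff₀ (by positivity)]
    linarith [h1.2]
  refine ⟨?_, ?_, ?_⟩
  · have e1 : ∀ v, 0 < c - r * v →
        deriv ψ₀ v = -(r * d * ((c - r * v) / (c - r * b)) ^ d / (c - r * v)) := by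
      intro v hv
      rw [funext hψ₀]
      exact (aux_pow r c _ d v hk hv).deriv
    have e2 : deriv (deriv ψ₀) w =
        r ^ 2 * d * (d - 1) * ((c - r * w) / (c - r * b)) ^ d / (c - r * w) ^ 2 := by
      have : deriv ψ₀ =ᶠ[nhds w]
          fun v => -(r * d * ((c - r * v) / (c - r * b)) ^ d / (c - r * v)) :=
        hev.mono e1
      rw [this.deriv_eq]
      refine HasDerivAt.deriv ?_
      have := ((((aux_pow r c _ d w hk hs).const_mul (r * d)).div (aux_lin r c w) hs.ne')).neg
      refine HasDerivAt.congr_deriv this ?_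
      set y := ((c - r * w) / (c - r * b)) ^ d
      set s := c - r * w
      field_simp
      ring
    rw [e2, e1 w hs, hψ₀]
    have hy : 0 < ((c - r * w) / (c - r * b)) ^ d := Real.rpow_pos_of_pos hx _
    set y := ((c - r * w) / (c - r * b)) ^ d
    have hsw : r * w - c = -(c - r * w) := by ring
    rw [hsw]
    set s := c - r * w
    have hd0 : 0 < d := by linarith
    have hd2 : 0 < d - 1 := by linarith
    have b1 : R * (-(r * d * y / s)) ^ 2 /
        (eps * (-(r * d * y / s)) ^ 2 + r ^ 2 * d * (d - 1) * y / s ^ 2) ≤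
        R * (-(r * d * y / s)) ^ 2 / (r ^ 2 * d * (d - 1) * y / s ^ 2) := by
      apply div_le_div_of_nonneg_left
      · positivity
      · positivity
      · have : 0 ≤ eps * (-(r * d * y / s)) ^ 2 := by positivity
        linarith
    have b2 : R * (-(r * d * y / s)) ^ 2 / (r ^ 2 * d * (d - 1) * y / s ^ 2) =
        R * d / (d - 1) * y := by
      field_simp
    have b3 : -s * -(r * d * y / s) = r * d * y := by field_simp
    have b4 : lam + R * d / (d - 1) = r * d := by
      field_simp; linarith
    rw [b3]
    rw [b2] at b1
    have b5 : lam * y + R * d / (d - 1) * y = r * d * y := by rw [← add_mul, b4]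
    linarith
  · have hA : 0 < Real.exp eps - 1 := by linarith [Real.add_one_lt_exp heps.ne']
    set A := Real.exp eps - 1
    have hq : R = r * ((R / r + 1) - 1) := by field_simp; ring
    have hq1 : 0 < (R / r + 1) - 1 := by
      have := div_pos hRpos hr
      linarith
    set q := R / r + 1
    have hu : ∀ v, 0 < c - r * v → 0 < 1 + A * ((c - r * v) / (c - r * b)) ^ q := by
      intro v hv
      have := Real.rpow_pos_of_pos (div_pos hv hk) q
      positivity
    have e1 : ∀ v, 0 < c - r * v →
        deriv p v = (1 / eps) * (A * -(r * q * ((c - r * v) / (c - r * b)) ^ q / (c - r * v)) /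
          (1 + A * ((c - r * v) / (c - r * b)) ^ q)) := by
      intro v hv
      rw [funext hp]
      exact (((((aux_pow r c _ q v hk hv).const_mul A).const_add 1).log
        (hu v hv).ne').const_mul (1 / eps)).deriv
    have hq0 : 0 < q := by linarith
    have hy : 0 < ((c - r * w) / (c - r * b)) ^ q := Real.rpow_pos_of_pos hx _
    have huw := hu w hs
    have e2 : eps * (deriv p w) ^ 2 + deriv (deriv p) w = (1 / eps) * (A *
        (r ^ 2 * q * (q - 1) * ((c - r * w) / (c - r * b)) ^ q / (c - r * w) ^ 2) /
        (1 + A * ((c - r * w) / (c - r * b)) ^ q)) := by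
      have : deriv p =ᶠ[nhds w] _ := hev.mono e1
      rw [this.deriv_eq, e1 w hs]
      have h1 := ((((aux_pow r c _ q w hk hs).const_mul (r * q)).div (aux_lin r c w) hs.ne')).neg
      have h2 := ((h1.const_mul A).div (((aux_pow r c _ q w hk hs).const_mul A).const_add 1)
        huw.ne').const_mul (1 / eps)
      have h3 := h2.deriv
      simp only [Pi.neg_apply, Pi.div_apply] at h3
      refine (congrArg _ h3).trans ?_
      set y := ((c - r * w) / (c - r * b)) ^ q
      set s := c - r * w
      field_simp
      ring
    rw [e2, e1 w hs]
    set y := ((c - r * w) / (c - r * b)) ^ q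
    have hsw : r * w - c = -(c - r * w) := by ring
    rw [hsw]
    set s := c - r * w
    rw [add_sub_assoc, add_eq_left, sub_eq_zero]
    set u := 1 + A * y
    clear_value q
    rw [hq]
    field_simp
  · have hA : 0 < Real.exp eps - 1 := by linarith [Real.add_one_lt_exp heps.ne']
    have hy := Real.rpow_pos_of_pos hx (R / r + 1)
    rw [hp]
    have : 0 ≤ Real.log (1 + (Real.exp eps - 1) *
        ((c - r * w) / (c - r * b)) ^ (R / r + 1)) := by
      apply Real.log_nonneg
      have := mul_pos hA hy
      linarith
    positivity
end

section
/- Let λ > 0 and ε ≥ 0. Let u : [b, w_s] → ℝ be a bounded, upper semi-continuous viscosity subsolution of F = 0 on (b, w_s), and let v : [b, w_s] → ℝ be a bounded, lower semi-continuous viscosity supersolution of F = 0 on (b, w_s). Assume that either v(w) ≥ 0 for all w ∈ (b, w_s), or u(w) > 0 for all w ∈ (b, w_s). If u(b) ≤ v(b) and u(w_s) ≤ v(w_s), then u(w) ≤ v(w) for all w ∈ [b, w_s]. -/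
/-- The Hamiltonian `F(w,u,p,A)`, with value `+∞` (in `EReal`) when the infimum over π
is not attained finitely. -/
noncomputable def Fop (lam eps R r c : ℝ) (w u p A : ℝ) : EReal :=
  if 0 < eps * p ^ 2 + A then
    ((lam * u + R * p ^ 2 / (eps * p ^ 2 + A) - (r * w - c) * p : ℝ) : EReal)
  else if eps * p ^ 2 + A = 0 ∧ p = 0 then ((lam * u : ℝ) : EReal)
  else ⊤

/-- `u` is an (u.s.c.) viscosity subsolution of `F = 0` on `(b, ws)`. -/
def IsViscSubsol (lam eps R r c b ws : ℝ) (u : ℝ → ℝ) : Prop :=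
  ∀ w₀ ∈ Set.Ioo b ws, ∀ φ : ℝ → ℝ, ContDiffAt ℝ 2 φ w₀ →
    IsLocalMaxOn (fun w => u w - φ w) (Set.Ioo b ws) w₀ →
    Fop lam eps R r c w₀ (u w₀) (deriv φ w₀) (deriv (deriv φ) w₀) ≤ 0

/-- `v` is a (l.s.c.) viscosity supersolution of `F = 0` on `(b, ws)`. -/
def IsViscSupersol (lam eps R r c b ws : ℝ) (v : ℝ → ℝ) : Prop :=
  ∀ w₀ ∈ Set.Ioo b ws, ∀ φ : ℝ → ℝ, ContDiffAt ℝ 2 φ w₀ →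
    IsLocalMinOn (fun w => v w - φ w) (Set.Ioo b ws) w₀ →
    0 ≤ Fop lam eps R r c w₀ (v w₀) (deriv φ w₀) (deriv (deriv φ) w₀)

open Set Filter Topology MeasureTheory

/-- `z` selects a maximizer in the sup-convolution of `a` over `I`. -/
def ArgSel (I : Set ℝ) (a : ℝ → ℝ) (k : ℝ) (z : ℝ → ℝ) : Prop :=
  ∀ x, z x ∈ I ∧ ∀ w ∈ I, a w - k / 2 * (x - w) ^ 2 ≤ a (z x) - k / 2 * (x - z x) ^ 2

theorem ArgSel.mono {I : Set ℝ} {a : ℝ → ℝ} {k : ℝ} {z : ℝ → ℝ} (hk : 0 < k)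
    (h : ArgSel I a k z) : Monotone z := by
  intro s t hst
  have h1 := (h s).2 (z t) (h t).1
  have h2 := (h t).2 (z s) (h s).1
  rcases hst.eq_or_lt with rfl | hlt
  · exact le_rfl
  have h3 : 0 ≤ k * ((t - s) * (z t - z s)) := by nlinarith
  have h4 : 0 ≤ (t - s) * (z t - z s) := nonneg_of_mul_nonneg_right h3 hk
  have h5 := nonneg_of_mul_nonneg_right h4 (sub_pos.2 hlt)
  linarith

theorem tele (e : ℝ → ℝ) (C : ℝ)
    (h : ∀ α β, 0 ≤ α → α ≤ β → β ≤ 1 → e β - e α ≤ C * (β - α) ^ 2) : e 1 ≤ e 0 := by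
  have key : ∀ n : ℕ, 0 < n → e 1 - e 0 ≤ C / n := by
    intro n hn
    have hn' : (0 : ℝ) < n := by exact_mod_cast hn
    have step : ∀ i : ℕ, i ≤ n → e (i / n) - e 0 ≤ i * (C / n ^ 2) := by
      intro i
      induction i with
      | zero => intro _; simp
      | succ j ih =>
        intro hj
        have h1 := ih (by omega)
        have h2 := h (j / n) ((j + 1 : ℕ) / n) (by positivity)
          (by gcongr; simp) (by rw [div_le_one hn']; exact_mod_cast hj)
        have h3 : C * (((j + 1 : ℕ) : ℝ) / n - j / n) ^ 2 = C / n ^ 2 := by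
          push_cast; field_simp; ring
        rw [h3] at h2
        push_cast at h2 ⊢
        linarith
    have := step n le_rfl
    rw [div_self hn'.ne'] at this
    calc e 1 - e 0 ≤ n * (C / n ^ 2) := this
      _ = C / n := by field_simp
  have hlim : Tendsto (fun n : ℕ => C / (n : ℝ)) atTop (𝓝 0) :=
    tendsto_const_div_atTop_nhds_zero_nat C
  have := ge_of_tendsto hlim (eventually_atTop.2 ⟨1, fun n hn => key n hn⟩)
  linarith

theorem ArgSel.step {I : Set ℝ} {a : ℝ → ℝ} {k : ℝ} {z : ℝ → ℝ}
    (h : ArgSel I a k z) (s t : ℝ) :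
    (a (z s) - k / 2 * (s - z s) ^ 2) - (a (z t) - k / 2 * (t - z t) ^ 2)
      ≤ k / 2 * (s - t) * (2 * z s - s - t) := by
  have := (h t).2 (z s) (h s).1
  nlinarith

/-- Second order upper expansion at points of differentiability of the selection. -/
theorem ArgSel.jet {I : Set ℝ} {a : ℝ → ℝ} {k : ℝ} {z : ℝ → ℝ} (hk : 0 < k)
    (h : ArgSel I a k z) {x D : ℝ} (hD : HasDerivAt z D x) {A : ℝ} (hA : k * (D - 1) < A) :
    ∀ᶠ w in 𝓝 (z x), w ∈ I →
      a w ≤ a (z x) + k * (z x - x) * (w - z x) + A / 2 * (w - z x) ^ 2 := by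
  set g : ℝ → ℝ := fun t => a (z t) - k / 2 * (t - z t) ^ 2 with hg
  obtain ⟨δ, hδ⟩ : ∃ δ, δ = A / k - (D - 1) := ⟨_, rfl⟩
  have hδ0 : 0 < δ := by
    rw [hδ, sub_pos, lt_div_iff₀ hk]; linarith
  have hAδ : A = k * (D - 1 + δ) := by rw [hδ]; field_simp; ring
  have hz : ∀ᶠ s in 𝓝 x, |z s - z x - (s - x) * D| ≤ δ * |s - x| := by
    have := (hasDerivAt_iff_isLittleO.1 hD).def hδ0
    simpa using this
  obtain ⟨ρ, hρ, hball⟩ := Metric.eventually_nhds_iff.1 hz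
  have hgE : ∀ s, |s - x| < ρ → g s ≤ g x + k * (z x - x) * (s - x) + A / 2 * (s - x) ^ 2 := by
    intro s hs
    obtain ⟨η, hη⟩ : ∃ η, η = s - x := ⟨_, rfl⟩
    rw [← hη] at hs
    have := tele (fun α => g (x + α * η) - k * (z x - x) * (α * η) - A / 2 * (α * η) ^ 2)
      (k / 2 * η ^ 2 + A / 2 * η ^ 2) ?_
    · simp only [one_mul, zero_mul, add_zero] at this
      have e : x + η = s := by rw [hη]; ring
      rw [e] at this
      rw [← hη]
      nlinarith
    · intro α β hα hαβ hβ
      have h1 := h.step (x + β * η) (x + α * η)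
      have hb : |z (x + β * η) - z x - (β * η) * D| ≤ δ * |β * η| := by
        have := hball (y := x + β * η) (by
          rw [Real.dist_eq, add_sub_cancel_left, abs_mul, abs_of_nonneg (hα.trans hαβ)]
          nlinarith [abs_nonneg η])
        simpa using this
      have h2 : η * (z (x + β * η)) ≤ η * (z x + (D + δ) * (β * η)) := by
        have : η * (z (x + β * η) - z x - (β * η) * D) ≤ |η| * (δ * |β * η|) := by
          refine (le_abs_self _).trans ?_
          rw [abs_mul]
          gcongr
        have e : |η| * (δ * |β * η|) = δ * β * η ^ 2 := by
          rw [abs_mul, abs_of_nonneg (hα.trans hαβ), ← sq_abs η]; ring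
        rw [e] at this
        linarith
      have h3 : k * (β - α) * (η * (z (x + β * η))) ≤
          k * (β - α) * (η * (z x + (D + δ) * (β * η))) :=
        mul_le_mul_of_nonneg_left h2 (mul_nonneg hk.le (sub_nonneg.2 hαβ))
      simp only [hg]
      rw [hAδ]
      nlinarith
  have hcont : ∀ᶠ w in 𝓝 (z x), |w - z x| < ρ := by
    have := Metric.ball_mem_nhds (z x) hρ
    filter_upwards [this] with w hw
    simpa [Real.dist_eq] using hw
  filter_upwards [hcont] with w hw hwI
  have h1 := hgE (x + (w - z x)) (by simpa using hw)
  have h2 := (h (x + (w - z x))).2 w hwI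
  simp only [hg] at h1
  simp only [add_sub_cancel_left] at h1
  nlinarith

/-- One-dimensional Jensen lemma. -/
theorem jensen {I : Set ℝ} {a a' : ℝ → ℝ} {k : ℝ} {z y : ℝ → ℝ} (hk : 0 < k)
    (hz : ArgSel I a k z) (hy : ArgSel I a' k y) {x0 : ℝ} (hS : z x0 + y x0 = 2 * x0)
    (hmax : ∀ x, (a (z x) - k / 2 * (x - z x) ^ 2) + (a' (y x) - k / 2 * (x - y x) ^ 2) ≤
      (a (z x0) - k / 2 * (x0 - z x0) ^ 2) + (a' (y x0) - k / 2 * (x0 - y x0) ^ 2))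
    {η : ℝ} (hη : 0 < η) :
    ∃ x ∈ Ioo x0 (x0 + η), ∃ Dz Dy, HasDerivAt z Dz x ∧ HasDerivAt y Dy x ∧
      Dz + Dy ≤ 2 + η := by
  by_contra hcon
  push Not at hcon
  set f : ℝ → ℝ := fun x =>
    (a (z x) - k / 2 * (x - z x) ^ 2) + (a' (y x) - k / 2 * (x - y x) ^ 2) with hf
  have hzm := hz.mono hk
  have hym := hy.mono hk
  have hSm : Monotone (fun x => z x + y x) := hzm.add hym
  have hinc : ∀ x ∈ Icc x0 (x0 + η), 2 * x + η * (x - x0) ≤ z x + y x := by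
    intro x hx
    have hint := (hSm.monotoneOn (uIcc x0 x)).intervalIntegral_deriv_mem_uIcc
    have hintg := (hSm.monotoneOn (uIcc x0 x)).intervalIntegrable_deriv
    rw [uIcc_of_le (by have := hSm hx.1; simpa using this)] at hint
    have hle : ∫ _ in x0..x, (2 + η) ≤ ∫ t in x0..x, deriv (fun x => z x + y x) t := by
      apply intervalIntegral.integral_mono_ae_restrict hx.1 (by simp) hintg
      rw [EventuallyLE, ← restrict_Ioo_eq_restrict_Icc, ae_restrict_iff' measurableSet_Ioo]
      filter_upwards [hzm.ae_differentiableAt, hym.ae_differentiableAt] with t h1 h2 ht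
      have := hcon t ⟨ht.1, ht.2.trans_le hx.2⟩ _ _ h1.hasDerivAt h2.hasDerivAt
      have e : deriv (fun x => z x + y x) t = deriv z t + deriv y t :=
        (h1.hasDerivAt.add h2.hasDerivAt).deriv
      rw [e]
      exact this.le
    rw [intervalIntegral.integral_const, smul_eq_mul] at hle
    have := hint.2
    nlinarith
  have := tele (fun α => -(f (x0 + α * η) - k * η / 2 * (α * η) ^ 2))
    (k * η ^ 2 + k * η / 2 * η ^ 2) ?_
  · have h1 := hmax (x0 + η)
    simp only [one_mul, zero_mul, add_zero] at this
    have h2 : f (x0 + η) ≤ f x0 := h1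
    have h3 : 0 < k * η / 2 * η ^ 2 := by positivity
    nlinarith
  · intro α β hα hαβ hβ
    have h1 := hz.step (x0 + α * η) (x0 + β * η)
    have h2 := hy.step (x0 + α * η) (x0 + β * η)
    have h3 := hinc (x0 + α * η) ⟨by nlinarith, by nlinarith⟩
    have h4 : k * (β - α) * η * (2 * (x0 + α * η) + η * (x0 + α * η - x0)) ≤
      k * (β - α) * η * (z (x0 + α * η) + y (x0 + α * η)) :=
      mul_le_mul_of_nonneg_left h3
        (mul_nonneg (mul_nonneg hk.le (sub_nonneg.2 hαβ)) hη.le)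
    simp only [hf]
    nlinarith

/-- The selections are Lipschitz from the right at the maximum point. -/
theorem sel_lip {I : Set ℝ} {a a' : ℝ → ℝ} {k : ℝ} {z y : ℝ → ℝ} (hk : 0 < k)
    (hz : ArgSel I a k z) (hy : ArgSel I a' k y) {x0 : ℝ} (hS : z x0 + y x0 = 2 * x0)
    (hmax : ∀ x, (a (z x) - k / 2 * (x - z x) ^ 2) + (a' (y x) - k / 2 * (x - y x) ^ 2) ≤
      (a (z x0) - k / 2 * (x0 - z x0) ^ 2) + (a' (y x0) - k / 2 * (x0 - y x0) ^ 2))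
    {x : ℝ} (hx : x0 < x) :
    (0 ≤ z x - z x0 ∧ z x - z x0 ≤ 4 * (x - x0)) ∧
    (0 ≤ y x - y x0 ∧ y x - y x0 ≤ 4 * (x - x0)) := by
  have h1 := hz.mono hk hx.le
  have h2 := hy.mono hk hx.le
  have h3 := hz.step x (2 * x - x0)
  have h4 := hy.step x (2 * x - x0)
  have h5 := hz.step x0 x
  have h6 := hy.step x0 x
  have h7 := hmax (2 * x - x0)
  have h8 : 0 ≤ k * (x - x0) * (2 * x0 + 4 * (x - x0) - (z x + y x)) := by
    have e : k / 2 * (x0 - x) * (2 * z x0 - x0 - x) + k / 2 * (x0 - x) * (2 * y x0 - x0 - x)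
        = k * (x - x0) ^ 2 := by
      linear_combination (k * (x0 - x)) * hS
    nlinarith
  have h9 := nonneg_of_mul_nonneg_right h8 (mul_pos hk (sub_pos.2 hx))
  refine ⟨⟨by linarith, by linarith⟩, ⟨by linarith, by linarith⟩⟩

theorem quad_derivs (C p A w0 : ℝ) :
    deriv (fun w : ℝ => C + p * (w - w0) + A / 2 * (w - w0) ^ 2) w0 = p ∧
    deriv (deriv (fun w : ℝ => C + p * (w - w0) + A / 2 * (w - w0) ^ 2)) w0 = A := by
  have h : ∀ x, HasDerivAt (fun w : ℝ => C + p * (w - w0) + A / 2 * (w - w0) ^ 2)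
      (p + A * (x - w0)) x := by
    intro x
    have h1 : HasDerivAt (fun w : ℝ => w - w0) 1 x := (hasDerivAt_id x).sub_const w0
    have h2 := ((h1.const_mul p).const_add C).add ((h1.pow 2).const_mul (A / 2))
    exact h2.congr_deriv (by norm_num; ring)
  have hd : deriv (fun w : ℝ => C + p * (w - w0) + A / 2 * (w - w0) ^ 2) =
      fun x => p + A * (x - w0) := funext fun x => (h x).deriv
  refine ⟨by rw [(h w0).deriv]; ring, ?_⟩
  rw [hd]
  have h1 : HasDerivAt (fun w : ℝ => w - w0) 1 w0 := (hasDerivAt_id w0).sub_const w0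
  have h2 := (h1.const_mul A).const_add p
  rw [h2.deriv]; ring

theorem sub_pt {lam eps R r c b ws : ℝ} {u : ℝ → ℝ} (h : IsViscSubsol lam eps R r c b ws u)
    {w0 p A : ℝ} (hw : w0 ∈ Ioo b ws)
    (hj : ∀ᶠ w in 𝓝 w0, w ∈ Icc b ws → u w ≤ u w0 + p * (w - w0) + A / 2 * (w - w0) ^ 2) :
    Fop lam eps R r c w0 (u w0) p A ≤ 0 := by
  have h1 := h w0 hw (fun w : ℝ => 0 + p * (w - w0) + A / 2 * (w - w0) ^ 2) (by fun_prop) ?_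
  · rwa [(quad_derivs 0 p A w0).1, (quad_derivs 0 p A w0).2] at h1
  · rw [IsLocalMaxOn, IsMaxFilter, eventually_nhdsWithin_iff]
    filter_upwards [hj] with w hw' hwI
    have := hw' (Ioo_subset_Icc_self hwI)
    simp
    linarith

theorem super_pt {lam eps R r c b ws : ℝ} {v : ℝ → ℝ} (h : IsViscSupersol lam eps R r c b ws v)
    {w0 p A : ℝ} (hw : w0 ∈ Ioo b ws)
    (hj : ∀ᶠ w in 𝓝 w0, w ∈ Icc b ws → v w0 + p * (w - w0) + A / 2 * (w - w0) ^ 2 ≤ v w) :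
    0 ≤ Fop lam eps R r c w0 (v w0) p A := by
  have h1 := h w0 hw (fun w : ℝ => 0 + p * (w - w0) + A / 2 * (w - w0) ^ 2) (by fun_prop) ?_
  · rwa [(quad_derivs 0 p A w0).1, (quad_derivs 0 p A w0).2] at h1
  · rw [IsLocalMinOn, IsMinFilter, eventually_nhdsWithin_iff]
    filter_upwards [hj] with w hw' hwI
    have := hw' (Ioo_subset_Icc_self hwI)
    simp
    linarith

theorem fop_sub {lam eps R r c w u p A : ℝ} (hR : 0 < R) (hu : 0 < lam * u)
    (h : Fop lam eps R r c w u p A ≤ 0) :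
    0 < eps * p ^ 2 + A ∧ lam * u + (c - r * w) * p ≤ 0 ∧
    (lam * u + (c - r * w) * p) * (eps * p ^ 2 + A) + R * p ^ 2 ≤ 0 := by
  unfold Fop at h
  split_ifs at h with h1 h2
  · have h3 : lam * u + R * p ^ 2 / (eps * p ^ 2 + A) - (r * w - c) * p ≤ 0 := by exact_mod_cast h
    have h4 : 0 ≤ R * p ^ 2 / (eps * p ^ 2 + A) := by positivity
    refine ⟨h1, by linarith, ?_⟩
    have h5 : (lam * u + R * p ^ 2 / (eps * p ^ 2 + A) - (r * w - c) * p) * (eps * p ^ 2 + A) ≤ 0 :=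
      mul_nonpos_of_nonpos_of_nonneg h3 h1.le
    have h6 : R * p ^ 2 / (eps * p ^ 2 + A) * (eps * p ^ 2 + A) = R * p ^ 2 :=
      div_mul_cancel₀ _ h1.ne'
    linarith
  · have : lam * u ≤ 0 := by exact_mod_cast h
    linarith
  · simp at h

theorem fop_super {lam eps R r c w u p A : ℝ} (h1 : 0 < eps * p ^ 2 + A)
    (h : 0 ≤ Fop lam eps R r c w u p A) :
    0 ≤ (lam * u + (c - r * w) * p) * (eps * p ^ 2 + A) + R * p ^ 2 := by
  unfold Fop at h
  rw [if_pos h1] at h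
  have h3 : 0 ≤ lam * u + R * p ^ 2 / (eps * p ^ 2 + A) - (r * w - c) * p := by exact_mod_cast h
  have h5 := mul_nonneg h3 h1.le
  have h6 : R * p ^ 2 / (eps * p ^ 2 + A) * (eps * p ^ 2 + A) = R * p ^ 2 :=
    div_mul_cancel₀ _ h1.ne'
  linarith

theorem exists_sel {b ws k x0 z0 : ℝ} {a : ℝ → ℝ} (ha : UpperSemicontinuousOn a (Icc b ws))
    (hz0 : z0 ∈ Icc b ws)
    (hm : ∀ w ∈ Icc b ws, a w - k / 2 * (x0 - w) ^ 2 ≤ a z0 - k / 2 * (x0 - z0) ^ 2) :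
    ∃ z, ArgSel (Icc b ws) a k z ∧ z x0 = z0 := by
  have : ∀ x, ∃ ζ, (x = x0 → ζ = z0) ∧ ζ ∈ Icc b ws ∧
      ∀ w ∈ Icc b ws, a w - k / 2 * (x - w) ^ 2 ≤ a ζ - k / 2 * (x - ζ) ^ 2 := by
    intro x
    by_cases hx : x = x0
    · subst hx
      exact ⟨z0, fun _ => rfl, hz0, hm⟩
    · have hc : ContinuousOn (fun w : ℝ => - (k / 2 * (x - w) ^ 2)) (Icc b ws) := by fun_prop
      obtain ⟨ζ, h1, h2⟩ := (ha.add hc.upperSemicontinuousOn).exists_isMaxOn ⟨z0, hz0⟩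
        isCompact_Icc
      refine ⟨ζ, fun h => absurd h hx, h1, fun w hw => ?_⟩
      have := h2 hw
      simp at this
      linarith
  choose z h1 h2 using this
  exact ⟨z, h2, h1 x0 rfl⟩

theorem core {lam eps R r c b ws k z0 y0 : ℝ} {u v : ℝ → ℝ}
    (hR : 0 < R) (hlam : 0 < lam) (hk : 0 < k)
    (hu : UpperSemicontinuousOn u (Icc b ws)) (hv : LowerSemicontinuousOn v (Icc b ws))
    (hsub : IsViscSubsol lam eps R r c b ws u)
    (hsuper : IsViscSupersol lam eps R r c b ws v)
    (hz0 : z0 ∈ Ioo b ws) (hy0 : y0 ∈ Ioo b ws)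
    (hmax : ∀ z ∈ Icc b ws, ∀ y ∈ Icc b ws,
      u z - v y - k / 4 * (z - y) ^ 2 ≤ u z0 - v y0 - k / 4 * (z0 - y0) ^ 2)
    (hu0 : 0 < u z0) :
    lam * (u z0 - v y0) ≤ r * k / 2 * (z0 - y0) ^ 2 := by
  obtain ⟨x0, hx0⟩ : ∃ x0, x0 = (z0 + y0) / 2 := ⟨_, rfl⟩
  have hz0' := Ioo_subset_Icc_self hz0
  have hy0' := Ioo_subset_Icc_self hy0
  have hnv : UpperSemicontinuousOn (fun w => - v w) (Icc b ws) := by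
    intro x hx y hy
    have := hv x hx (-y) (by linarith)
    filter_upwards [this] with w hw
    linarith
  obtain ⟨z, hz, hzx⟩ := exists_sel (k := k) (x0 := x0) hu hz0' (by
    intro w hw
    have := hmax w hw y0 hy0'
    subst hx0
    nlinarith [sq_nonneg (w - z0), mul_nonneg hk.le (sq_nonneg (w - z0))])
  obtain ⟨y, hy, hyx⟩ := exists_sel (k := k) (x0 := x0) hnv hy0' (by
    intro w hw
    have := hmax z0 hz0' w hw
    subst hx0
    nlinarith [sq_nonneg (w - y0), mul_nonneg hk.le (sq_nonneg (w - y0))])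
  have hS : z x0 + y x0 = 2 * x0 := by rw [hzx, hyx, hx0]; ring
  have hmx : ∀ x, (u (z x) - k / 2 * (x - z x) ^ 2) + (- v (y x) - k / 2 * (x - y x) ^ 2) ≤
      (u (z x0) - k / 2 * (x0 - z x0) ^ 2) + (- v (y x0) - k / 2 * (x0 - y x0) ^ 2) := by
    intro x
    have := hmax (z x) (hz x).1 (y x) (hy x).1
    rw [hzx, hyx, hx0]
    nlinarith [mul_nonneg hk.le (sq_nonneg (2 * x - z x - y x))]
  have hη : ∀ n : ℕ, (0 : ℝ) < 1 / ((n : ℝ) + 1) := fun n => by positivity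
  have hηlim : Tendsto (fun n : ℕ => 1 / ((n : ℝ) + 1)) atTop (𝓝 0) :=
    tendsto_one_div_add_atTop_nhds_zero_nat
  choose x hx Dz Dy hDz hDy hD using fun n : ℕ => jensen hk hz hy hS hmx (hη n)
  have hDz0 : ∀ n, 0 ≤ Dz n := fun n => by
    rw [← (hDz n).deriv]; exact (hz.mono hk).deriv_nonneg
  have hDy0 : ∀ n, 0 ≤ Dy n := fun n => by
    rw [← (hDy n).deriv]; exact (hy.mono hk).deriv_nonneg
  have hDz3 : ∀ n, Dz n ∈ Icc (0 : ℝ) 3 := fun n => by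
    refine ⟨hDz0 n, ?_⟩
    have h1 : 1 / ((n : ℝ) + 1) ≤ 1 := by
      rw [div_le_one (by positivity)]
      have : (0 : ℝ) ≤ n := by positivity
      linarith
    linarith [hD n, hDy0 n]
  obtain ⟨D, -, φ, hφ, hDlim⟩ := isCompact_Icc.tendsto_subseq hDz3
  have hφt := hφ.tendsto_atTop
  -- the vanishing error along the subsequence
  obtain ⟨e, he⟩ : ∃ e : ℕ → ℝ, e = fun n => 1 / ((φ n : ℝ) + 1) := ⟨_, rfl⟩
  have helim : Tendsto e atTop (𝓝 0) := by rw [he]; exact hηlim.comp hφt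
  have he0 : ∀ n, 0 < e n := fun n => by rw [he]; exact hη _
  have hlip : ∀ n, (0 ≤ z (x (φ n)) - z0 ∧ z (x (φ n)) - z0 ≤ 4 * e n) ∧
      (0 ≤ y (x (φ n)) - y0 ∧ y (x (φ n)) - y0 ≤ 4 * e n) := by
    intro n
    have h1 := sel_lip hk hz hy hS hmx (hx (φ n)).1
    have h2 : x (φ n) - x0 ≤ e n := by rw [he]; linarith [(hx (φ n)).2]
    rw [hzx, hyx] at h1
    exact ⟨⟨h1.1.1, by linarith⟩, ⟨h1.2.1, by linarith⟩⟩
  have hxlim : Tendsto (fun n => x (φ n)) atTop (𝓝 x0) := by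
    refine tendsto_of_tendsto_of_tendsto_of_le_of_le tendsto_const_nhds
      (by simpa using helim.const_add x0) (fun n => (hx (φ n)).1.le) (fun n => ?_)
    rw [he]; exact (hx (φ n)).2.le
  have hzlim : Tendsto (fun n => z (x (φ n))) atTop (𝓝 z0) := by
    refine tendsto_of_tendsto_of_tendsto_of_le_of_le tendsto_const_nhds
      (by simpa using (helim.const_mul 4).const_add z0) (fun n => ?_) (fun n => ?_)
    · linarith [(hlip n).1.1]
    · linarith [(hlip n).1.2]
  have hylim : Tendsto (fun n => y (x (φ n))) atTop (𝓝 y0) := by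
    refine tendsto_of_tendsto_of_tendsto_of_le_of_le tendsto_const_nhds
      (by simpa using (helim.const_mul 4).const_add y0) (fun n => ?_) (fun n => ?_)
    · linarith [(hlip n).2.1]
    · linarith [(hlip n).2.2]
  -- names for the jets
  obtain ⟨p, hp⟩ : ∃ p : ℕ → ℝ, p = fun n => k * (z (x (φ n)) - x (φ n)) := ⟨_, rfl⟩
  obtain ⟨q, hq⟩ : ∃ q : ℕ → ℝ, q = fun n => k * (x (φ n) - y (x (φ n))) := ⟨_, rfl⟩
  obtain ⟨A, hA⟩ : ∃ A : ℕ → ℝ, A = fun n => k * (Dz (φ n) - 1) + e n := ⟨_, rfl⟩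
  obtain ⟨B, hB⟩ : ∃ B : ℕ → ℝ, B = fun n => k * (Dz (φ n) - 1) - k * e n - e n := ⟨_, rfl⟩
  obtain ⟨l, hl⟩ : ∃ l : ℕ → ℝ,
    l = fun n => u z0 - k / 2 * (x (φ n) - z0) ^ 2 + k / 2 * (x (φ n) - z (x (φ n))) ^ 2 := ⟨_, rfl⟩
  obtain ⟨m, hm⟩ : ∃ m : ℕ → ℝ,
    m = fun n => v y0 + k / 2 * (x (φ n) - y0) ^ 2 - k / 2 * (x (φ n) - y (x (φ n))) ^ 2 := ⟨_, rfl⟩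
  obtain ⟨P, hP⟩ : ∃ P : ℝ, P = k * (z0 - x0) := ⟨_, rfl⟩
  have hP' : P = k * (x0 - y0) := by rw [hP, hx0]; ring
  have hplim : Tendsto p atTop (𝓝 P) := by
    rw [hp, hP]; exact (hzlim.sub hxlim).const_mul k
  have hqlim : Tendsto q atTop (𝓝 P) := by
    rw [hq, hP']; exact (hxlim.sub hylim).const_mul k
  have hAlim : Tendsto A atTop (𝓝 (k * (D - 1))) := by
    rw [hA]; simpa using ((hDlim.sub_const 1).const_mul k).add helim
  have hBlim : Tendsto B atTop (𝓝 (k * (D - 1))) := by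
    rw [hB]; simpa using (((hDlim.sub_const 1).const_mul k).sub (helim.const_mul k)).sub helim
  have hllim : Tendsto l atTop (𝓝 (u z0)) := by
    rw [hl]
    have := ((((hxlim.sub_const z0).pow 2).const_mul (k / 2)).const_sub (u z0)).add
      (((hxlim.sub hzlim).pow 2).const_mul (k / 2))
    simpa using this
  have hmlim : Tendsto m atTop (𝓝 (v y0)) := by
    rw [hm]
    have := ((((hxlim.sub_const y0).pow 2).const_mul (k / 2)).const_add (v y0)).sub
      (((hxlim.sub hylim).pow 2).const_mul (k / 2))
    simpa using this
  have hlu : ∀ n, l n ≤ u (z (x (φ n))) := by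
    intro n
    have := (hz (x (φ n))).2 z0 hz0'
    rw [hl]; linarith
  have hmv : ∀ n, v (y (x (φ n))) ≤ m n := by
    intro n
    have := (hy (x (φ n))).2 y0 hy0'
    rw [hm]; linarith
  have hzin : ∀ᶠ n in atTop, z (x (φ n)) ∈ Ioo b ws := hzlim (isOpen_Ioo.mem_nhds hz0)
  have hyin : ∀ᶠ n in atTop, y (x (φ n)) ∈ Ioo b ws := hylim (isOpen_Ioo.mem_nhds hy0)
  have hlpos : ∀ᶠ n in atTop, 0 < l n := hllim (isOpen_Ioi.mem_nhds hu0)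
  have hSub : ∀ᶠ n in atTop, 0 < eps * p n ^ 2 + A n ∧
      lam * l n + (c - r * z (x (φ n))) * p n ≤ 0 ∧
      (lam * l n + (c - r * z (x (φ n))) * p n) * (eps * p n ^ 2 + A n) + R * p n ^ 2 ≤ 0 := by
    filter_upwards [hzin, hlpos] with n h1 h2
    have h3 : Fop lam eps R r c (z (x (φ n))) (u (z (x (φ n)))) (p n) (A n) ≤ 0 := by
      apply sub_pt hsub h1
      rw [hp]
      exact hz.jet hk (hDz (φ n)) (by rw [hA]; linarith [he0 n])
    obtain ⟨h4, h5, h6⟩ := fop_sub hR (mul_pos hlam (h2.trans_le (hlu n))) h3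
    have h7 : lam * l n ≤ lam * u (z (x (φ n))) := mul_le_mul_of_nonneg_left (hlu n) hlam.le
    refine ⟨h4, by linarith, ?_⟩
    nlinarith
  have hSup : ∀ᶠ n in atTop, 0 < eps * q n ^ 2 + B n →
      0 ≤ (lam * m n + (c - r * y (x (φ n))) * q n) * (eps * q n ^ 2 + B n) + R * q n ^ 2 := by
    filter_upwards [hyin] with n h1 h2
    have h3 : 0 ≤ Fop lam eps R r c (y (x (φ n))) (v (y (x (φ n)))) (q n) (B n) := by
      apply super_pt hsuper h1
      have hj := hy.jet hk (hDy (φ n)) (A := - B n) (by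
        have := hD (φ n)
        rw [hB]
        have e1 : 1 / ((φ n : ℝ) + 1) = e n := by rw [he]
        rw [e1] at this
        nlinarith [he0 n])
      filter_upwards [hj] with w hw hwI
      have := hw hwI
      rw [hq]
      linarith
    have h6 := fop_super h2 h3
    have h7 : lam * v (y (x (φ n))) ≤ lam * m n := mul_le_mul_of_nonneg_left (hmv n) hlam.le
    nlinarith
  obtain ⟨Q, hQ⟩ : ∃ Q : ℝ, Q = eps * P ^ 2 + k * (D - 1) := ⟨_, rfl⟩
  have hQA : Tendsto (fun n => eps * p n ^ 2 + A n) atTop (𝓝 Q) := by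
    rw [hQ]; exact ((hplim.pow 2).const_mul eps).add hAlim
  have hQB : Tendsto (fun n => eps * q n ^ 2 + B n) atTop (𝓝 Q) := by
    rw [hQ]; exact ((hqlim.pow 2).const_mul eps).add hBlim
  have hX : Tendsto (fun n => lam * l n + (c - r * z (x (φ n))) * p n) atTop
      (𝓝 (lam * u z0 + (c - r * z0) * P)) :=
    (hllim.const_mul lam).add (((hzlim.const_mul r).const_sub c).mul hplim)
  have hY : Tendsto (fun n => lam * m n + (c - r * y (x (φ n))) * q n) atTop
      (𝓝 (lam * v y0 + (c - r * y0) * P)) :=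
    (hmlim.const_mul lam).add (((hylim.const_mul r).const_sub c).mul hqlim)
  have hQ0 : 0 ≤ Q := ge_of_tendsto hQA (hSub.mono fun n h => h.1.le)
  have hX0 : lam * u z0 + (c - r * z0) * P ≤ 0 := le_of_tendsto hX (hSub.mono fun n h => h.2.1)
  have hXQ : (lam * u z0 + (c - r * z0) * P) * Q + R * P ^ 2 ≤ 0 :=
    le_of_tendsto ((hX.mul hQA).add ((hplim.pow 2).const_mul R)) (hSub.mono fun n h => h.2.2)
  have hPne : P ≠ 0 := by
    rintro h
    rw [h] at hX0
    have := mul_pos hlam hu0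
    linarith
  have hQpos : 0 < Q := by
    rcases hQ0.eq_or_lt with h | h
    · rw [← h] at hXQ
      have : 0 < R * P ^ 2 := by positivity
      linarith
    · exact h
  have hYQ : 0 ≤ (lam * v y0 + (c - r * y0) * P) * Q + R * P ^ 2 := by
    refine ge_of_tendsto ((hY.mul hQB).add ((hqlim.pow 2).const_mul R)) ?_
    filter_upwards [hSup, hQB (isOpen_Ioi.mem_nhds hQpos)] with n h1 h2
    exact h1 h2
  have hfin : 0 ≤ Q * (r * (z0 - y0) * P - lam * (u z0 - v y0)) := by nlinarith
  have hfin2 := nonneg_of_mul_nonneg_right hfin hQpos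
  have e1 : r * (z0 - y0) * P = r * k / 2 * (z0 - y0) ^ 2 := by rw [hP, hx0]; ring
  linarith

theorem exists_good {b ws r lam : ℝ} {u v : ℝ → ℝ} (hb : b < ws) (hr : 0 < r) (hlam : 0 < lam)
    (hu : UpperSemicontinuousOn u (Icc b ws)) (hv : LowerSemicontinuousOn v (Icc b ws))
    (hubd : ∃ M, ∀ w ∈ Icc b ws, |u w| ≤ M) (hvbd : ∃ M, ∀ w ∈ Icc b ws, |v w| ≤ M)
    (hub : u b ≤ v b) (huws : u ws ≤ v ws) (hpos : ∃ w ∈ Icc b ws, v w < u w) :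
    ∃ k > 0, ∃ z0 ∈ Ioo b ws, ∃ y0 ∈ Ioo b ws,
      (∀ z ∈ Icc b ws, ∀ y ∈ Icc b ws,
        u z - v y - k / 4 * (z - y) ^ 2 ≤ u z0 - v y0 - k / 4 * (z0 - y0) ^ 2) ∧
      v y0 < u z0 ∧ r * k / 2 * (z0 - y0) ^ 2 < lam * (u z0 - v y0) := by
  have hnv : UpperSemicontinuousOn (fun w => - v w) (Icc b ws) := by
    intro x hx y hy
    have := hv x hx (-y) (by linarith)
    filter_upwards [this] with w hw
    linarith
  obtain ⟨w1, hw1, hw1'⟩ := hpos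
  obtain ⟨xm, hxm, hxmax⟩ := (hu.add hnv).exists_isMaxOn ⟨w1, hw1⟩ isCompact_Icc
  obtain ⟨M, hM⟩ : ∃ M, M = u xm - v xm := ⟨_, rfl⟩
  have hMmax : ∀ w ∈ Icc b ws, u w - v w ≤ M := by
    intro w hw
    have := hxmax hw
    simp at this
    linarith
  have hM0 : 0 < M := by linarith [hMmax w1 hw1]
  have hu2 : UpperSemicontinuousOn (fun q : ℝ × ℝ => u q.1) (Icc b ws ×ˢ Icc b ws) :=
    hu.comp continuousOn_fst (fun q hq => hq.1)
  have hv2 : UpperSemicontinuousOn (fun q : ℝ × ℝ => - v q.2) (Icc b ws ×ˢ Icc b ws) :=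
    hnv.comp continuousOn_snd (fun q hq => hq.2)
  have hcpt : IsCompact (Icc b ws ×ˢ Icc b ws) := isCompact_Icc.prod isCompact_Icc
  have hex : ∀ n : ℕ, ∃ q ∈ Icc b ws ×ˢ Icc b ws, ∀ z ∈ Icc b ws, ∀ y ∈ Icc b ws,
      u z - v y - ((n : ℝ) + 1) / 4 * (z - y) ^ 2 ≤
        u q.1 - v q.2 - ((n : ℝ) + 1) / 4 * (q.1 - q.2) ^ 2 := by
    intro n
    have hc : ContinuousOn (fun q : ℝ × ℝ => - (((n : ℝ) + 1) / 4 * (q.1 - q.2) ^ 2))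
      (Icc b ws ×ˢ Icc b ws) := by fun_prop
    obtain ⟨q, hq, hq'⟩ := ((hu2.add hv2).add hc.upperSemicontinuousOn).exists_isMaxOn
      (⟨(w1, w1), hw1, hw1⟩ : (Icc b ws ×ˢ Icc b ws).Nonempty) hcpt
    refine ⟨q, hq, fun z hz y hy => ?_⟩
    have := hq' (show (z, y) ∈ Icc b ws ×ˢ Icc b ws from ⟨hz, hy⟩)
    simp at this
    linarith
  choose q hq hqmax using hex
  have hbase : ∀ n : ℕ, M + ((n : ℝ) + 1) / 4 * ((q n).1 - (q n).2) ^ 2 ≤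
      u (q n).1 - v (q n).2 := by
    intro n
    have := hqmax n xm hxm xm hxm
    simp at this
    linarith
  obtain ⟨qb, hqb, φ, hφ, hlim⟩ := hcpt.tendsto_subseq hq
  have h1lim : Tendsto (fun n => (q (φ n)).1) atTop (𝓝 qb.1) :=
    (continuous_fst.tendsto _).comp hlim
  have h2lim : Tendsto (fun n => (q (φ n)).2) atTop (𝓝 qb.2) :=
    (continuous_snd.tendsto _).comp hlim
  have heq : qb.1 = qb.2 := by
    obtain ⟨M1, hM1⟩ := hubd
    obtain ⟨M2, hM2⟩ := hvbd
    have hle : ∀ n, ((q (φ n)).1 - (q (φ n)).2) ^ 2 ≤ 4 * (M1 + M2) / ((φ n : ℝ) + 1) := by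
      intro n
      have h1 := hbase (φ n)
      have h2 := (abs_le.1 (hM1 _ (hq (φ n)).1)).2
      have h3 := (abs_le.1 (hM2 _ (hq (φ n)).2)).1
      rw [le_div_iff₀ (by positivity)]
      linarith
    have h0 : Tendsto (fun n => 4 * (M1 + M2) / ((φ n : ℝ) + 1)) atTop (𝓝 0) := by
      have h := (tendsto_one_div_add_atTop_nhds_zero_nat (𝕜 := ℝ)).comp hφ.tendsto_atTop
      have := h.const_mul (4 * (M1 + M2))
      simpa [Function.comp_def, div_eq_mul_inv] using this
    have h3 := le_of_tendsto_of_tendsto' ((h1lim.sub h2lim).pow 2) h0 hle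
    have h4 : qb.1 - qb.2 = 0 := pow_eq_zero_iff (two_ne_zero) |>.1 (le_antisymm h3 (sq_nonneg _))
    linarith
  have h1w : Tendsto (fun n => (q (φ n)).1) atTop (𝓝[Icc b ws] qb.1) :=
    tendsto_nhdsWithin_iff.2 ⟨h1lim, Eventually.of_forall fun n => (hq (φ n)).1⟩
  have h2w : Tendsto (fun n => (q (φ n)).2) atTop (𝓝[Icc b ws] qb.2) :=
    tendsto_nhdsWithin_iff.2 ⟨h2lim, Eventually.of_forall fun n => (hq (φ n)).2⟩
  have hev : ∀ δ > 0, ∀ᶠ n in atTop, u (q (φ n)).1 - v (q (φ n)).2 < u qb.1 - v qb.1 + δ := by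
    intro δ hδ
    have a1 := h1w.eventually (hu qb.1 hqb.1 (u qb.1 + δ / 2) (by linarith))
    have a2 := h2w.eventually (hv qb.2 hqb.2 (v qb.2 - δ / 2) (by linarith))
    filter_upwards [a1, a2] with n b1 b2
    rw [← heq] at b2
    linarith
  have hqbM : M ≤ u qb.1 - v qb.1 := by
    by_contra hlt
    push Not at hlt
    obtain ⟨n, hn⟩ := (hev (M - (u qb.1 - v qb.1)) (by linarith)).exists
    have h1 := hbase (φ n)
    have h2 : 0 ≤ ((φ n : ℝ) + 1) / 4 * ((q (φ n)).1 - (q (φ n)).2) ^ 2 := by positivity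
    linarith
  have hin : qb.1 ∈ Ioo b ws := by
    have h1 := hqb.1
    refine ⟨lt_of_le_of_ne h1.1 ?_, lt_of_le_of_ne h1.2 ?_⟩
    · intro h; rw [← h] at hqbM; linarith
    · intro h; rw [h] at hqbM; linarith
  have hin2 : qb.2 ∈ Ioo b ws := heq ▸ hin
  have hδ : 0 < lam * M / (2 * r) := by positivity
  obtain ⟨n, c1, c2, c3⟩ := ((h1lim.eventually (isOpen_Ioo.mem_nhds hin)).and
    ((h2lim.eventually (isOpen_Ioo.mem_nhds hin2)).and (hev _ hδ))).exists
  have h1 := hbase (φ n)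
  have h2 : 0 ≤ ((φ n : ℝ) + 1) / 4 * ((q (φ n)).1 - (q (φ n)).2) ^ 2 := by positivity
  have h3 := hMmax _ hqb.1
  refine ⟨(φ n : ℝ) + 1, by positivity, (q (φ n)).1, c1, (q (φ n)).2, c2, hqmax (φ n),
    by linarith, ?_⟩
  have h4 : ((φ n : ℝ) + 1) / 4 * ((q (φ n)).1 - (q (φ n)).2) ^ 2 < lam * M / (2 * r) := by
    linarith
  rw [lt_div_iff₀ (by positivity)] at h4
  have h5 : lam * M ≤ lam * (u (q (φ n)).1 - v (q (φ n)).2) :=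
    mul_le_mul_of_nonneg_left (by linarith) hlam.le
  linarith

/-- Comparison principle for the robust HJB operator `F`. -/
theorem stmt_5 (r μ σ c b ws R lam eps : ℝ)
    (hr : 0 < r) (hμ : r < μ) (hσ : 0 < σ) (hc : 0 < c)
    (hws : ws = c / r) (hb : b < ws)
    (hR : R = (1 / 2) * ((μ - r) / σ) ^ 2)
    (hlam : 0 < lam) (heps : 0 ≤ eps)
    (u v : ℝ → ℝ)
    (hu_usc : UpperSemicontinuousOn u (Set.Icc b ws))
    (hu_bdd : ∃ M, ∀ w ∈ Set.Icc b ws, |u w| ≤ M)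
    (hv_lsc : LowerSemicontinuousOn v (Set.Icc b ws))
    (hv_bdd : ∃ M, ∀ w ∈ Set.Icc b ws, |v w| ≤ M)
    (hsub : IsViscSubsol lam eps R r c b ws u)
    (hsuper : IsViscSupersol lam eps R r c b ws v)
    (hsign : (∀ w ∈ Set.Ioo b ws, 0 ≤ v w) ∨ (∀ w ∈ Set.Ioo b ws, 0 < u w))
    (hub : u b ≤ v b) (huws : u ws ≤ v ws) :
    ∀ w ∈ Set.Icc b ws, u w ≤ v w := by
  have hR0 : 0 < R := by
    rw [hR]
    have : 0 < (μ - r) / σ := div_pos (by linarith) hσ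
    positivity
  by_contra hcon
  push Not at hcon
  obtain ⟨k, hk, z0, hz0, y0, hy0, hmax, hlt, hgap⟩ :=
    exists_good hb hr hlam hu_usc hv_lsc hu_bdd hv_bdd hub huws hcon
  have hu0 : 0 < u z0 := by
    rcases hsign with h | h
    · exact (h y0 hy0).trans_lt hlt
    · exact h z0 hz0
  have := core hR0 hlam hk hu_usc hv_lsc hsub hsuper hz0 hy0 hmax hu0
  linarith
end

section
/- Let λ > 0 and ε ≥ 0. Suppose u₁, u₂ : [b, w_s] → ℝ are bounded, non-negative, continuous viscosity solutions of F = 0 on (b, w_s) satisfying u₁(b) = u₂(b) = 1 and u₁(w_s) = u₂(w_s) = 0. Then u₁ = u₂ on [b, w_s]. -/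
open Set Filter Topology

lemma Fop_le_zero {lam eps R r c w u p A : ℝ} (hR : 0 < R)
    (h : Fop lam eps R r c w u p A ≤ 0) :
    0 ≤ eps * p ^ 2 + A ∧ lam * u + (c - r * w) * p ≤ 0 ∧
    (0 < eps * p ^ 2 + A →
      lam * u + R * p ^ 2 / (eps * p ^ 2 + A) + (c - r * w) * p ≤ 0) := by
  unfold Fop at h
  split_ifs at h with h1 h2
  · have h' : lam * u + R * p ^ 2 / (eps * p ^ 2 + A) - (r * w - c) * p ≤ 0 := by
      exact_mod_cast h
    have h3 : 0 ≤ R * p ^ 2 / (eps * p ^ 2 + A) := by positivity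
    exact ⟨h1.le, by nlinarith, fun _ => by nlinarith⟩
  · have h' : lam * u ≤ 0 := by exact_mod_cast h
    refine ⟨h2.1.ge, by rw [h2.2]; linarith, fun h => absurd h h1⟩
  · simp at h

lemma zero_le_Fop {lam eps R r c w u p A : ℝ}
    (h : 0 ≤ Fop lam eps R r c w u p A) (h1 : 0 < eps * p ^ 2 + A) :
    0 ≤ lam * u + R * p ^ 2 / (eps * p ^ 2 + A) + (c - r * w) * p := by
  unfold Fop at h
  rw [if_pos h1] at h
  have h' : 0 ≤ lam * u + R * p ^ 2 / (eps * p ^ 2 + A) - (r * w - c) * p := by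
    exact_mod_cast h
  nlinarith

lemma quad_hasDeriv (α β γ x w : ℝ) :
    HasDerivAt (fun w => α + β * (w - x) + γ * (w - x) ^ 2) (β + 2 * γ * (w - x)) w := by
  have h := (hasDerivAt_id w).sub_const x
  have := ((h.const_mul β).const_add α).fun_add ((h.fun_pow 2).const_mul γ)
  refine this.congr_deriv ?_
  simp only [id, Nat.cast_ofNat]; ring

lemma lin_hasDeriv (β γ x w : ℝ) :
    HasDerivAt (fun w => β + 2 * γ * (w - x)) (2 * γ) w := by
  simpa using (((hasDerivAt_id w).sub_const x).const_mul (2 * γ)).const_add β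

lemma quad_deriv (α β γ x : ℝ) :
    deriv (fun w => α + β * (w - x) + γ * (w - x) ^ 2) = fun w => β + 2 * γ * (w - x) :=
  funext fun w => (quad_hasDeriv α β γ x w).deriv

lemma quad_deriv2 (α β γ x w : ℝ) :
    deriv (deriv (fun w => α + β * (w - x) + γ * (w - x) ^ 2)) w = 2 * γ := by
  rw [quad_deriv]; exact (lin_hasDeriv β γ x w).deriv

lemma sub_quad {lam eps R r c b ws : ℝ} {u : ℝ → ℝ} (hR : 0 < R)
    (hu : IsViscSubsol lam eps R r c b ws u) {z : ℝ} (hz : z ∈ Ioo b ws) (α β γ x : ℝ)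
    (hm : IsLocalMax (fun w => u w - (α + β * (w - x) + γ * (w - x) ^ 2)) z)
    (p : ℝ) (hp : p = β + 2 * γ * (z - x)) :
    lam * u z + (c - r * z) * p ≤ 0 ∧ (0 < eps * p ^ 2 + 2 * γ →
      lam * u z + R * p ^ 2 / (eps * p ^ 2 + 2 * γ) + (c - r * z) * p ≤ 0) := by
  have := hu z hz (fun w => α + β * (w - x) + γ * (w - x) ^ 2)
    (by fun_prop) (hm.on _)
  rw [quad_deriv2, quad_deriv] at this
  subst hp
  exact (Fop_le_zero hR this).2

lemma super_quad {lam eps R r c b ws : ℝ} {u : ℝ → ℝ}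
    (hu : IsViscSupersol lam eps R r c b ws u) {z : ℝ} (hz : z ∈ Ioo b ws) (α β γ x : ℝ)
    (hm : IsLocalMin (fun w => u w - (α + β * (w - x) + γ * (w - x) ^ 2)) z)
    (p : ℝ) (hp : p = β + 2 * γ * (z - x)) (h : 0 < eps * p ^ 2 + 2 * γ) :
      0 ≤ lam * u z + R * p ^ 2 / (eps * p ^ 2 + 2 * γ) + (c - r * z) * p := by
  have := hu z hz (fun w => α + β * (w - x) + γ * (w - x) ^ 2)
    (by fun_prop) (hm.on _)
  rw [quad_deriv2, quad_deriv] at this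
  subst hp
  exact zero_le_Fop this h

set_option maxHeartbeats 1000000 in
/-- The exponential transform of a subsolution is convex. -/
lemma sub_convex {lam eps R r c b ws : ℝ} {u : ℝ → ℝ} (hR : 0 < R) (heps : 0 ≤ eps)
    (hu : IsViscSubsol lam eps R r c b ws u) (hc : ContinuousOn u (Ioo b ws)) :
    ConvexOn ℝ (Ioo b ws) (fun w => Real.exp ((eps + 1) * u w)) := by
  set k := eps + 1 with hk
  have hk0 : 0 < k := by linarith
  refine LinearOrder.convexOn_of_lt (convex_Ioo b ws) ?_
  intro s hs t ht hst a a' ha ha' haa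
  by_contra! hcon
  simp only [smul_eq_mul] at hcon
  set y := a * s + a' * t with hy
  have hys : y - s = a' * (t - s) := by
    have : a = 1 - a' := by linarith
    rw [hy, this]; ring
  have hty : t - y = a * (t - s) := by
    have : a' = 1 - a := by linarith
    rw [hy, this]; ring
  have hts : 0 < t - s := by linarith
  have hsy : s < y := by nlinarith
  have hyt : y < t := by nlinarith
  set Vs := Real.exp (k * u s) with hVs
  set Vt := Real.exp (k * u t) with hVt
  have hVs0 : 0 < Vs := Real.exp_pos _
  have hVt0 : 0 < Vt := Real.exp_pos _
  set V := Real.exp (k * u y) with hV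
  set κ := (V - (a * Vs + a' * Vt)) / (2 * (y - s) * (t - y)) with hκ
  have hκ0 : 0 < κ := by
    apply div_pos (by linarith)
    have : 0 < y - s := by linarith
    have : 0 < t - y := by linarith
    positivity
  have hκ1 : κ * ((y - s) * (t - y)) = (V - (a * Vs + a' * Vt)) / 2 := by
    rw [hκ]
    have : y - s ≠ 0 := by linarith
    have : t - y ≠ 0 := by linarith
    field_simp
  set m := (Vt - Vs) / (t - s) with hm
  have hm1 : m * (t - s) = Vt - Vs := by rw [hm]; field_simp
  set ψ : ℝ → ℝ := fun w => Vs + (m + κ * (t - s)) * (w - s) + (-κ) * (w - s) ^ 2 with hψ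
  have hψ' : ∀ w, ψ w * (t - s) = Vs * (t - w) + Vt * (w - s)
      + κ * ((w - s) * (t - w)) * (t - s) := by
    intro w
    have : ψ w * (t - s) = Vs * (t - s) + (m * (t - s)) * (w - s) + 
      κ * ((w - s) * (t - w)) * (t - s) := by simp only [hψ]; ring
    rw [this, hm1]; ring
  have hψpos : ∀ w ∈ Icc s t, 0 < ψ w := by
    intro w hw
    have h1 : 0 ≤ w - s := by linarith [hw.1]
    have h2 : 0 ≤ t - w := by linarith [hw.2]
    have h3 : 0 < Vs * (t - w) + Vt * (w - s) := by
      rcases h1.eq_or_lt with h | h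
      · have : 0 < t - w := by linarith
        positivity
      · positivity
    have : 0 < ψ w * (t - s) := by rw [hψ']; positivity
    exact pos_of_mul_pos_left this hts.le
  have hψs : ψ s = Vs := by simp [hψ]
  have hψt : ψ t = Vt := by
    have := hψ' t
    have h2 : ψ t * (t - s) = Vt * (t - s) := by rw [this]; ring
    exact mul_right_cancel₀ hts.ne' h2
  have hψy : ψ y < V := by
    have h := hψ' y
    rw [hκ1, hys, hty] at h
    have h2 : ψ y * (t - s) = (a * Vs + a' * Vt + (V - (a * Vs + a' * Vt)) / 2) * (t - s) := by
      rw [h]; ring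
    have := mul_right_cancel₀ hts.ne' h2
    rw [this]; linarith
  set φ : ℝ → ℝ := fun w => Real.log (ψ w) / k with hφ
  have hψc : Continuous ψ := by simp only [hψ]; fun_prop
  have hsub : Icc s t ⊆ Ioo b ws := fun w hw => ⟨hs.1.trans_le hw.1, hw.2.trans_lt ht.2⟩
  have hcont : ContinuousOn (fun w => u w - φ w) (Icc s t) := by
    apply (hc.mono hsub).sub
    exact (hψc.continuousOn.log fun w hw => (hψpos w hw).ne').div_const _
  obtain ⟨z, hz, hzm⟩ := isCompact_Icc.exists_isMaxOn ⟨s, left_mem_Icc.2 hst.le⟩ hcont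
  have hfs : u s - φ s = 0 := by
    simp only [hφ, hψs, hVs, Real.log_exp]; field_simp; ring
  have hft : u t - φ t = 0 := by
    simp only [hφ, hψt, hVt, Real.log_exp]; field_simp; ring
  have hfy : 0 < u y - φ y := by
    have h1 : Real.log (ψ y) < k * u y := by
      rw [← Real.log_exp (k * u y)]
      exact Real.log_lt_log (hψpos y ⟨hsy.le, hyt.le⟩) hψy
    have : φ y < u y := by
      simp only [hφ]; rw [div_lt_iff₀ hk0]; linarith
    linarith
  have hfz : 0 < u z - φ z := hfy.trans_le (hzm ⟨hsy.le, hyt.le⟩)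
  have hzs : s < z := lt_of_le_of_ne hz.1 (by rintro rfl; linarith)
  have hzt : z < t := lt_of_le_of_ne hz.2 (by rintro rfl; linarith)
  have hloc : IsLocalMax (fun w => u w - φ w) z := hzm.isLocalMax (Icc_mem_nhds hzs hzt)
  have hN := hψpos z hz
  have hψcd : ContDiffAt ℝ 2 ψ z := by simp only [hψ]; fun_prop
  have hφcd : ContDiffAt ℝ 2 φ z := (hψcd.log hN.ne').div_const _
  have hF := hu z (hsub hz) φ hφcd (hloc.on _)
  have hψd : ∀ w, HasDerivAt ψ ((m + κ * (t - s)) + 2 * (-κ) * (w - s)) w :=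
    fun w => quad_hasDeriv _ _ _ _ _
  have hev : ∀ᶠ w in 𝓝 z, 0 < ψ w := hψc.continuousAt.eventually (lt_mem_nhds hN)
  have hd1 : deriv φ =ᶠ[𝓝 z]
      fun w => ((m + κ * (t - s)) + 2 * (-κ) * (w - s)) / ψ w / k := by
    filter_upwards [hev] with w hw
    exact (((hψd w).log hw.ne').div_const k).deriv
  have hd2 := hd1.deriv_eq
  rw [(((lin_hasDeriv (m + κ * (t - s)) (-κ) s z).fun_div (hψd z) hN.ne').div_const k).deriv] at hd2
  have h0 := (Fop_le_zero hR hF).1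
  rw [hd2, hd1.eq_of_nhds] at h0
  generalize (m + κ * (t - s)) + 2 * (-κ) * (z - s) = D at h0
  generalize ψ z = N at h0 hN
  have : eps * (D / N / k) ^ 2 + (2 * -κ * N - D * D) / N ^ 2 / k
      = - (2 * κ / (N * k)) - (D / N / k) ^ 2 := by
    have : eps = k - 1 := by linarith
    rw [this]; field_simp; ring
  rw [this] at h0
  have h5 : 0 < 2 * κ / (N * k) := by positivity
  nlinarith [sq_nonneg (D / N / k)]

/-- First order inequality at a point with a right derivative. -/
lemma sub_right {lam eps R r c b ws : ℝ} {u : ℝ → ℝ} (hR : 0 < R)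
    (hu : IsViscSubsol lam eps R r c b ws u) (hc : ContinuousOn u (Ioo b ws))
    {x q : ℝ} (hx : x ∈ Ioo b ws) (hd : HasDerivWithinAt u q (Ioi x) x) :
    lam * u x + (c - r * x) * q ≤ 0 := by
  by_contra! hcon
  have hcx : ContinuousAt u x := hc.continuousAt (Ioo_mem_nhds hx.1 hx.2)
  have hg : ContinuousAt (fun y : ℝ × ℝ => lam * u y.1 + (c - r * y.1) * y.2) (x, q) := by
    have h1 : ContinuousAt (fun y : ℝ × ℝ => u y.1) (x, q) :=
      ContinuousAt.comp (f := Prod.fst) (x := (x, q)) hcx continuousAt_fst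
    fun_prop
  obtain ⟨η, hη, hball⟩ := Metric.eventually_nhds_iff.1 (hg.eventually (lt_mem_nhds hcon))
  have hlo := (hasDerivWithinAt_iff_isLittleO.1 hd).def (show 0 < η / 100 by positivity)
  obtain ⟨y, hy, hyI⟩ := mem_nhdsGT_iff_exists_Ioc_subset.1 hlo
  have hy : x < y := hy
  obtain ⟨h, hh0, hhη, hhy, hhw⟩ : ∃ h, 0 < h ∧ h < η ∧ x + h ≤ y ∧ x + h < ws := by
    refine ⟨min (min (η / 2) (y - x)) ((ws - x) / 2), ?_, ?_, ?_, ?_⟩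
    · have := hx.2
      refine lt_min (lt_min (by linarith) (by linarith)) (by linarith)
    · exact ((min_le_left _ _).trans (min_le_left _ _)).trans_lt (by linarith)
    · linarith [(min_le_left (min (η / 2) (y - x)) ((ws - x) / 2)).trans (min_le_right _ _)]
    · have := hx.2
      linarith [(min_le_right (min (η / 2) (y - x)) ((ws - x) / 2))]
  have hest : ∀ w ∈ Icc x (x + h), |u w - u x - q * (w - x)| ≤ η / 100 * (w - x) := by
    intro w hw
    rcases hw.1.eq_or_lt with rfl | hlt
    · simp
    · have := hyI ⟨hlt, hw.2.trans hhy⟩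
      simp only [mem_ofPred_eq, Real.norm_eq_abs, smul_eq_mul, abs_of_pos (sub_pos.2 hlt)] at this
      rwa [mul_comm q]
  set κ := η / (4 * h) with hκ
  have hκh : κ * h = η / 4 := by rw [hκ]; field_simp
  have hsub : Icc x (x + h) ⊆ Ioo b ws := fun w hw => ⟨hx.1.trans_le hw.1, hw.2.trans_lt hhw⟩
  set f : ℝ → ℝ := fun w => u w - (u x + (q - κ * h) * (w - x) + κ * (w - x) ^ 2) with hf
  have hcont : ContinuousOn f (Icc x (x + h)) := (hc.mono hsub).sub (by fun_prop)
  obtain ⟨z, hz, hzm⟩ := isCompact_Icc.exists_isMaxOn ⟨x, left_mem_Icc.2 (by linarith)⟩ hcont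
  have hmid : x + h / 2 ∈ Icc x (x + h) := ⟨by linarith, by linarith⟩
  have hfm : η * h / 16 - η * h / 200 ≤ f (x + h / 2) := by
    have h1 := (abs_le.1 (hest _ hmid)).1
    have h2 : f (x + h / 2) = u (x + h / 2) - u x - q * (h / 2) + (κ * h) * h / 4 := by
      simp only [hf]; ring
    rw [h2, hκh]
    have : x + h / 2 - x = h / 2 := by ring
    rw [this] at h1
    nlinarith
  have hfx : f x = 0 := by simp [hf]
  have hfe : f (x + h) ≤ η * h / 100 := by
    have h1 := (abs_le.1 (hest (x + h) ⟨by linarith, le_refl _⟩)).2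
    have h2 : f (x + h) = u (x + h) - u x - q * (x + h - x) := by
      simp only [hf]; ring
    rw [h2]
    have : x + h - x = h := by ring
    rw [this] at h1 ⊢
    linarith
  have hfz := hzm hmid
  simp only [mem_ofPred_eq] at hfz
  have hηh : 0 < η * h := by positivity
  have hzx : x < z := lt_of_le_of_ne hz.1 (by rintro rfl; linarith)
  have hzh : z < x + h := lt_of_le_of_ne hz.2 (by rintro rfl; linarith)
  have hloc : IsLocalMax f z := hzm.isLocalMax (Icc_mem_nhds hzx hzh)
  have hfin := (sub_quad hR hu (hsub hz) _ _ _ _ hloc _ rfl).1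
  have hκ0 : 0 < κ := by rw [hκ]; positivity
  have hdist : dist (z, q - κ * h + 2 * κ * (z - x)) (x, q) < η := by
    rw [Prod.dist_eq, max_lt_iff, Real.dist_eq, Real.dist_eq, abs_lt, abs_lt]
    dsimp only
    have h1 : 0 < κ * (z - x) := mul_pos hκ0 (by linarith)
    have h2 : κ * (z - x) < κ * h := mul_lt_mul_of_pos_left (by linarith) hκ0
    refine ⟨⟨?_, ?_⟩, ?_, ?_⟩ <;> nlinarith
  have := hball hdist
  dsimp only at this
  linarith

/-- First order inequality at a convex kink. -/
lemma super_kink {lam eps R r c b ws : ℝ} {u : ℝ → ℝ} (hR : 0 < R) (heps : 0 ≤ eps)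
    (hu : IsViscSupersol lam eps R r c b ws u)
    {x ql qr q : ℝ} (hx : x ∈ Ioo b ws) (hdr : HasDerivWithinAt u qr (Ioi x) x)
    (hdl : HasDerivWithinAt u ql (Iio x) x) (h1 : ql < q) (h2 : q < qr) :
    0 ≤ lam * u x + (c - r * x) * q := by
  have key : ∀ B : ℝ, 0 < B →
      0 ≤ lam * u x + R * q ^ 2 / (eps * q ^ 2 + 2 * B) + (c - r * x) * q := by
    intro B hB
    refine super_quad hu hx (u x) q B x ?_ q (by simp) (by positivity)
    have er := (hasDerivWithinAt_iff_isLittleO.1 hdr).def (show 0 < (qr - q) / 2 by linarith)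
    have el := (hasDerivWithinAt_iff_isLittleO.1 hdl).def (show 0 < (q - ql) / 2 by linarith)
    have er2 : ∀ᶠ w in 𝓝 x, B * (w - x) < (qr - q) / 2 := by
      have : ContinuousAt (fun w => B * (w - x)) x := by fun_prop
      exact this.eventually (gt_mem_nhds (by simp; linarith))
    have el2 : ∀ᶠ w in 𝓝 x, B * (x - w) < (q - ql) / 2 := by
      have : ContinuousAt (fun w => B * (x - w)) x := by fun_prop
      exact this.eventually (gt_mem_nhds (by simp; linarith))
    have er' := eventually_nhdsWithin_iff.1 er
    have el' := eventually_nhdsWithin_iff.1 el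
    filter_upwards [er', el', er2, el2] with w a1 a2 a3 a4
    simp only [sub_self, mul_zero, add_zero, ne_eq, OfNat.ofNat_ne_zero, not_false_eq_true,
      zero_pow]
    rcases lt_trichotomy w x with hw | hw | hw
    · have := a2 hw
      simp only [Real.norm_eq_abs, smul_eq_mul, abs_of_neg (sub_neg.2 hw)] at this
      have := (abs_le.1 this).1
      nlinarith
    · subst hw; simp
    · have := a1 hw
      simp only [Real.norm_eq_abs, smul_eq_mul, abs_of_pos (sub_pos.2 hw)] at this
      have := (abs_le.1 this).1
      nlinarith
  by_contra! hcon
  set d := -(lam * u x + (c - r * x) * q) with hd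
  have hd0 : 0 < d := by linarith
  have := key (R * q ^ 2 / d + 1) (by positivity)
  have h3 : R * q ^ 2 / (eps * q ^ 2 + 2 * (R * q ^ 2 / d + 1)) < d := by
    rw [div_lt_iff₀ (by positivity)]
    have : R * q ^ 2 / d * d = R * q ^ 2 := by field_simp
    have h4 : 0 ≤ eps * q ^ 2 * d := by positivity
    have h5 : 0 ≤ R * q ^ 2 := by positivity
    nlinarith
  linarith

lemma sol_diff {lam eps R r c b ws : ℝ} {u : ℝ → ℝ} (hR : 0 < R) (heps : 0 ≤ eps)
    (ha : ∀ x ∈ Ioo b ws, 0 < c - r * x)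
    (hu : IsViscSubsol lam eps R r c b ws u) (hs : IsViscSupersol lam eps R r c b ws u)
    (hc : ContinuousOn u (Ioo b ws))
    {x : ℝ} (hx : x ∈ Ioo b ws) : ∃ q, HasDerivAt u q x := by
  have hV := sub_convex hR heps hu hc
  have hxi : x ∈ interior (Ioo b ws) := by rwa [interior_Ioo]
  have hr := hV.hasDerivWithinAt_rightDeriv_of_mem_interior hxi
  have hl := hV.hasDerivWithinAt_leftDeriv_of_mem_interior hxi
  have hle := hV.leftDeriv_le_rightDeriv_of_mem_interior hxi
  have hk0 : 0 < eps + 1 := by linarith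
  have hinv : ∀ w, Real.log (Real.exp ((eps + 1) * u w)) / (eps + 1) = u w := by
    intro w; rw [Real.log_exp]; field_simp
  have hr' := (hr.log (Real.exp_pos _).ne').div_const (eps + 1)
  have hl' := (hl.log (Real.exp_pos _).ne').div_const (eps + 1)
  simp only [hinv] at hr' hl'
  generalize derivWithin (fun w => Real.exp ((eps + 1) * u w)) (Ioi x) x = Qr at *
  generalize derivWithin (fun w => Real.exp ((eps + 1) * u w)) (Iio x) x = Ql at *
  rcases hle.eq_or_lt with heq | hlt
  · rw [heq] at hl'
    refine ⟨Qr / Real.exp ((eps + 1) * u x) / (eps + 1), ?_⟩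
    rw [← hasDerivWithinAt_univ]
    rw [← hasDerivWithinAt_diff_singleton (x := x)]
    have := hl'.union hr'
    rwa [Iio_union_Ioi, compl_eq_univ_diff] at this
  · exfalso
    have hlt' : Ql / Real.exp ((eps + 1) * u x) / (eps + 1)
        < Qr / Real.exp ((eps + 1) * u x) / (eps + 1) := by
      gcongr
    obtain ⟨q, h1, h2⟩ := exists_between hlt'
    have k1 := super_kink hR heps hs hx hr' hl' h1 h2
    have k2 := sub_right hR hu hc hx hr'
    have := ha x hx
    nlinarith

/-- A solution is continuously differentiable. -/
lemma sol_C1 {lam eps R r c b ws : ℝ} {u : ℝ → ℝ} (hR : 0 < R) (heps : 0 ≤ eps)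
    (ha : ∀ x ∈ Ioo b ws, 0 < c - r * x)
    (hu : IsViscSubsol lam eps R r c b ws u) (hs : IsViscSupersol lam eps R r c b ws u)
    (hc : ContinuousOn u (Ioo b ws)) :
    ∃ u' : ℝ → ℝ, ContinuousOn u' (Ioo b ws) ∧ ∀ x ∈ Ioo b ws, HasDerivAt u (u' x) x := by
  have hV := sub_convex hR heps hu hc
  have hdu : ∀ x ∈ Ioo b ws, HasDerivAt u (deriv u x) x := fun x hx => by
    obtain ⟨q, hq⟩ := sol_diff hR heps ha hu hs hc hx
    rwa [hq.deriv]
  set V := fun w => Real.exp ((eps + 1) * u w) with hVdef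
  have hVd : ∀ x ∈ Ioo b ws, HasDerivAt V (V x * ((eps + 1) * deriv u x)) x :=
    fun x hx => ((hdu x hx).const_mul _).exp
  have hVc : ContinuousOn V (Ioo b ws) := fun x hx => (hVd x hx).continuousAt.continuousWithinAt
  set V' := fun x => V x * ((eps + 1) * deriv u x) with hV'
  have hcont : ∀ x ∈ Ioo b ws, ContinuousAt V' x := by
    intro x hx
    have hnh := Ioo_mem_nhds hx.1 hx.2
    have hcx := hVc.continuousAt hnh
    have hmono : ∀ p ∈ Ioo b ws, ∀ q ∈ Ioo b ws, p ≤ q → V' p ≤ V' q := by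
      intro p hp q hq hpq
      rcases hpq.eq_or_lt with rfl | hlt
      · rfl
      · exact (hV.le_slope_of_hasDerivAt hp hq hlt (hVd p hp)).trans
          (hV.slope_le_of_hasDerivAt hp hq hlt (hVd q hq))
    rw [ContinuousAt, tendsto_order]
    have hts := hasDerivAt_iff_tendsto_slope.1 (hVd x hx)
    have hslope : ∀ y, y ≠ x → ContinuousAt (fun z => slope V z y) x := by
      intro y hy
      simp only [slope_def_field]
      have : y - x ≠ 0 := sub_ne_zero.2 hy
      fun_prop (disch := assumption)
    constructor
    · intro m hm
      have e1 : ∀ᶠ y in 𝓝[<] x, m < slope V x y :=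
        (hts.mono_left (nhdsWithin_mono _ (fun y hy => ne_of_lt hy))).eventually (lt_mem_nhds hm)
      have e2 : ∀ᶠ y in 𝓝[<] x, y ∈ Ioo b ws := nhdsWithin_le_nhds hnh
      have e3 : ∀ᶠ y in 𝓝[<] x, y < x := self_mem_nhdsWithin
      obtain ⟨y, h1, h2, h3⟩ := (e1.and (e2.and e3)).exists
      rw [slope_comm, slope_comm] at h1
      filter_upwards [(hslope y h3.ne).eventually (lt_mem_nhds h1), hnh, lt_mem_nhds h3]
        with z z1 z2 z3
      rw [slope_comm] at z1
      exact z1.trans_le (hV.slope_le_of_hasDerivAt h2 z2 z3 (hVd z z2))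
    · intro m hm
      have e1 : ∀ᶠ y in 𝓝[>] x, slope V x y < m :=
        (hts.mono_left (nhdsWithin_mono _ (fun y hy => ne_of_gt hy))).eventually (gt_mem_nhds hm)
      have e2 : ∀ᶠ y in 𝓝[>] x, y ∈ Ioo b ws := nhdsWithin_le_nhds hnh
      have e3 : ∀ᶠ y in 𝓝[>] x, x < y := self_mem_nhdsWithin
      obtain ⟨y, h1, h2, h3⟩ := (e1.and (e2.and e3)).exists
      filter_upwards [(hslope y h3.ne').eventually (gt_mem_nhds h1), hnh, gt_mem_nhds h3]
        with z z1 z2 z3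
      exact (hV.le_slope_of_hasDerivAt z2 h2 z3 (hVd z z2)).trans_lt z1
  refine ⟨deriv u, fun x hx => ?_, hdu⟩
  apply ContinuousAt.continuousWithinAt
  have hk0 : 0 < eps + 1 := by linarith
  have : deriv u = fun x => V' x / (V x * (eps + 1)) := by
    funext y
    have : 0 < V y := Real.exp_pos _
    simp only [hV']; field_simp
  rw [this]
  have h1 := hcont x hx
  have h2 := (hVd x hx).continuousAt
  have h3 : V x * (eps + 1) ≠ 0 := (mul_pos (Real.exp_pos _) hk0).ne'
  exact h1.div (h2.mul continuousAt_const) h3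

lemma comparison {lam eps R r c b ws : ℝ} {u v : ℝ → ℝ} (hlam : 0 < lam)
    (hR : 0 < R) (heps : 0 ≤ eps)
    (ha : ∀ x ∈ Ioo b ws, 0 < c - r * x) (hb : b < ws)
    (hu : IsViscSubsol lam eps R r c b ws u) (hus : IsViscSupersol lam eps R r c b ws u)
    (hv : IsViscSubsol lam eps R r c b ws v) (hvs : IsViscSupersol lam eps R r c b ws v)
    (huc : ContinuousOn u (Icc b ws)) (hvc : ContinuousOn v (Icc b ws))
    (hv0 : ∀ w ∈ Icc b ws, 0 ≤ v w)
    (h1 : u b = v b) (h2 : u ws = v ws) : ∀ x ∈ Icc b ws, u x ≤ v x := by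
  obtain ⟨x, hx, hxm⟩ := isCompact_Icc.exists_isMaxOn ⟨b, left_mem_Icc.2 hb.le⟩ (huc.sub hvc)
  by_contra! hcon
  obtain ⟨y, hy, hyl⟩ := hcon
  have hpos : v x < u x := by
    have := hxm hy
    simp only [mem_ofPred_eq, Pi.sub_apply] at this
    linarith
  have hxb : b < x := lt_of_le_of_ne hx.1 (by rintro rfl; linarith)
  have hxw : x < ws := lt_of_le_of_ne hx.2 (by rintro rfl; linarith)
  have hxI : x ∈ Ioo b ws := ⟨hxb, hxw⟩
  have hloc : IsLocalMax (u - v) x := hxm.isLocalMax (Icc_mem_nhds hxb hxw)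
  have huc' := huc.mono Ioo_subset_Icc_self
  have hvc' := hvc.mono Ioo_subset_Icc_self
  obtain ⟨u', -, hud⟩ := sol_C1 hR heps ha hu hus huc'
  obtain ⟨v', hv'c, hvd⟩ := sol_C1 hR heps ha hv hvs hvc'
  have hpe : u' x - v' x = 0 := hloc.hasDerivAt_eq_zero ((hud x hxI).sub (hvd x hxI))
  set p := v' x with hp
  have hup : u' x = p := by linarith
  have hdu := sub_right hR hu huc' hxI (hud x hxI).hasDerivWithinAt
  rw [hup] at hdu
  have hax := ha x hxI
  have hvx := hv0 x hx
  have hluv : lam * v x < lam * u x := mul_lt_mul_of_pos_left hpos hlam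
  have hlv : 0 ≤ lam * v x := by positivity
  have hp0 : p ≠ 0 := by
    intro h; rw [h] at hdu; linarith
  have hp2 : 0 < p ^ 2 := by positivity
  set s := -((lam * u x + lam * v x) / 2 + (c - r * x) * p) with hs
  have hs0 : 0 < s := by linarith
  set γ := (R * p ^ 2 / s - eps * p ^ 2) / 2 with hγ
  have hγ1 : eps * p ^ 2 + 2 * γ = R * p ^ 2 / s := by rw [hγ]; ring
  have hγ2 : 0 < eps * p ^ 2 + 2 * γ := by rw [hγ1]; positivity
  have hγ3 : R * p ^ 2 / (eps * p ^ 2 + 2 * γ) = s := by rw [hγ1]; field_simp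
  -- near x, the supersolution inequality with curvature `2γ` fails
  have hv'x : ContinuousAt v' x := hv'c.continuousAt (Ioo_mem_nhds hxb hxw)
  have hvx' : ContinuousAt v x := (hvd x hxI).continuousAt
  have hc1 : ContinuousAt (fun w => eps * (v' w) ^ 2 + 2 * γ) x := by fun_prop
  have hc2 : ContinuousAt (fun w => lam * v w + R * (v' w) ^ 2 / (eps * (v' w) ^ 2 + 2 * γ)
      + (c - r * w) * v' w) x := by
    have h3 : eps * (v' x) ^ 2 + 2 * γ ≠ 0 := hγ2.ne'
    fun_prop (disch := assumption)
  have e1 := hc1.eventually (lt_mem_nhds hγ2)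
  have e2 := hc2.eventually (gt_mem_nhds (show lam * v x + R * (v' x) ^ 2 /
    (eps * (v' x) ^ 2 + 2 * γ) + (c - r * x) * v' x < 0 by rw [← hp, hγ3]; linarith))
  obtain ⟨h, hh, hball⟩ := Metric.eventually_nhds_iff.1
    ((e1.and e2).and (Ioo_mem_nhds hxb hxw : ∀ᶠ w in 𝓝 x, w ∈ Ioo b ws))
  -- no touching from below near x
  have notouch : ∀ z, dist z x < h → ∀ m : ℝ,
      ¬ IsLocalMin (fun w => v w - (v x + (p + m) * (w - x) + γ * (w - x) ^ 2)) z := by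
    intro z hz m hmin
    obtain ⟨⟨z1, z2⟩, z3⟩ := hball hz
    have hd := (hvd z z3).sub (quad_hasDeriv (v x) (p + m) γ x z)
    have hq : v' z - (p + m + 2 * γ * (z - x)) = 0 := hmin.hasDerivAt_eq_zero hd
    have := super_quad hvs z3 _ _ _ _ hmin (v' z) (by linarith) z1
    linarith
  set f : ℝ → ℝ := fun w => v w - (v x + p * (w - x) + γ * (w - x) ^ 2) with hf
  have hfx : f x = 0 := by simp [hf]
  have hfle : ∀ y, dist y x < h → f y ≤ 0 := by
    intro y hy
    by_contra! hfy
    have hyx : y ≠ x := by rintro rfl; linarith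
    set m := f y / (y - x) with hm
    have hyx' : y - x ≠ 0 := sub_ne_zero.2 hyx
    have hmy : m * (y - x) = f y := by rw [hm]; field_simp
    set G : ℝ → ℝ := fun w => v w - (v x + (p + m) * (w - x) + γ * (w - x) ^ 2) with hG
    have hGf : ∀ w, G w = f w - m * (w - x) := fun w => by simp only [hG, hf]; ring
    have hGx : G x = 0 := by rw [hGf, hfx]; ring
    have hGy : G y = 0 := by rw [hGf, hmy]; ring
    have hGd : HasDerivAt G (-m) x := by
      have := (hvd x hxI).sub (quad_hasDeriv (v x) (p + m) γ x x)
      refine this.congr_deriv ?_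
      rw [← hp]; ring
    have hsubI : ∀ w ∈ uIcc x y, dist w x < h := fun w hw => by
      refine lt_of_le_of_lt ?_ hy
      rw [Real.dist_eq, Real.dist_eq]
      exact abs_sub_left_of_mem_uIcc hw
    have hGc : ContinuousOn G (uIcc x y) := fun w hw => by
      have := (hvd w (hball (hsubI w hw)).2).continuousAt
      apply ContinuousAt.continuousWithinAt
      simp only [hG]; fun_prop
    obtain ⟨z, hz, hzm⟩ := isCompact_uIcc.exists_isMinOn ⟨x, left_mem_uIcc⟩ hGc
    -- there is a point with negative value
    have hneg : ∃ w ∈ uIcc x y, G w < 0 := by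
      by_contra! hall
      rcases lt_or_gt_of_ne hyx with hlt | hgt
      · have hm0 : m < 0 := div_neg_of_pos_of_neg hfy (by linarith)
        have hts := (hasDerivAt_iff_tendsto_slope.1 hGd).mono_left
          (nhdsWithin_mono _ (fun y hy => ne_of_lt hy) : 𝓝[<] x ≤ _)
        have k1 := hts.eventually (lt_mem_nhds (show (0:ℝ) < -m by linarith))
        have k2 : ∀ᶠ w in 𝓝[<] x, w ∈ Ioo y x := Ioo_mem_nhdsLT hlt
        obtain ⟨w, w1, w2⟩ := (k1.and k2).exists
        have := hall w (by rw [uIcc_of_ge hlt.le]; exact ⟨w2.1.le, w2.2.le⟩)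
        rw [slope_def_field, hGx, sub_zero] at w1
        have : G w / (w - x) ≤ 0 := div_nonpos_of_nonneg_of_nonpos this (by linarith [w2.2])
        linarith
      · have hm0 : 0 < m := div_pos hfy (by linarith)
        have hts := (hasDerivAt_iff_tendsto_slope.1 hGd).mono_left
          (nhdsWithin_mono _ (fun y hy => ne_of_gt hy) : 𝓝[>] x ≤ _)
        have k1 := hts.eventually (gt_mem_nhds (show -m < (0:ℝ) by linarith))
        have k2 : ∀ᶠ w in 𝓝[>] x, w ∈ Ioo x y := Ioo_mem_nhdsGT hgt
        obtain ⟨w, w1, w2⟩ := (k1.and k2).exists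
        have := hall w (by rw [uIcc_of_le hgt.le]; exact ⟨w2.1.le, w2.2.le⟩)
        rw [slope_def_field, hGx, sub_zero] at w1
        have : 0 ≤ G w / (w - x) := div_nonneg this (by linarith [w2.1])
        linarith
    obtain ⟨w, hw, hwn⟩ := hneg
    have hzn : G z < 0 := lt_of_le_of_lt (hzm hw) hwn
    have hzx : z ≠ x := by rintro rfl; linarith
    have hzy : z ≠ y := by rintro rfl; linarith
    have hnb : uIcc x y ∈ 𝓝 z := by
      rw [uIcc, mem_Icc] at hz
      apply Icc_mem_nhds
      · refine lt_of_le_of_ne hz.1 ?_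
        rcases min_choice x y with h | h <;> rw [h]
        exacts [hzx.symm, hzy.symm]
      · refine lt_of_le_of_ne hz.2 ?_
        rcases max_choice x y with h | h <;> rw [h]
        exacts [hzx, hzy]
    exact notouch z (hsubI z hz) m (hzm.isLocalMin hnb)
  have hmax : IsLocalMax (fun w => u w - (v x + p * (w - x) + γ * (w - x) ^ 2)) x := by
    filter_upwards [hloc, Metric.ball_mem_nhds x hh] with w w1 w2
    have := hfle w w2
    simp only [hf] at this
    simp only [Pi.sub_apply] at w1
    simp only [sub_self, mul_zero, add_zero, ne_eq, OfNat.ofNat_ne_zero, not_false_eq_true,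
      zero_pow]
    linarith
  have := (sub_quad hR hu hxI _ _ _ _ hmax p (by simp)).2 hγ2
  rw [hγ3] at this
  linarith

/-- Uniqueness of the bounded non-negative continuous viscosity solution of
the Dirichlet problem for `F = 0`. -/
theorem stmt_6 (r μ σ c b ws R lam eps : ℝ)
    (hr : 0 < r) (hμ : r < μ) (hσ : 0 < σ) (hc : 0 < c)
    (hws : ws = c / r) (hb : b < ws)
    (hR : R = (1 / 2) * ((μ - r) / σ) ^ 2)
    (hlam : 0 < lam) (heps : 0 ≤ eps)
    (u₁ u₂ : ℝ → ℝ)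
    (h₁_cont : ContinuousOn u₁ (Set.Icc b ws))
    (h₂_cont : ContinuousOn u₂ (Set.Icc b ws))
    (h₁_bdd : ∃ M, ∀ w ∈ Set.Icc b ws, |u₁ w| ≤ M)
    (h₂_bdd : ∃ M, ∀ w ∈ Set.Icc b ws, |u₂ w| ≤ M)
    (h₁_nonneg : ∀ w ∈ Set.Icc b ws, 0 ≤ u₁ w)
    (h₂_nonneg : ∀ w ∈ Set.Icc b ws, 0 ≤ u₂ w)
    (h₁_sub : IsViscSubsol lam eps R r c b ws u₁)
    (h₁_super : IsViscSupersol lam eps R r c b ws u₁)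
    (h₂_sub : IsViscSubsol lam eps R r c b ws u₂)
    (h₂_super : IsViscSupersol lam eps R r c b ws u₂)
    (h₁b : u₁ b = 1) (h₂b : u₂ b = 1)
    (h₁ws : u₁ ws = 0) (h₂ws : u₂ ws = 0) :
    Set.EqOn u₁ u₂ (Set.Icc b ws) := by
  have hR0 : 0 < R := by
    rw [hR]
    have : 0 < (μ - r) / σ := div_pos (by linarith) hσ
    positivity
  have ha : ∀ x ∈ Set.Ioo b ws, 0 < c - r * x := by
    intro x hx
    have h1 : r * ws = c := by rw [hws]; field_simp
    nlinarith [hx.2]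
  intro x hx
  apply le_antisymm
  · exact comparison hlam hR0 heps ha hb h₁_sub h₁_super h₂_sub h₂_super h₁_cont h₂_cont
      h₂_nonneg (h₁b.trans h₂b.symm) (h₁ws.trans h₂ws.symm) x hx
  · exact comparison hlam hR0 heps ha hb h₂_sub h₂_super h₁_sub h₁_super h₂_cont h₁_cont
      h₁_nonneg (h₂b.trans h₁b.symm) (h₂ws.trans h₁ws.symm) x hx
end

section
/- Let λ > 0 and ε > 0. There exists a continuous function u : [b, w_s] → [0, 1] which is a viscosity solution of F = 0 on (b, w_s), satisfies u(b) = 1 and u(w_s) = 0, and satisfies ψ₀(w) ≤ u(w) ≤ 𝔭(w) for all w ∈ [b, w_s], where ψ₀(w) := ((c − r w)/(c − r b))^d and 𝔭(w) := (1/ε)·ln(1 + (e^ε − 1)·((c − r w)/(c − r b))^{R/r + 1}). -/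
open MeasureTheory Set Filter Topology

lemma J_deriv (K M : ℝ) (hK : 0 < K) (h : ℝ → ℝ) (hc : Continuous h) (hM : ∀ t, |h t| ≤ M) (t : ℝ) :
    HasDerivAt (fun t => Real.exp (-K*t) * ∫ x in Iic t, Real.exp (K*x) * h x)
      (h t - K * (Real.exp (-K*t) * ∫ x in Iic t, Real.exp (K*x) * h x)) t := by
  have hIntg : ∀ t, IntegrableOn (fun x => Real.exp (K*x) * h x) (Iic t) := by
    intro t
    refine Integrable.mul_bdd (c := M) (integrableOn_exp_mul_Iic hK t)
      hc.aestronglyMeasurable (Eventually.of_forall fun x => ?_)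
    simpa using hM x
  have hg : Continuous (fun x => Real.exp (K*x) * h x) := by fun_prop
  have e : (fun t => ∫ x in Iic t, Real.exp (K*x) * h x) =
      fun t => (∫ x in Iic 0, Real.exp (K*x) * h x) + ∫ x in (0:ℝ)..t, Real.exp (K*x) * h x := by
    funext t
    rw [← intervalIntegral.integral_Iic_sub_Iic (hIntg 0) (hIntg t)]; ring
  have h1 : HasDerivAt (fun t => ∫ x in Iic t, Real.exp (K*x) * h x) (Real.exp (K*t) * h t) t := by
    rw [e]
    exact (intervalIntegral.integral_hasDerivAt_right (hg.intervalIntegrable _ _)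
      hg.aestronglyMeasurable.stronglyMeasurableAtFilter hg.continuousAt).const_add _
  have h2 : HasDerivAt (fun t => Real.exp (-K*t)) (Real.exp (-K*t) * (-K)) t := by
    have := ((hasDerivAt_id t).const_mul (-K)).exp
    simpa using this
  refine (h2.mul h1).congr_deriv ?_
  have : Real.exp (-K*t) * Real.exp (K*t) = 1 := by rw [← Real.exp_add]; simp
  linear_combination (h t) * this

lemma J_bound (K A B : ℝ) (hK : 0 < K) (h : ℝ → ℝ) (hc : Continuous h) (hM : ∀ t, A ≤ h t ∧ h t ≤ B) (t : ℝ) :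
    A / K ≤ Real.exp (-K*t) * ∫ x in Iic t, Real.exp (K*x) * h x ∧
    (Real.exp (-K*t) * ∫ x in Iic t, Real.exp (K*x) * h x) ≤ B / K := by
  have hi := integrableOn_exp_mul_Iic hK t
  have hIntg : IntegrableOn (fun x => Real.exp (K*x) * h x) (Iic t) := by
    refine Integrable.mul_bdd (c := |A| + |B|) hi
      hc.aestronglyMeasurable (Eventually.of_forall fun x => ?_)
    obtain ⟨h1, h2⟩ := hM x
    rw [Real.norm_eq_abs, abs_le]
    constructor <;> linarith [neg_abs_le A, le_abs_self B, abs_nonneg A, abs_nonneg B]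
  have hE : Real.exp (-K*t) * Real.exp (K*t) = 1 := by rw [← Real.exp_add]; simp
  have hv := integral_exp_mul_Iic hK t
  have cst : ∀ C : ℝ, C / K = Real.exp (-K*t) * ∫ x in Iic t, Real.exp (K*x) * C := by
    intro C
    rw [integral_mul_const, hv]
    linear_combination (-C/K) * hE
  rw [cst A, cst B]
  constructor
  · refine mul_le_mul_of_nonneg_left ?_ (Real.exp_pos _).le
    exact integral_mono (hi.mul_const A) hIntg fun x =>
      mul_le_mul_of_nonneg_left (hM x).1 (Real.exp_pos _).le
  · refine mul_le_mul_of_nonneg_left ?_ (Real.exp_pos _).le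
    exact integral_mono hIntg (hi.mul_const B) fun x =>
      mul_le_mul_of_nonneg_left (hM x).2 (Real.exp_pos _).le

lemma J_sub (K M : ℝ) (hK : 0 < K) (h k : ℝ → ℝ) (hc : Continuous h) (kc : Continuous k)
    (hM : ∀ t, |h t| ≤ M) (kM : ∀ t, |k t| ≤ M) (t : ℝ) :
    (Real.exp (-K*t) * ∫ x in Iic t, Real.exp (K*x) * h x) -
    (Real.exp (-K*t) * ∫ x in Iic t, Real.exp (K*x) * k x) =
    (Real.exp (-K*t) * ∫ x in Iic t, Real.exp (K*x) * (h x - k x)) := by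
  have hi := integrableOn_exp_mul_Iic hK t
  have hIntg : IntegrableOn (fun x => Real.exp (K*x) * h x) (Iic t) :=
    Integrable.mul_bdd (c := M) hi hc.aestronglyMeasurable (Eventually.of_forall fun x => by simpa using hM x)
  have kIntg : IntegrableOn (fun x => Real.exp (K*x) * k x) (Iic t) :=
    Integrable.mul_bdd (c := M) hi kc.aestronglyMeasurable (Eventually.of_forall fun x => by simpa using kM x)
  rw [← mul_sub, ← integral_sub hIntg kIntg]
  simp only [mul_sub]

/-- General fixed point: `H` monotone and `(K-1)`-Lipschitz on `[a,d]`. -/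
lemma exists_bdd_sol (K a d : ℝ) (hK : 1 < K) (had : a ≤ d) (H : ℝ → ℝ → ℝ)
    (Hc : ContinuousOn (fun z : ℝ × ℝ => H z.1 z.2) (univ ×ˢ Icc a d))
    (Hm : ∀ t, ∀ v ∈ Icc a d, K * a ≤ H t v ∧ H t v ≤ K * d)
    (HL : ∀ t, ∀ v ∈ Icc a d, ∀ v' ∈ Icc a d, |H t v - H t v'| ≤ (K - 1) * |v - v'|) :
    ∃ y : ℝ → ℝ, ∀ t, y t ∈ Icc a d ∧ HasDerivAt y (H t (y t) - K * y t) t := by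
  have hK0 : 0 < K := by linarith
  let cl : ℝ → ℝ := fun v => (projIcc a d had v : ℝ)
  have clc : Continuous cl := continuous_subtype_val.comp continuous_projIcc
  have clm : ∀ v, cl v ∈ Icc a d := fun v => (projIcc a d had v).2
  have clL : ∀ v v', |cl v - cl v'| ≤ |v - v'| := by
    intro v v'
    exact abs_projIcc_sub_projIcc had
  let h : (BoundedContinuousFunction ℝ ℝ) → ℝ → ℝ := fun y t => H t (cl (y t))
  have hcont : ∀ y, Continuous (h y) := by
    intro y
    exact Hc.comp_continuous (f := fun t => (t, cl (y t))) (by fun_prop) (fun t => ⟨mem_univ _, clm _⟩)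
  have hb : ∀ y t, K * a ≤ h y t ∧ h y t ≤ K * d := fun y t => Hm t _ (clm _)
  have hab : ∀ y t, |h y t| ≤ |K*a| + |K*d| := by
    intro y t
    obtain ⟨h1, h2⟩ := hb y t
    rw [abs_le]
    constructor <;> linarith [neg_abs_le (K*a), le_abs_self (K*d), abs_nonneg (K*a), abs_nonneg (K*d)]
  let J : (BoundedContinuousFunction ℝ ℝ) → ℝ → ℝ :=
    fun y t => Real.exp (-K*t) * ∫ x in Iic t, Real.exp (K*x) * h y x
  have Jd : ∀ y t, HasDerivAt (J y) (h y t - K * J y t) t :=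
    fun y t => J_deriv K _ hK0 (h y) (hcont y) (hab y) t
  have Jb : ∀ y t, J y t ∈ Icc a d := by
    intro y t
    have := J_bound K _ _ hK0 (h y) (hcont y) (hb y) t
    rw [mul_div_cancel_left₀ _ hK0.ne', mul_div_cancel_left₀ _ hK0.ne'] at this
    exact this
  have Jc : ∀ y, Continuous (J y) := fun y =>
    continuous_iff_continuousAt.2 fun t => (Jd y t).continuousAt
  let T : (BoundedContinuousFunction ℝ ℝ) → (BoundedContinuousFunction ℝ ℝ) := fun y =>
    BoundedContinuousFunction.ofNormedAddCommGroup (J y) (Jc y) (|a| + |d|) (by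
      intro t
      obtain ⟨h1, h2⟩ := Jb y t
      rw [Real.norm_eq_abs, abs_le]
      constructor <;> linarith [neg_abs_le a, le_abs_self d, abs_nonneg a, abs_nonneg d])
  have hq : 0 ≤ (K-1)/K := div_nonneg (by linarith) hK0.le
  have hT : ContractingWith ((K-1)/K).toNNReal T := by
    constructor
    · rw [← NNReal.coe_lt_coe, Real.coe_toNNReal _ hq, NNReal.coe_one]
      rw [div_lt_one hK0]; linarith
    · refine LipschitzWith.of_dist_le_mul fun y z => ?_
      rw [Real.coe_toNNReal _ hq]
      rw [BoundedContinuousFunction.dist_le (by positivity)]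
      intro t
      change dist (J y t) (J z t) ≤ _
      rw [Real.dist_eq]
      have e := J_sub K _ hK0 (h y) (h z) (hcont y) (hcont z) (hab y) (hab z) t
      have hd : ∀ x, -((K-1) * dist y z) ≤ h y x - h z x ∧ h y x - h z x ≤ (K-1) * dist y z := by
        intro x
        rw [← abs_le]
        refine (HL x _ (clm _) _ (clm _)).trans ?_
        refine mul_le_mul_of_nonneg_left ?_ (by linarith)
        refine (clL _ _).trans ?_
        rw [← Real.dist_eq]
        exact BoundedContinuousFunction.dist_coe_le_dist x
      have := J_bound K _ _ hK0 (fun x => h y x - h z x) ((hcont y).sub (hcont z)) hd t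
      rw [← e] at this
      rw [abs_le]
      have e2 : (K-1)/K * dist y z = (K-1) * dist y z / K := by ring
      rw [e2, ← neg_div]
      exact this
  let y := hT.fixedPoint T
  have hy : T y = y := hT.fixedPoint_isFixedPt
  have hy' : J y = y := by
    funext t
    exact congrArg (fun f : BoundedContinuousFunction ℝ ℝ => f t) hy
  refine ⟨y, fun t => ?_⟩
  have h1 := Jb y t
  have h2 := Jd y t
  rw [hy'] at h1 h2
  refine ⟨h1, ?_⟩
  have : cl (y t) = y t := by
    change ((projIcc a d had (y t) : Icc a d) : ℝ) = _
    rw [projIcc_of_mem had h1]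
  change HasDerivAt y (H t (cl (y t)) - K * y t) t at h2
  rwa [this] at h2

lemma exists_y (r lam R eps d : ℝ) (hr : 0 < r) (hl : 0 < lam) (hR : 0 < R) (he : 0 < eps)
    (hd1 : 1 < d) (hdl : lam < r * d) (hq : (d - 1) * (r * d - lam) = R * d) :
    ∃ a : ℝ, 0 < a ∧ lam < r * a ∧ ∃ y : ℝ → ℝ, ∀ t, (a ≤ y t ∧ y t ≤ d) ∧
      HasDerivAt y (1 - y t - eps * min (Real.exp t) 1 * y t + R * y t / (r * y t - lam)) t := by
  obtain ⟨η, hη, hη1, hη2⟩ : ∃ η : ℝ, 0 < η ∧ η * (1 + eps) ≤ R ∧ η ≤ r * d - lam := by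
    refine ⟨min (R / (1+eps)) (r*d-lam), lt_min (by positivity) (by linarith), ?_, min_le_right _ _⟩
    rw [← le_div_iff₀ (by positivity)]; exact min_le_left _ _
  obtain ⟨a, ha⟩ : ∃ a : ℝ, r * a = lam + η := ⟨(lam+η)/r, by field_simp⟩
  have ha0 : 0 < a := by
    by_contra hcon; push Not at hcon; nlinarith
  have had : a ≤ d := by
    by_contra hcon; push Not at hcon; nlinarith
  refine ⟨a, ha0, by linarith, ?_⟩
  set L := R * lam / η^2 with hL
  have hL0 : 0 < L := by positivity
  let m : ℝ → ℝ := fun t => min (Real.exp t) 1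
  have hm : ∀ t, 0 ≤ m t ∧ m t ≤ 1 := fun t => ⟨le_min (Real.exp_pos t).le zero_le_one, min_le_right _ _⟩
  let K := 1 + eps + L
  let H : ℝ → ℝ → ℝ := fun t v => K * v + (1 - v - eps * m t * v + R * v / (r * v - lam))
  have hden : ∀ v ∈ Icc a d, η ≤ r * v - lam := by
    intro v hv; nlinarith [hv.1]
  have key : ∀ t, ∀ v ∈ Icc a d, ∀ v' ∈ Icc a d, ∃ k, 0 ≤ k ∧ k ≤ K - 1 ∧ H t v - H t v' = k * (v - v') := by
    intro t v hv v' hv'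
    have h1 := hden v hv
    have h2 := hden v' hv'
    have p1 : 0 < r * v - lam := by linarith
    have p2 : 0 < r * v' - lam := by linarith
    have hh : R * lam / ((r*v-lam)*(r*v'-lam)) ≤ L := by
      rw [hL]
      apply div_le_div_of_nonneg_left (by positivity) (by positivity)
      nlinarith
    have hh0 : 0 ≤ R * lam / ((r*v-lam)*(r*v'-lam)) := by positivity
    have := hm t
    refine ⟨K - 1 - eps * m t - R * lam / ((r*v-lam)*(r*v'-lam)), ?_, ?_, ?_⟩
    · simp only [K]; nlinarith
    · nlinarith
    · simp only [H]
      have e : R * v / (r * v - lam) - R * v' / (r * v' - lam) =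
        - (R * lam / ((r*v-lam)*(r*v'-lam))) * (v - v') := by
        have q1 := p1.ne'
        have q2 := p2.ne'
        rw [div_sub_div _ _ q1 q2, ← neg_div, div_mul_eq_mul_div]
        congr 1; ring
      linear_combination e
  have hK : 1 < K := by simp only [K]; linarith
  have hKa : ∀ t, K * a ≤ H t a := by
    intro t
    simp only [H]
    have : r * a - lam = η := by linarith
    rw [this]
    have h1 : (1+eps) * a ≤ R * a / η := by
      rw [le_div_iff₀ hη]; nlinarith
    have h2 : eps * m t * a ≤ eps * a := by
      have := mul_le_mul_of_nonneg_left (hm t).2 (mul_pos he ha0).le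
      nlinarith
    nlinarith
  have hKd : ∀ t, H t d ≤ K * d := by
    intro t
    simp only [H]
    have : R * d / (r * d - lam) = d - 1 := by
      rw [← hq, mul_div_cancel_right₀ _ (by linarith)]
    rw [this]
    have : 0 ≤ eps * m t * d := by have := (hm t).1; positivity
    linarith
  have HC : ContinuousOn (fun z : ℝ × ℝ => H z.1 z.2) (univ ×ˢ Icc a d) := by
    simp only [H, m]
    have : ContinuousOn (fun z : ℝ × ℝ => R * z.2 / (r * z.2 - lam)) (univ ×ˢ Icc a d) := by
      apply ContinuousOn.div (by fun_prop) (by fun_prop)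
      rintro z ⟨-, hz⟩
      have := hden _ hz
      linarith
    have h2 : Continuous (fun z : ℝ × ℝ => K * z.2 + (1 - z.2 - eps * min (Real.exp z.1) 1 * z.2)) := by
      fun_prop
    refine (h2.continuousOn.add this).congr fun z _ => ?_
    simp only [Pi.add_apply]
    ring
  have HM : ∀ t, ∀ v ∈ Icc a d, K * a ≤ H t v ∧ H t v ≤ K * d := by
    intro t v hv
    obtain ⟨k, k0, k1, e⟩ := key t v hv a ⟨le_rfl, had⟩
    obtain ⟨k', k0', k1', e'⟩ := key t d ⟨had, le_rfl⟩ v hv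
    have := hKa t
    have := hKd t
    have := mul_nonneg k0 (sub_nonneg.2 hv.1)
    have := mul_nonneg k0' (sub_nonneg.2 hv.2)
    constructor <;> linarith
  have HL : ∀ t, ∀ v ∈ Icc a d, ∀ v' ∈ Icc a d, |H t v - H t v'| ≤ (K - 1) * |v - v'| := by
    intro t v hv v' hv'
    obtain ⟨k, k0, k1, e⟩ := key t v hv v' hv'
    rw [e, abs_mul, abs_of_nonneg k0]
    exact mul_le_mul_of_nonneg_right k1 (abs_nonneg _)
  obtain ⟨y, hy⟩ := exists_bdd_sol K a d hK had H HC HM HL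
  refine ⟨y, fun t => ⟨(hy t).1, ?_⟩⟩
  refine (hy t).2.congr_deriv ?_
  simp only [H, m]; ring

/-- time change -/
lemma exists_T (a d : ℝ) (ha : 0 < a) (y : ℝ → ℝ) (hyc : Continuous y)
    (hy : ∀ t, a ≤ y t ∧ y t ≤ d) :
    ∃ s T : ℝ → ℝ, s 0 = 0 ∧ (∀ t, HasDerivAt s (1 / y t) t) ∧ (∀ x, s (T x) = x) ∧
      (∀ t, T (s t) = t) ∧ StrictMono T ∧ (∀ x, HasDerivAt T (y (T x)) x) := by
  have hpos : ∀ t, 0 < y t := fun t => ha.trans_le (hy t).1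
  have hd : 0 < d := (hpos 0).trans_le (hy 0).2
  have hic : Continuous (fun t => 1 / y t) := by
    exact continuous_const.div hyc fun t => (hpos t).ne'
  let s : ℝ → ℝ := fun t => ∫ x in (0:ℝ)..t, 1 / y x
  have hs0 : s 0 = 0 := by simp [s]
  have hs : ∀ t, HasDerivAt s (1 / y t) t := fun t =>
    intervalIntegral.integral_hasDerivAt_right (hic.intervalIntegrable _ _)
      hic.aestronglyMeasurable.stronglyMeasurableAtFilter hic.continuousAt
  have hsc : Continuous s := continuous_iff_continuousAt.2 fun t => (hs t).continuousAt
  have hsm : StrictMono s := strictMono_of_deriv_pos fun t => by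
    rw [(hs t).deriv]; exact one_div_pos.2 (hpos t)
  have hg : Monotone (fun t => s t - t / d) := by
    refine monotone_of_hasDerivAt_nonneg (f' := fun t => 1 / y t - 1 / d)
      (fun t => (hs t).sub ((hasDerivAt_id t).div_const d)) (fun t => ?_)
    exact sub_nonneg.2 (one_div_le_one_div_of_le (hpos t) (hy t).2)
  have hsurj : Function.Surjective s := by
    apply hsc.surjective
    · refine tendsto_atTop_mono' atTop ?_ (tendsto_id.atTop_div_const hd)
      filter_upwards [eventually_ge_atTop 0] with t ht
      have := hg ht
      simp only [hs0, id] at this ⊢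
      linarith [zero_div d]
    · refine tendsto_atBot_mono' atBot ?_ (tendsto_id.atBot_div_const hd)
      filter_upwards [eventually_le_atBot 0] with t ht
      have := hg ht
      simp only [hs0, id] at this ⊢
      linarith [zero_div d]
  let e := StrictMono.orderIsoOfSurjective s hsm hsurj
  have he : ∀ x, s (e.symm x) = x := fun x => e.apply_symm_apply x
  have he' : ∀ t, e.symm (s t) = t := fun t => e.symm_apply_apply t
  refine ⟨s, e.symm, hs0, hs, he, he', e.symm.strictMono, fun x => ?_⟩
  have := HasDerivAt.of_local_left_inverse (f := s) (g := e.symm) (a := x)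
    e.symm.continuous.continuousAt (hs (e.symm x)) (one_div_pos.2 (hpos _)).ne'
    (Eventually.of_forall he)
  simpa using this

/-- `s`-bounds -/
lemma s_upper (d : ℝ) (y s : ℝ → ℝ) (hpos : ∀ t, 0 < y t) (hy : ∀ t, y t ≤ d) (hs0 : s 0 = 0)
    (hs : ∀ t, HasDerivAt s (1 / y t) t) (t : ℝ) (ht : t ≤ 0) : d * s t ≤ t := by
  have hd : 0 < d := (hpos 0).trans_le (hy 0)
  have hg : Monotone (fun t => s t - t / d) := by
    refine monotone_of_hasDerivAt_nonneg (f' := fun t => 1 / y t - 1 / d)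
      (fun t => (hs t).sub ((hasDerivAt_id t).div_const d)) (fun t => ?_)
    exact sub_nonneg.2 (one_div_le_one_div_of_le (hpos t) (hy t))
  have := hg ht
  simp only [hs0, zero_div, sub_zero, sub_nonpos] at this
  rw [le_div_iff₀ hd] at this
  linarith

lemma y_lower (r lam R eps a d : ℝ) (hr : 0 < r) (hl : 0 < lam) (hR : 0 < R) (he : 0 < eps)
    (ha : 0 < a) (hla : lam < r * a) (y : ℝ → ℝ) (hy : ∀ t, (a ≤ y t ∧ y t ≤ d) ∧
      HasDerivAt y (1 - y t - eps * min (Real.exp t) 1 * y t + R * y t / (r * y t - lam)) t)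
    (t : ℝ) (ht : t ≤ 0) :
    (R / r + 1) * (Real.exp (eps * Real.exp t) - 1) ≤
      eps * Real.exp (eps * Real.exp t) * Real.exp t * y t := by
  let D : ℝ → ℝ := fun t => eps * Real.exp (eps * Real.exp t) * Real.exp t * y t -
    (R / r + 1) * (Real.exp (eps * Real.exp t) - 1)
  have hD : ∀ t ≤ 0, HasDerivAt D (eps * Real.exp (eps * Real.exp t) * Real.exp t *
      (R * y t / (r * y t - lam) - R / r)) t := by
    intro t ht
    have h1 := Real.hasDerivAt_exp t
    have h2 := (h1.const_mul eps).exp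
    have h3 := (((h2.const_mul eps).mul h1).mul (hy t).2).sub ((h2.sub_const 1).const_mul (R/r+1))
    refine h3.congr_deriv ?_
    rw [min_eq_left (Real.exp_le_one_iff.2 ht)]
    simp only [Pi.mul_apply]
    ring
  have hmono : MonotoneOn D (Iic 0) := by
    apply monotoneOn_of_deriv_nonneg (convex_Iic 0)
    · exact fun t ht => (hD t ht).continuousAt.continuousWithinAt
    · intro t ht
      rw [interior_Iic] at ht
      exact (hD t (le_of_lt ht)).differentiableAt.differentiableWithinAt
    · intro t ht
      rw [interior_Iic] at ht
      rw [(hD t (le_of_lt ht)).deriv]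
      have h1 : 0 < r * y t - lam := by nlinarith [(hy t).1.1]
      have h2 : R / r ≤ R * y t / (r * y t - lam) := by
        rw [div_le_div_iff₀ hr h1]; nlinarith
      have := sub_nonneg.2 h2
      positivity
  have hlim : Tendsto D atBot (𝓝 0) := by
    have h1 : Tendsto Real.exp atBot (𝓝 0) := Real.tendsto_exp_atBot
    have h2 : Tendsto (fun t => Real.exp (eps * Real.exp t)) atBot (𝓝 1) := by
      have := (Real.continuous_exp.tendsto (eps*0)).comp (h1.const_mul eps)
      simpa [Function.comp_def] using this
    have h3 : Tendsto (fun t => Real.exp t * y t) atBot (𝓝 0) := by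
      refine squeeze_zero (g := fun t => Real.exp t * d) (fun t => ?_) (fun t => ?_) ?_
      · have := ha.trans_le (hy t).1.1; positivity
      · exact mul_le_mul_of_nonneg_left (hy t).1.2 (Real.exp_pos t).le
      · simpa using h1.mul_const d
    have h4 := ((h2.const_mul eps).mul h3).sub ((h2.sub_const 1).const_mul (R/r+1))
    simp only [sub_self, mul_zero] at h4
    refine h4.congr fun t => ?_
    simp only [D]; ring
  have : 0 ≤ D t := by
    refine le_of_tendsto hlim ?_
    filter_upwards [eventually_le_atBot t] with τ hτ
    exact hmono (mem_Iic.2 (hτ.trans ht)) ht hτ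
  simp only [D] at this
  linarith

lemma s_lower (r R eps : ℝ) (hr : 0 < r) (hR : 0 < R) (he : 0 < eps)
    (y s : ℝ → ℝ) (hpos : ∀ t, 0 < y t) (hs0 : s 0 = 0)
    (hs : ∀ t, HasDerivAt s (1 / y t) t)
    (hlow : ∀ t ≤ 0, (R / r + 1) * (Real.exp (eps * Real.exp t) - 1) ≤
      eps * Real.exp (eps * Real.exp t) * Real.exp t * y t)
    (t : ℝ) (ht : t ≤ 0) :
    Real.log ((Real.exp (eps * Real.exp t) - 1) / (Real.exp eps - 1)) ≤ (R / r + 1) * s t := by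
  have hP : ∀ t, 0 < Real.exp (eps * Real.exp t) - 1 := by
    intro t
    have := Real.one_lt_exp_iff.2 (mul_pos he (Real.exp_pos t))
    linarith
  have hE : 0 < Real.exp eps - 1 := by
    have := Real.one_lt_exp_iff.2 he
    linarith
  let G : ℝ → ℝ := fun t => Real.log (Real.exp (eps * Real.exp t) - 1) - (R / r + 1) * s t
  have hG : ∀ t, HasDerivAt G (Real.exp (eps * Real.exp t) * (eps * Real.exp t) /
      (Real.exp (eps * Real.exp t) - 1) - (R/r+1) * (1 / y t)) t := by
    intro t
    have h1 := Real.hasDerivAt_exp t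
    have h2 := (((h1.const_mul eps).exp).sub_const 1).log (hP t).ne'
    exact h2.sub ((hs t).const_mul _)
  have hmono : MonotoneOn G (Iic 0) := by
    apply monotoneOn_of_deriv_nonneg (convex_Iic 0)
    · exact fun t ht => (hG t).continuousAt.continuousWithinAt
    · exact fun t ht => (hG t).differentiableAt.differentiableWithinAt
    · intro t ht
      rw [interior_Iic] at ht
      rw [(hG t).deriv, sub_nonneg, mul_one_div, div_le_div_iff₀ (hpos t) (hP t)]
      refine (hlow t (le_of_lt ht)).trans (le_of_eq ?_)
      ring
  have := hmono ht (mem_Iic.2 le_rfl) ht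
  simp only [G, hs0, Real.exp_zero, mul_one, mul_zero, sub_zero] at this
  rw [Real.log_div (hP t).ne' hE.ne']
  linarith

lemma second_order_max (g : ℝ → ℝ) (x : ℝ) (hc : ContinuousAt g x) (h : IsLocalMax g x) :
    deriv (deriv g) x ≤ 0 := by
  by_contra hcon
  push Not at hcon
  have h2 := isLocalMin_of_deriv_deriv_pos hcon h.deriv_eq_zero hc
  have h3 : g =ᶠ[𝓝 x] fun _ => g x := by
    filter_upwards [h, h2] with z h h'
    exact le_antisymm h h'
  have h4 := h3.deriv.deriv_eq
  simp at h4
  linarith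

lemma max_test (b ws : ℝ) (u φ : ℝ → ℝ) (w u2 : ℝ) (hw : w ∈ Ioo b ws)
    (hu : ∀ᶠ x in 𝓝 w, DifferentiableAt ℝ u x) (hu2 : HasDerivAt (deriv u) u2 w)
    (hφ : ContDiffAt ℝ 2 φ w) (h : IsLocalMaxOn (fun w => u w - φ w) (Ioo b ws) w) :
    deriv φ w = deriv u w ∧ u2 ≤ deriv (deriv φ) w := by
  have h' : IsLocalMax (fun w => u w - φ w) w := h.isLocalMax (Ioo_mem_nhds hw.1 hw.2)
  have hφ1 : ∀ᶠ x in 𝓝 w, DifferentiableAt ℝ φ x := by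
    filter_upwards [hφ.eventually (by simp)] with x hx
    exact hx.differentiableAt (by simp)
  have hφ2 : DifferentiableAt ℝ (deriv φ) w := by
    have h1 : ContDiffAt ℝ 1 (fderiv ℝ φ) w := hφ.fderiv_right (by norm_num [one_add_one_eq_two])
    have h2 := (h1.differentiableAt (by simp)).clm_apply (differentiableAt_const (1:ℝ))
    exact h2
  have e : deriv (fun w => u w - φ w) =ᶠ[𝓝 w] fun x => deriv u x - deriv φ x := by
    filter_upwards [hu, hφ1] with x h1 h2
    exact deriv_fun_sub h1 h2
  have h1 := h'.deriv_eq_zero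
  rw [e.self_of_nhds] at h1
  have h2 := second_order_max (fun w => u w - φ w) w
    (hu.self_of_nhds.continuousAt.sub hφ1.self_of_nhds.continuousAt) h'
  rw [e.deriv_eq, deriv_fun_sub hu2.differentiableAt hφ2, hu2.deriv] at h2
  exact ⟨by linarith, by linarith⟩

lemma min_test (b ws : ℝ) (u φ : ℝ → ℝ) (w u2 : ℝ) (hw : w ∈ Ioo b ws)
    (hu : ∀ᶠ x in 𝓝 w, DifferentiableAt ℝ u x) (hu2 : HasDerivAt (deriv u) u2 w)
    (hφ : ContDiffAt ℝ 2 φ w) (h : IsLocalMinOn (fun w => u w - φ w) (Ioo b ws) w) :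
    deriv φ w = deriv u w ∧ deriv (deriv φ) w ≤ u2 := by
  have e : ∀ f : ℝ → ℝ, deriv (fun x => - f x) = fun x => - deriv f x := by
    intro f; funext x; exact deriv.fun_neg
  have := max_test b ws (fun x => - u x) (fun x => - φ x) w (-u2) hw
    (by filter_upwards [hu] with x hx; exact hx.neg) (by rw [e]; exact hu2.neg) hφ.neg
    (by
      filter_upwards [h] with x hx
      exact (by linarith : -u x - -φ x ≤ -u w - -φ w))
  simp only [e] at this
  exact ⟨by linarith, by linarith⟩

lemma log_deriv (r c X w : ℝ) (hX : 0 < X) (hw : 0 < c - r * w) :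
    HasDerivAt (fun w => Real.log ((c - r * w) / X)) (-r / (c - r * w)) w := by
  have h1 : HasDerivAt (fun w => (c - r * w) / X) (-r / X) w := by
    have := (((hasDerivAt_id w).const_mul r).const_sub c).div_const X
    simpa using this
  refine (h1.log (by positivity)).congr_deriv ?_
  field_simp

/-- Existence of a classical, hence viscosity, solution with the stated bounds. -/
theorem stmt_7 (r μ σ c b ws R lam eps d : ℝ)
    (hr : 0 < r) (hμ : r < μ) (hσ : 0 < σ) (hc : 0 < c)
    (hws : ws = c / r) (hb : b < ws)
    (hR : R = (1 / 2) * ((μ - r) / σ) ^ 2)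
    (hlam : 0 < lam) (heps : 0 < eps)
    (hd : d = (1 / (2 * r)) *
      ((r + lam + R) + Real.sqrt ((r + lam + R) ^ 2 - 4 * r * lam)))
    (ψ₀ : ℝ → ℝ)
    (hψ₀ : ∀ w, ψ₀ w = ((c - r * w) / (c - r * b)) ^ d)
    (p : ℝ → ℝ)
    (hp : ∀ w, p w = (1 / eps) *
      Real.log (1 + (Real.exp eps - 1) * ((c - r * w) / (c - r * b)) ^ (R / r + 1))) :
    ∃ u : ℝ → ℝ,
      ContinuousOn u (Set.Icc b ws) ∧
      (∀ w ∈ Set.Icc b ws, u w ∈ Set.Icc (0 : ℝ) 1) ∧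
      IsViscSubsol lam eps R r c b ws u ∧
      IsViscSupersol lam eps R r c b ws u ∧
      u b = 1 ∧ u ws = 0 ∧
      (∀ w ∈ Set.Icc b ws, ψ₀ w ≤ u w ∧ u w ≤ p w) := by
  have hR0 : 0 < R := by
    rw [hR]
    have : 0 < (μ - r) / σ := div_pos (by linarith) hσ
    positivity
  have hrw : r * ws = c := by rw [hws]; field_simp
  have hX : 0 < c - r * b := by nlinarith
  -- facts on d
  obtain ⟨S, hS0, hS2, hdS⟩ : ∃ S : ℝ, 0 ≤ S ∧ S ^ 2 = (r + lam + R) ^ 2 - 4 * r * lam ∧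
      2 * r * d = r + lam + R + S := by
    refine ⟨_, Real.sqrt_nonneg _, Real.sq_sqrt ?_, ?_⟩
    · nlinarith [sq_nonneg (lam + R - r), mul_pos hr hR0]
    · rw [hd]; field_simp
  have hquad : (d - 1) * (r * d - lam) = R * d := by
    have h1 : 4 * r * ((d - 1) * (r * d - lam) - R * d) = 0 := by
      have : S = 2 * r * d - (r + lam + R) := by linarith
      rw [this] at hS2
      linear_combination hS2
    have := (mul_eq_zero.1 h1).resolve_left (by positivity)
    linarith
  have hd1 : 1 < d := by
    by_contra hcon
    push Not at hcon
    have h1 : r * d ≤ r := by nlinarith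
    have h2 : 0 ≤ r - lam - R - S := by linarith
    nlinarith [mul_pos hr hR0]
  have hdl : lam < r * d := by
    by_contra hcon
    push Not at hcon
    nlinarith [mul_nonneg (sub_nonneg.2 hd1.le) (sub_nonneg.2 hcon), mul_pos hR0 (zero_lt_one.trans hd1)]
  obtain ⟨a, ha, hla, y, hy⟩ := exists_y r lam R eps d hr hlam hR0 heps hd1 hdl hquad
  have hpos : ∀ t, 0 < y t := fun t => ha.trans_le (hy t).1.1
  have hyc : Continuous y := continuous_iff_continuousAt.2 fun t => (hy t).2.continuousAt
  obtain ⟨s, T, hs0, hs, hsT, hTs, hTm, hT⟩ := exists_T a d ha y hyc (fun t => (hy t).1)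
  have hT0 : T 0 = 0 := by rw [← hs0, hTs, hs0]
  let U : ℝ → ℝ := fun w => Real.exp (T (Real.log ((c - r * w) / (c - r * b))))
  let u : ℝ → ℝ := fun w => if w < ws then U w else 0
  have huU : ∀ w < ws, u w = U w := fun w hw => if_pos hw
  have huw : u ws = 0 := if_neg (lt_irrefl _)
  have hx : ∀ w < ws, 0 < c - r * w := fun w hw => by nlinarith
  -- derivatives
  have hU1 : ∀ w < ws, HasDerivAt U (-r * (U w * y (T (Real.log ((c - r * w) / (c - r * b))))) / (c - r * w)) w := by
    intro w hw
    have h1 := log_deriv r c _ w hX (hx w hw)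
    have h2 := (HasDerivAt.comp w (hT _) h1).exp
    refine h2.congr_deriv ?_
    simp only [U, Function.comp]
    ring
  have hu1 : ∀ w < ws, HasDerivAt u (-r * (U w * y (T (Real.log ((c - r * w) / (c - r * b))))) / (c - r * w)) w := by
    intro w hw
    refine (hU1 w hw).congr_of_eventuallyEq ?_
    filter_upwards [Iio_mem_nhds hw] with z hz
    exact huU z hz
  have hu2 : ∀ w < ws, HasDerivAt (deriv u) (r ^ 2 / (c - r * w) ^ 2 * (U w * y (T (Real.log ((c - r * w) / (c - r * b))))) *
      (y (T (Real.log ((c - r * w) / (c - r * b)))) + (1 - y (T (Real.log ((c - r * w) / (c - r * b)))) -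
       eps * min (Real.exp (T (Real.log ((c - r * w) / (c - r * b))))) 1 * y (T (Real.log ((c - r * w) / (c - r * b)))) +
       R * y (T (Real.log ((c - r * w) / (c - r * b)))) / (r * y (T (Real.log ((c - r * w) / (c - r * b)))) - lam)) - 1)) w := by
    intro w hw
    have h1 := log_deriv r c _ w hX (hx w hw)
    have h2 := HasDerivAt.comp w (hT _) h1
    have h3 := HasDerivAt.comp w (hy _).2 h2
    have h4 : HasDerivAt (fun w => c - r * w) (-r) w := by
      simpa using ((hasDerivAt_id w).const_mul r).const_sub c
    have h5 := (((hU1 w hw).mul h3).const_mul (-r)).div h4 (hx w hw).ne'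
    have h6 : deriv u =ᶠ[𝓝 w] fun w => -r * (U w * y (T (Real.log ((c - r * w) / (c - r * b))))) / (c - r * w) := by
      filter_upwards [Iio_mem_nhds hw] with z hz
      exact (hu1 z hz).deriv
    refine HasDerivAt.congr_of_eventuallyEq (h5.congr_deriv ?_) h6
    have hne := (hx w hw).ne'
    simp only [Function.comp, Pi.mul_apply]
    generalize R * y (T (Real.log ((c - r * w) / (c - r * b)))) / (r * y (T (Real.log ((c - r * w) / (c - r * b)))) - lam) = Q
    generalize y (T (Real.log ((c - r * w) / (c - r * b)))) = Y
    generalize min (Real.exp (T (Real.log ((c - r * w) / (c - r * b))))) 1 = m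
    field_simp
    ring
  have hlog : ∀ w, b ≤ w → w < ws → Real.log ((c - r * w) / (c - r * b)) ≤ 0 := by
    intro w hw hw'
    apply Real.log_nonpos (div_pos (hx w hw') hX).le
    rw [div_le_one hX]; nlinarith
  have hTn : ∀ w, b ≤ w → w < ws → T (Real.log ((c - r * w) / (c - r * b))) ≤ 0 := by
    intro w hw hw'
    rw [← hT0]; exact hTm.monotone (hlog w hw hw')
  -- summary at interior points
  have main : ∀ w ∈ Ioo b ws, ∃ u2, HasDerivAt (deriv u) u2 w ∧ deriv u w < 0 ∧
      0 < eps * (deriv u w) ^ 2 + u2 ∧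
      lam * u w + R * (deriv u w) ^ 2 / (eps * (deriv u w) ^ 2 + u2) - (r * w - c) * deriv u w = 0 := by
    intro w hw
    refine ⟨_, hu2 w hw.2, ?_⟩
    rw [(hu1 w hw.2).deriv, huU w hw.2]
    rw [min_eq_left (Real.exp_le_one_iff.2 (hTn w hw.1.le hw.2))]
    have hx0 := hx w hw.2
    have hU0 : 0 < U w := Real.exp_pos _
    have hY0 := hpos (T (Real.log ((c - r * w) / (c - r * b))))
    have hYl : 0 < r * y (T (Real.log ((c - r * w) / (c - r * b)))) - lam := by
      nlinarith [(hy (T (Real.log ((c - r * w) / (c - r * b))))).1.1]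
    change _ ∧ (0 < _ + r ^ 2 / (c - r * w) ^ 2 * (U w * y (T (Real.log ((c - r * w) / (c - r * b))))) *
      (_ + (1 - _ - eps * U w * _ + _) - 1)) ∧ lam * U w + _ / (_ + r ^ 2 / (c - r * w) ^ 2 * (U w * y (T (Real.log ((c - r * w) / (c - r * b))))) *
      (_ + (1 - _ - eps * U w * _ + _) - 1)) - _ = 0
    generalize y (T (Real.log ((c - r * w) / (c - r * b)))) = Y at *
    generalize U w = V at *
    have e : eps * (-r * (V * Y) / (c - r * w)) ^ 2 + r ^ 2 / (c - r * w) ^ 2 * (V * Y) *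
        (Y + (1 - Y - eps * V * Y + R * Y / (r * Y - lam)) - 1) =
        r ^ 2 / (c - r * w) ^ 2 * (V * Y) * (R * Y / (r * Y - lam)) := by
      field_simp; ring
    rw [e]
    refine ⟨?_, by positivity, ?_⟩
    · apply div_neg_of_neg_of_pos _ hx0
      have := mul_pos hr (mul_pos hU0 hY0)
      linarith
    · have e1 : R * (-r * (V * Y) / (c - r * w)) ^ 2 /
          (r ^ 2 / (c - r * w) ^ 2 * (V * Y) * (R * Y / (r * Y - lam))) = V * (r * Y - lam) := by
        have := hx0.ne'
        have := hYl.ne'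
        field_simp
      rw [e1]
      have e2 : (r * w - c) * (-r * (V * Y) / (c - r * w)) = r * (V * Y) := by
        rw [mul_div_assoc', div_eq_iff hx0.ne']; ring
      rw [e2]; ring
  have hdiff : ∀ w ∈ Ioo b ws, ∀ᶠ x in 𝓝 w, DifferentiableAt ℝ u x := by
    intro w hw
    filter_upwards [Iio_mem_nhds hw.2] with z hz
    exact (hu1 z hz).differentiableAt
  have hpw : p ws = 0 := by
    rw [hp, hrw]
    rw [sub_self, zero_div, Real.zero_rpow (by positivity)]
    simp
  have hψw : ψ₀ ws = 0 := by
    rw [hψ₀, hrw, sub_self, zero_div, Real.zero_rpow (by linarith)]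
  have hbounds : ∀ w ∈ Set.Icc b ws, ψ₀ w ≤ u w ∧ u w ≤ p w := by
    intro w hw
    rcases hw.2.lt_or_eq with h | h
    swap
    · rw [h, hpw, hψw, huw]; exact ⟨le_rfl, le_rfl⟩
    rw [huU w h, hp, hψ₀]
    have hz : 0 < (c - r * w) / (c - r * b) := div_pos (hx w h) hX
    have ht := hTn w hw.1 h
    rw [Real.rpow_def_of_pos hz, Real.rpow_def_of_pos hz]
    have hst := hsT (Real.log ((c - r * w) / (c - r * b)))
    change _ ≤ Real.exp (T (Real.log ((c - r * w) / (c - r * b)))) ∧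
      Real.exp (T (Real.log ((c - r * w) / (c - r * b)))) ≤ _
    set L := Real.log ((c - r * w) / (c - r * b)) with hL
    constructor
    · apply Real.exp_le_exp.2
      have := s_upper d y s hpos (fun t => (hy t).1.2) hs0 hs (T L) ht
      rw [hst] at this
      linarith
    · have := s_lower r R eps hr hR0 heps y s hpos hs0 hs
        (fun t ht => y_lower r lam R eps a d hr hlam hR0 heps ha hla y hy t ht) (T L) ht
      rw [hst] at this
      have hP : 0 < Real.exp (eps * Real.exp (T L)) - 1 := by
        have := Real.one_lt_exp_iff.2 (mul_pos heps (Real.exp_pos (T L)))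
        linarith
      have hE : 0 < Real.exp eps - 1 := by
        have := Real.one_lt_exp_iff.2 heps
        linarith
      rw [Real.log_le_iff_le_exp (by positivity), div_le_iff₀ hE] at this
      rw [one_div, ← div_eq_inv_mul, le_div_iff₀ heps, Real.le_log_iff_exp_le (by positivity)]
      rw [mul_comm L, mul_comm (Real.exp (T L))]
      linarith
  have hu01 : ∀ w ∈ Set.Icc b ws, u w ∈ Set.Icc (0 : ℝ) 1 := by
    intro w hw
    rcases hw.2.lt_or_eq with h | h
    · rw [huU w h]
      exact ⟨(Real.exp_pos _).le, Real.exp_le_one_iff.2 (hTn w hw.1 h)⟩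
    · rw [h, huw]; simp
  refine ⟨u, ?_, hu01, ?_, ?_, ?_, huw, hbounds⟩
  · intro w hw
    rcases hw.2.lt_or_eq with h | h
    · exact (hu1 w h).continuousAt.continuousWithinAt
    · subst h
      have hpc : ContinuousAt p w := by
        have : p = fun w => (1 / eps) *
          Real.log (1 + (Real.exp eps - 1) * ((c - r * w) / (c - r * b)) ^ (R / r + 1)) := funext hp
        rw [this]
        refine ContinuousAt.mul continuousAt_const (ContinuousAt.log ?_ ?_)
        · refine continuousAt_const.add (continuousAt_const.mul ?_)
          refine ContinuousAt.rpow_const (by fun_prop) (Or.inr (by positivity))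
        · rw [hrw, sub_self, zero_div, Real.zero_rpow (by positivity)]
          simp
      have hpt : Tendsto p (𝓝[Icc b w] w) (𝓝 0) := by
        rw [← hpw]; exact hpc.continuousWithinAt
      rw [ContinuousWithinAt, huw]
      refine tendsto_of_tendsto_of_tendsto_of_le_of_le' tendsto_const_nhds hpt ?_ ?_
      · filter_upwards [self_mem_nhdsWithin] with z hz
        exact (hu01 z hz).1
      · filter_upwards [self_mem_nhdsWithin] with z hz
        exact (hbounds z hz).2
  · intro w hw φ hφ hmax
    obtain ⟨u2, h2, hneg, hden, heq⟩ := main w hw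
    obtain ⟨e1, e2⟩ := max_test b ws u φ w u2 hw (hdiff w hw) h2 hφ hmax
    rw [e1]
    have hden' : 0 < eps * (deriv u w) ^ 2 + deriv (deriv φ) w := by linarith
    rw [Fop, if_pos hden', ← EReal.coe_zero, EReal.coe_le_coe_iff]
    have : R * (deriv u w) ^ 2 / (eps * (deriv u w) ^ 2 + deriv (deriv φ) w) ≤
        R * (deriv u w) ^ 2 / (eps * (deriv u w) ^ 2 + u2) :=
      div_le_div_of_nonneg_left (by positivity) hden (by linarith)
    linarith
  · intro w hw φ hφ hmin
    obtain ⟨u2, h2, hneg, hden, heq⟩ := main w hw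
    obtain ⟨e1, e2⟩ := min_test b ws u φ w u2 hw (hdiff w hw) h2 hφ hmin
    rw [e1]
    by_cases hden' : 0 < eps * (deriv u w) ^ 2 + deriv (deriv φ) w
    · rw [Fop, if_pos hden', ← EReal.coe_zero, EReal.coe_le_coe_iff]
      have : R * (deriv u w) ^ 2 / (eps * (deriv u w) ^ 2 + u2) ≤
          R * (deriv u w) ^ 2 / (eps * (deriv u w) ^ 2 + deriv (deriv φ) w) :=
        div_le_div_of_nonneg_left (by positivity) hden' (by linarith)
      linarith
    · rw [Fop, if_neg hden', if_neg (fun h => hneg.ne h.2)]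
      exact le_top
  · rw [huU b hb]
    simp only [U]
    rw [div_self hX.ne', Real.log_one, hT0, Real.exp_zero]
end

section
/- Let λ > 0 and ε > 0. Let v : [b, w_s] → ℝ be a continuous viscosity solution of G = 0 on (b, w_s) with v(b) = e^ε, v(w_s) = 1, and e^{ε·ψ₀(w)} ≤ v(w) ≤ e^{ε·𝔭(w)} for all w ∈ (b, w_s), where ψ₀(w) := ((c − r w)/(c − r b))^d and 𝔭(w) := (1/ε)·ln(1 + (e^ε − 1)·((c − r w)/(c − r b))^{R/r + 1}). Then v is strictly convex and strictly decreasing on [b, w_s]. -/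
/-- The Hamiltonian `G(w,v,p,A)` of the Cole–Hopf transformed problem, with value `+∞`
(in `EReal`) when the infimum over π is not attained finitely. -/
noncomputable def Gop (lam R r c : ℝ) (w v p A : ℝ) : EReal :=
  if 0 < A then
    ((lam * v * Real.log v + R * p ^ 2 / A - (r * w - c) * p : ℝ) : EReal)
  else if A = 0 ∧ p = 0 then ((lam * v * Real.log v : ℝ) : EReal)
  else ⊤

/-- `v` is a viscosity subsolution of `G = 0` on `(b, ws)`. -/
def IsViscSubsolG (lam R r c b ws : ℝ) (v : ℝ → ℝ) : Prop :=
  ∀ w₀ ∈ Set.Ioo b ws, ∀ φ : ℝ → ℝ, ContDiffAt ℝ 2 φ w₀ →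
    IsLocalMaxOn (fun w => v w - φ w) (Set.Ioo b ws) w₀ →
    Gop lam R r c w₀ (v w₀) (deriv φ w₀) (deriv (deriv φ) w₀) ≤ 0

/-- `v` is a viscosity supersolution of `G = 0` on `(b, ws)`. -/
def IsViscSupersolG (lam R r c b ws : ℝ) (v : ℝ → ℝ) : Prop :=
  ∀ w₀ ∈ Set.Ioo b ws, ∀ φ : ℝ → ℝ, ContDiffAt ℝ 2 φ w₀ →
    IsLocalMinOn (fun w => v w - φ w) (Set.Ioo b ws) w₀ →
    0 ≤ Gop lam R r c w₀ (v w₀) (deriv φ w₀) (deriv (deriv φ) w₀)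

/-- The viscosity solution of the Cole–Hopf transformed Dirichlet problem
is strictly convex and strictly decreasing. -/
theorem stmt_8 (r μ σ c b ws R lam eps d : ℝ)
    (hr : 0 < r) (hμ : r < μ) (hσ : 0 < σ) (hc : 0 < c)
    (hws : ws = c / r) (hb : b < ws)
    (hR : R = (1 / 2) * ((μ - r) / σ) ^ 2)
    (hlam : 0 < lam) (heps : 0 < eps)
    (hd : d = (1 / (2 * r)) *
      ((r + lam + R) + Real.sqrt ((r + lam + R) ^ 2 - 4 * r * lam)))
    (ψ₀ : ℝ → ℝ)
    (hψ₀ : ∀ w, ψ₀ w = ((c - r * w) / (c - r * b)) ^ d)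
    (p : ℝ → ℝ)
    (hp : ∀ w, p w = (1 / eps) *
      Real.log (1 + (Real.exp eps - 1) * ((c - r * w) / (c - r * b)) ^ (R / r + 1)))
    (v : ℝ → ℝ)
    (hv_cont : ContinuousOn v (Set.Icc b ws))
    (hv_sub : IsViscSubsolG lam R r c b ws v)
    (hv_super : IsViscSupersolG lam R r c b ws v)
    (hvb : v b = Real.exp eps) (hvws : v ws = 1)
    (hv_bounds : ∀ w ∈ Set.Ioo b ws,
      Real.exp (eps * ψ₀ w) ≤ v w ∧ v w ≤ Real.exp (eps * p w)) :
    StrictConvexOn ℝ (Set.Icc b ws) v ∧ StrictAntiOn v (Set.Icc b ws) := by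
  have hwr : ∀ w, w < ws → 0 < c - r * w := by
    intro w hw
    rw [hws, lt_div_iff₀ hr] at hw
    linarith
  have hgt : ∀ w, b ≤ w → w < ws → 1 < v w := by
    intro w h1 h2
    rcases eq_or_lt_of_le h1 with h | h
    · rw [← h, hvb]
      exact Real.one_lt_exp_iff.mpr heps
    · refine lt_of_lt_of_le ?_ (hv_bounds w ⟨h, h2⟩).1
      rw [Real.one_lt_exp_iff, hψ₀]
      exact mul_pos heps (Real.rpow_pos_of_pos (div_pos (hwr w h2) (hwr b hb)) d)
  -- no affine function touches `v` from above at an interior point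
  have key : ∀ w₀ ∈ Set.Ioo b ws, ∀ k q : ℝ,
      ¬ IsLocalMaxOn (fun w => v w - (q + k * w)) (Set.Ioo b ws) w₀ := by
    intro w₀ hw₀ k q hmax
    have h := hv_sub w₀ hw₀ (fun w => q + k * w) (by fun_prop) hmax
    have hder : deriv (fun w : ℝ => q + k * w) = fun _ => k := by
      funext w
      simpa using (((hasDerivAt_id w).const_mul k).const_add q).deriv
    have hv1 := hgt w₀ hw₀.1.le hw₀.2
    have hpos : 0 < lam * v w₀ * Real.log (v w₀) :=
      mul_pos (mul_pos hlam (by linarith)) (Real.log_pos hv1)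
    rw [hder] at h
    simp only [deriv_const, Gop, lt_irrefl, if_false, true_and] at h
    split_ifs at h with hk
    · have h' : lam * v w₀ * Real.log (v w₀) ≤ 0 := by exact_mod_cast h
      linarith
    · simp at h
  have chord : ∀ x ∈ Set.Icc b ws, ∀ y ∈ Set.Icc b ws, ∀ m ∈ Set.Ioo x y, ∀ k q : ℝ,
      v x = q + k * x → v y = q + k * y → v m < q + k * m := by
    intro x hx y hy m hm k q hkx hky
    by_contra! hcon
    have hsub : Set.Icc x y ⊆ Set.Icc b ws := Set.Icc_subset_Icc hx.1 hy.2
    have hcont : ContinuousOn (fun w => v w - (q + k * w)) (Set.Icc x y) :=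
      (hv_cont.mono hsub).sub (by fun_prop)
    obtain ⟨z, hz, hzmax⟩ := isCompact_Icc.exists_isMaxOn
      ⟨m, Set.Ioo_subset_Icc_self hm⟩ hcont
    have hint : ∃ z ∈ Set.Ioo x y, IsMaxOn (fun w => v w - (q + k * w)) (Set.Icc x y) z := by
      by_cases hzi : z ∈ Set.Ioo x y
      · exact ⟨z, hzi, hzmax⟩
      · have hz0 : v z - (q + k * z) = 0 := by
          rcases eq_or_lt_of_le hz.1 with h | h
          · rw [← h]; linarith
          · rcases eq_or_lt_of_le hz.2 with h' | h'
            · rw [h']; linarith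
            · exact absurd ⟨h, h'⟩ hzi
        refine ⟨m, hm, fun w hw => ?_⟩
        have := hzmax hw
        simp only [Set.mem_ofPred_eq] at this ⊢
        linarith
    obtain ⟨u, hu, humax⟩ := hint
    refine key u ⟨hx.1.trans_lt hu.1, hu.2.trans_le hy.2⟩ k q ?_
    exact (humax.isLocalMax (Icc_mem_nhds hu.1 hu.2)).on _
  have hconv : StrictConvexOn ℝ (Set.Icc b ws) v := by
    refine LinearOrder.strictConvexOn_of_lt (convex_Icc b ws) ?_
    intro x hx y hy hxy s t hs ht hst
    obtain rfl : s = 1 - t := by linarith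
    have hyx : y - x ≠ 0 := by linarith
    have h1 : 0 < t * (y - x) := mul_pos ht (by linarith)
    have h2 : 0 < (1 - t) * (y - x) := mul_pos hs (by linarith)
    have h := chord x hx y hy ((1 - t) * x + t * y)
      ⟨by linarith, by linarith⟩
      ((v y - v x) / (y - x)) (v x - (v y - v x) / (y - x) * x) (by ring)
      (by field_simp; ring)
    simp only [smul_eq_mul]
    refine h.trans_eq ?_
    field_simp
    ring
  refine ⟨hconv, ?_⟩
  intro x hx y hy hxy
  rcases eq_or_lt_of_le hy.2 with h | h
  · rw [h, hvws]
    exact hgt x hx.1 (h ▸ hxy)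
  · have h1 := hgt y hy.1 h
    by_contra! hcon
    have h3 := hconv.slope_strict_mono_adjacent hx ⟨hb.le, le_rfl⟩ hxy h
    have h4 : 0 ≤ (v y - v x) / (y - x) := div_nonneg (by linarith) (by linarith)
    have h5 : (v ws - v y) / (ws - y) < 0 :=
      div_neg_of_neg_of_pos (by linarith) (by linarith)
    linarith
end

section
/- Let λ > 0 and ε > 0. Let v : [b, w_s] → ℝ be a continuous, convex, strictly decreasing viscosity solution of G = 0 on (b, w_s) with v(b) = e^ε, v(w_s) = 1, and e^{ε·ψ₀(w)} ≤ v(w) ≤ e^{ε·𝔭(w)} for all w ∈ (b, w_s), where ψ₀(w) := ((c − r w)/(c − r b))^d and 𝔭(w) := (1/ε)·ln(1 + (e^ε − 1)·((c − r w)/(c − r b))^{R/r + 1}). Then v is continuously differentiable on [b, w_s], twice continuously differentiable on [b, w_s), satisfies v'(w) < 0 and v''(w) > 0 for all w ∈ [b, w_s), and solves the ordinary differential equation λ·v(w)·ln v(w) = − R·v'(w)²/v''(w) + (r w − c)·v'(w) for all w ∈ (b, w_s). -/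
open Set Filter Topology

lemma quad_deriv_s9 (M s : ℝ) :
    deriv (fun t : ℝ => M / 2 * t ^ 2 + s * t) = fun t => M * t + s := by
  funext t
  have h : HasDerivAt (fun t : ℝ => M / 2 * t ^ 2 + s * t) (M / 2 * (2 * t) + s * 1) t := by
    have := ((hasDerivAt_pow 2 t).const_mul (M / 2)).fun_add ((hasDerivAt_id' t).const_mul s)
    simpa using this
  rw [h.deriv]; ring

lemma quad_hasDerivAt (M s t : ℝ) :
    HasDerivAt (fun t : ℝ => M / 2 * t ^ 2 + s * t) (M * t + s) t := by
  have := ((hasDerivAt_pow 2 t).const_mul (M / 2)).fun_add ((hasDerivAt_id' t).const_mul s)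
  refine this.congr_deriv ?_
  simp
  ring

lemma quad_deriv2_s9 (M s t : ℝ) :
    deriv (deriv (fun t : ℝ => M / 2 * t ^ 2 + s * t)) t = M := by
  rw [quad_deriv_s9]
  simp

lemma sub_quad_s9 {lam R r c b ws : ℝ} {v : ℝ → ℝ} (hs : IsViscSubsolG lam R r c b ws v)
    {w : ℝ} (hw : w ∈ Ioo b ws) {M s : ℝ}
    (hmax : IsLocalMax (fun t => v t - (M / 2 * t ^ 2 + s * t)) w)
    (hp : M * w + s ≠ 0) :
    0 < M ∧ lam * v w * Real.log (v w) + R * (M * w + s) ^ 2 / M - (r * w - c) * (M * w + s) ≤ 0 := by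
  have h := hs w hw (fun t => M / 2 * t ^ 2 + s * t) (by fun_prop) (hmax.on _)
  rw [quad_deriv2_s9, quad_deriv_s9] at h
  simp only [Gop] at h
  by_cases hM : 0 < M
  · rw [if_pos hM] at h
    exact ⟨hM, by exact_mod_cast h⟩
  · rw [if_neg hM, if_neg (fun hh => hp hh.2)] at h
    simp at h

lemma super_quad_s9 {lam R r c b ws : ℝ} {v : ℝ → ℝ} (hs : IsViscSupersolG lam R r c b ws v)
    {w : ℝ} (hw : w ∈ Ioo b ws) {M s : ℝ} (hM : 0 < M)
    (hmin : IsLocalMin (fun t => v t - (M / 2 * t ^ 2 + s * t)) w) :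
    0 ≤ lam * v w * Real.log (v w) + R * (M * w + s) ^ 2 / M - (r * w - c) * (M * w + s) := by
  have h := hs w hw (fun t => M / 2 * t ^ 2 + s * t) (by fun_prop) (hmin.on _)
  rw [quad_deriv2_s9, quad_deriv_s9] at h
  simp only [Gop] at h
  rw [if_pos hM] at h
  exact_mod_cast h

/-- Interior local maximum. -/
lemma exists_localMax {h : ℝ → ℝ} {x y m : ℝ} (hm : m ∈ Ioo x y) (hc : ContinuousOn h (Icc x y))
    (hx : h x < h m) (hy : h y < h m) : ∃ z ∈ Ioo x y, IsLocalMax h z := by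
  obtain ⟨z, hz, hzmax⟩ := isCompact_Icc.exists_isMaxOn ⟨m, Ioo_subset_Icc_self hm⟩ hc
  have hmz : h m ≤ h z := hzmax (Ioo_subset_Icc_self hm)
  have h1 : z ≠ x := by rintro rfl; linarith
  have h2 : z ≠ y := by rintro rfl; linarith
  have hz' : z ∈ Ioo x y := ⟨lt_of_le_of_ne hz.1 h1.symm, lt_of_le_of_ne hz.2 h2⟩
  exact ⟨z, hz', hzmax.isLocalMax (Icc_mem_nhds hz'.1 hz'.2)⟩

lemma deriv_pos_right {h : ℝ → ℝ} {x y a : ℝ} (hxy : x < y) (hd : HasDerivAt h a x) (ha : 0 < a) :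
    ∃ t ∈ Ioo x y, h x < h t := by
  have h1 := hd.tendsto_slope
  have h2 : ∀ᶠ t in 𝓝[>] x, 0 < slope h x t :=
    (h1.mono_left (nhdsWithin_mono _ (fun t ht => ne_of_gt ht))).eventually (lt_mem_nhds ha)
  obtain ⟨t, ht, ht'⟩ := (h2.and (Ioo_mem_nhdsGT hxy)).exists
  refine ⟨t, ht', ?_⟩
  rw [slope_def_field] at ht
  have := (div_pos_iff_of_pos_right (by linarith [ht'.1] : 0 < t - x)).1 ht
  linarith

lemma deriv_neg_left {h : ℝ → ℝ} {x y a : ℝ} (hxy : x < y) (hd : HasDerivAt h a y) (ha : a < 0) :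
    ∃ t ∈ Ioo x y, h y < h t := by
  have h1 := hd.tendsto_slope
  have h2 : ∀ᶠ t in 𝓝[<] y, slope h y t < 0 :=
    (h1.mono_left (nhdsWithin_mono _ (fun t ht => ne_of_lt ht))).eventually (gt_mem_nhds ha)
  obtain ⟨t, ht, ht'⟩ := (h2.and (Ioo_mem_nhdsLT hxy)).exists
  refine ⟨t, ht', ?_⟩
  rw [slope_def_field] at ht
  by_contra hcon
  have : 0 ≤ (h t - h y) / (t - y) := div_nonneg_of_nonpos (by linarith) (by linarith [ht'.2])
  linarith

lemma exists_localMax_of_deriv {h : ℝ → ℝ} {x y a a' : ℝ} (hxy : x < y)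
    (hc : ContinuousOn h (Icc x y))
    (hx : HasDerivAt h a x) (ha : 0 < a) (hy : HasDerivAt h a' y) (ha' : a' < 0) :
    ∃ z ∈ Ioo x y, IsLocalMax h z := by
  obtain ⟨t1, ht1, h1⟩ := deriv_pos_right hxy hx ha
  obtain ⟨t2, ht2, h2⟩ := deriv_neg_left hxy hy ha'
  rcases le_total (h t1) (h t2) with h3 | h3
  · exact exists_localMax ht2 hc (by linarith) h2
  · exact exists_localMax ht1 hc h1 (by linarith)

lemma exists_localMin_of_deriv {h : ℝ → ℝ} {x y a a' : ℝ} (hxy : x < y)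
    (hc : ContinuousOn h (Icc x y))
    (hx : HasDerivAt h a x) (ha : a < 0) (hy : HasDerivAt h a' y) (ha' : 0 < a') :
    ∃ z ∈ Ioo x y, IsLocalMin h z := by
  obtain ⟨z, hz, hz'⟩ := exists_localMax_of_deriv (h := fun t => - h t) hxy hc.neg hx.neg
    (by linarith) hy.neg (by linarith)
  refine ⟨z, hz, ?_⟩
  have := hz'.neg
  simpa using this

lemma hasDerivAt_of_sides {v : ℝ → ℝ} {z p : ℝ} (hl : HasDerivWithinAt v p (Iio z) z)
    (hr : HasDerivWithinAt v p (Ioi z) z) : HasDerivAt v p z := by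
  have := hl.union hr
  rw [Iio_union_Ioi] at this
  rw [hasDerivAt_iff_tendsto_slope]
  have := hasDerivWithinAt_iff_tendsto_slope.1 this
  simpa using this

/-- A convex function touched from above by a differentiable function is differentiable. -/
lemma convex_touch {S : Set ℝ} {v φ : ℝ → ℝ} (hv : ConvexOn ℝ S v) {z p : ℝ}
    (hz : z ∈ interior S) (hφ : HasDerivAt φ p z) (hmax : IsLocalMax (fun t => v t - φ t) z) :
    HasDerivAt v p z := by
  have hr := hv.hasDerivWithinAt_rightDeriv_of_mem_interior hz
  have hl := hv.hasDerivWithinAt_leftDeriv_of_mem_interior hz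
  have hle := hv.leftDeriv_le_rightDeriv_of_mem_interior hz
  set D := derivWithin v (Ioi z) z
  set E := derivWithin v (Iio z) z
  have h1 : D - p ≤ 0 := by
    have h := (hasDerivWithinAt_iff_tendsto_slope' (by simp)).1 (hr.fun_sub hφ.hasDerivWithinAt)
    refine le_of_tendsto h ?_
    filter_upwards [self_mem_nhdsWithin, mem_nhdsWithin_of_mem_nhds hmax] with t ht ht'
    rw [slope_def_field]
    simp only [mem_Ioi] at ht ht'
    apply div_nonpos_of_nonpos_of_nonneg
    · simpa using ht'
    · linarith
  have h2 : 0 ≤ E - p := by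
    have h := (hasDerivWithinAt_iff_tendsto_slope' (by simp)).1 (hl.fun_sub hφ.hasDerivWithinAt)
    refine ge_of_tendsto h ?_
    filter_upwards [self_mem_nhdsWithin, mem_nhdsWithin_of_mem_nhds hmax] with t ht ht'
    rw [slope_def_field]
    simp only [mem_Iio] at ht ht'
    apply div_nonneg_of_nonpos
    · simpa using ht'
    · linarith
  have hD : D = p := by linarith
  have hE : E = p := by linarith
  rw [hD] at hr
  rw [hE] at hl
  exact hasDerivAt_of_sides hl hr

/-- One sided limits of the derivative of a convex function are one sided derivatives. -/
lemma right_limit {v : ℝ → ℝ} {x y B : ℝ} (hxy : x < y) (hc : ContinuousWithinAt v (Ioo x y) x)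
    (hd : ∀ t ∈ Ioo x y, DifferentiableAt ℝ v t) (hm : MonotoneOn (deriv v) (Ioo x y))
    (hB : ∀ t ∈ Ioo x y, B ≤ deriv v t) :
    ∃ e, Tendsto (deriv v) (𝓝[>] x) (𝓝 e) ∧ HasDerivWithinAt v e (Ici x) x := by
  have h := hm.tendsto_nhdsWithin_Ioo_right (nonempty_Ioo.2 hxy)
    ⟨B, by rintro _ ⟨t, ht, rfl⟩; exact hB t ht⟩
  exact ⟨_, h, hasDerivWithinAt_Ici_of_tendsto_deriv (fun t ht => (hd t ht).differentiableWithinAt)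
    hc (Ioo_mem_nhdsGT hxy) h⟩

lemma left_limit {v : ℝ → ℝ} {x y B : ℝ} (hxy : x < y) (hc : ContinuousWithinAt v (Ioo x y) y)
    (hd : ∀ t ∈ Ioo x y, DifferentiableAt ℝ v t) (hm : MonotoneOn (deriv v) (Ioo x y))
    (hB : ∀ t ∈ Ioo x y, deriv v t ≤ B) :
    ∃ e, Tendsto (deriv v) (𝓝[<] y) (𝓝 e) ∧ HasDerivWithinAt v e (Iic y) y := by
  have h := hm.tendsto_nhdsWithin_Ioo_left (nonempty_Ioo.2 hxy)
    ⟨B, by rintro _ ⟨t, ht, rfl⟩; exact hB t ht⟩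
  exact ⟨_, h, hasDerivWithinAt_Iic_of_tendsto_deriv (fun t ht => (hd t ht).differentiableWithinAt)
    hc (Ioo_mem_nhdsLT hxy) h⟩

lemma continuousAt_deriv_of_mono {v : ℝ → ℝ} {x y z : ℝ} (hz : z ∈ Ioo x y)
    (hd : ∀ t ∈ Ioo x y, DifferentiableAt ℝ v t) (hm : MonotoneOn (deriv v) (Ioo x y)) :
    ContinuousAt (deriv v) z := by
  have hs1 : Ioo z y ⊆ Ioo x y := Ioo_subset_Ioo_left hz.1.le
  have hs2 : Ioo x z ⊆ Ioo x y := Ioo_subset_Ioo_right hz.2.le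
  obtain ⟨e, he, he'⟩ := right_limit hz.2 (hd z hz).continuousAt.continuousWithinAt
    (fun t ht => hd t (hs1 ht)) (hm.mono hs1) (B := deriv v z)
    (fun t ht => hm hz (hs1 ht) ht.1.le)
  obtain ⟨f, hf, hf'⟩ := left_limit hz.1 (hd z hz).continuousAt.continuousWithinAt
    (fun t ht => hd t (hs2 ht)) (hm.mono hs2) (B := deriv v z)
    (fun t ht => hm (hs2 ht) hz ht.2.le)
  have h1 := (uniqueDiffOn_Ici z z self_mem_Ici).eq_deriv _ he' (hd z hz).hasDerivAt.hasDerivWithinAt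
  have h2 := (uniqueDiffOn_Iic z z self_mem_Iic).eq_deriv _ hf' (hd z hz).hasDerivAt.hasDerivWithinAt
  rw [h1] at he
  rw [h2] at hf
  rw [continuousAt_iff_continuous_left'_right']
  exact ⟨hf, he⟩

lemma deriv_neg_of_anti {b ws : ℝ} {v : ℝ → ℝ} (hb : b < ws) (hv : ConvexOn ℝ (Icc b ws) v)
    (ha : StrictAntiOn v (Icc b ws)) {x p : ℝ} (hx : x ∈ Ioo b ws) (hp : HasDerivAt v p x) :
    p < 0 := by
  have h1 := hv.le_slope_of_hasDerivAt (Ioo_subset_Icc_self hx) (right_mem_Icc.2 hb.le) hx.2 hp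
  rw [slope_def_field] at h1
  have h2 : v ws < v x := ha (Ioo_subset_Icc_self hx) (right_mem_Icc.2 hb.le) hx.2
  have h3 : (v ws - v x) / (ws - x) < 0 := div_neg_of_neg_of_pos (by linarith) (by linarith [hx.2])
  linarith

lemma dense_pt {lam R r c b ws : ℝ} {v : ℝ → ℝ} (hR : 0 < R) (hb : b < ws)
    (hcont : ContinuousOn v (Icc b ws)) (hv : ConvexOn ℝ (Icc b ws) v)
    (ha : StrictAntiOn v (Icc b ws)) (hs : IsViscSubsolG lam R r c b ws v)
    {α β : ℝ} (hα : b ≤ α) (hβ : β ≤ ws) (hαβ : α < β) :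
    ∃ x ∈ Ioo α β, ∃ p, HasDerivAt v p x ∧ lam * v x * Real.log (v x) < (r * x - c) * p := by
  obtain ⟨m, hm1, hm2⟩ := exists_between hαβ
  set N : ℝ := 2 * (|v α - v m| + 1) / (α - m) ^ 2 + 2 * (|v β - v m| + 1) / (β - m) ^ 2 with hN
  have hA : 0 < (α - m) ^ 2 := sq_pos_of_neg (by linarith)
  have hB : 0 < (β - m) ^ 2 := sq_pos_of_pos (by linarith)
  have e1 : 2 * (|v α - v m| + 1) ≤ N * (α - m) ^ 2 := by
    rw [hN, add_mul, div_mul_cancel₀ _ hA.ne']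
    have : 0 ≤ 2 * (|v β - v m| + 1) / (β - m) ^ 2 * (α - m) ^ 2 := by positivity
    linarith
  have e2 : 2 * (|v β - v m| + 1) ≤ N * (β - m) ^ 2 := by
    rw [hN, add_mul, div_mul_cancel₀ _ hB.ne']
    have : 0 ≤ 2 * (|v α - v m| + 1) / (α - m) ^ 2 * (β - m) ^ 2 := by positivity
    linarith
  have f1 := le_abs_self (v α - v m)
  have f2 := le_abs_self (v β - v m)
  have hsub : Icc α β ⊆ Icc b ws := Icc_subset_Icc hα hβ
  obtain ⟨z, hz, hzm⟩ := exists_localMax (h := fun t => v t - (N / 2 * t ^ 2 + (-(N * m)) * t))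
    (⟨hm1, hm2⟩ : m ∈ Ioo α β) (by
      apply (hcont.mono hsub).sub
      fun_prop) (by nlinarith) (by nlinarith)
  have hzI : z ∈ Ioo b ws := ⟨by linarith [hz.1], by linarith [hz.2]⟩
  have hd := convex_touch hv (by rw [interior_Icc]; exact hzI) (quad_hasDerivAt N (-(N * m)) z) hzm
  have hneg := deriv_neg_of_anti hb hv ha hzI hd
  obtain ⟨hN0, hG⟩ := sub_quad_s9 hs hzI hzm hneg.ne
  refine ⟨z, hz, _, hd, ?_⟩
  have : 0 < R * (N * z + -(N * m)) ^ 2 / N := by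
    apply div_pos _ hN0
    apply mul_pos hR
    have := hneg.ne
    positivity
  linarith

lemma diff_interior {lam R r c b ws : ℝ} {v : ℝ → ℝ} (hR : 0 < R) (hb : b < ws)
    (hcont : ContinuousOn v (Icc b ws)) (hv : ConvexOn ℝ (Icc b ws) v)
    (ha : StrictAntiOn v (Icc b ws)) (hs : IsViscSubsolG lam R r c b ws v)
    (hsup : IsViscSupersolG lam R r c b ws v) (hrc : ∀ x < ws, r * x - c < 0)
    (hpos : ∀ x ∈ Icc b ws, 0 < v x)
    {w : ℝ} (hw : w ∈ Ioo b ws) : DifferentiableAt ℝ v w := by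
  have hwi : w ∈ interior (Icc b ws) := by rw [interior_Icc]; exact hw
  have hr := hv.hasDerivWithinAt_rightDeriv_of_mem_interior hwi
  have hl := hv.hasDerivWithinAt_leftDeriv_of_mem_interior hwi
  have hle := hv.leftDeriv_le_rightDeriv_of_mem_interior hwi
  have hrs : ∀ y ∈ Icc b ws, w < y → derivWithin v (Ioi w) w ≤ slope v w y := fun y hy hwy =>
    hv.rightDeriv_le_slope_of_mem_interior hwi hy hwy
  have hls : ∀ y ∈ Icc b ws, y < w → slope v y w ≤ derivWithin v (Iio w) w := fun y hy hwy =>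
    hv.slope_le_leftDeriv_of_mem_interior hy hwi hwy
  set D := derivWithin v (Ioi w) w
  set E := derivWithin v (Iio w) w
  rcases hle.eq_or_lt with h | hlt
  · rw [h] at hl
    exact (hasDerivAt_of_sides hl hr).differentiableAt
  exfalso
  have hcw : ContinuousAt v w := hcont.continuousAt (Icc_mem_nhds hw.1 hw.2)
  have hvw := hpos w (Ioo_subset_Icc_self hw)
  set q := (E + D) / 2 with hq
  -- supersolution test
  have key : ∀ A > 0, 0 ≤ lam * v w * Real.log (v w) + R * q ^ 2 / A - (r * w - c) * q := by
    intro A hA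
    have h := super_quad_s9 hsup hw (M := A) (s := q - A * w) hA ?_
    · simpa using h
    · set δ := (D - E) / A with hδ
      have hδA : A * δ = D - E := by rw [hδ]; field_simp
      have hδ0 : 0 < δ := div_pos (by linarith) hA
      filter_upwards [Ioo_mem_nhds hw.1 hw.2,
        Ioo_mem_nhds (show w - δ < w by linarith) (show w < w + δ by linarith)] with t ht ht'
      rcases lt_trichotomy t w with h1 | h1 | h1
      · have h2 := hls t (Ioo_subset_Icc_self ht) h1
        rw [slope_def_field, div_le_iff₀ (by linarith)] at h2
        have h3 : 0 ≤ (w - t) * (A * δ - A * (w - t)) :=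
          mul_nonneg (by linarith) (by rw [← mul_sub]; exact mul_nonneg hA.le (by linarith [ht'.1]))
        rw [hδA] at h3
        nlinarith
      · rw [h1]
      · have h2 := hrs t (Ioo_subset_Icc_self ht) h1
        rw [slope_def_field, le_div_iff₀ (by linarith)] at h2
        have h3 : 0 ≤ (t - w) * (A * δ - A * (t - w)) :=
          mul_nonneg (by linarith) (by rw [← mul_sub]; exact mul_nonneg hA.le (by linarith [ht'.2]))
        rw [hδA] at h3
        nlinarith
  have key2 : (r * w - c) * q ≤ lam * v w * Real.log (v w) := by
    by_contra hcon
    push Not at hcon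
    set η := (r * w - c) * q - lam * v w * Real.log (v w) with hη
    have hη0 : 0 < η := by linarith
    have hRq : 0 ≤ R * q ^ 2 := by positivity
    have h := key ((R * q ^ 2 + 1) / η) (by positivity)
    have h2 : R * q ^ 2 / ((R * q ^ 2 + 1) / η) < η := by
      rw [div_lt_iff₀ (by positivity)]
      field_simp
      linarith
    linarith
  have key3 : lam * v w * Real.log (v w) ≤ (r * w - c) * D := by
    by_contra hcon
    push Not at hcon
    have hc2 : ContinuousAt (fun t => lam * v t * Real.log (v t) - (r * t - c) * D) w := by
      have := hcw.log hvw.ne'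
      fun_prop
    have hev : ∀ᶠ t in 𝓝 w, 0 < lam * v t * Real.log (v t) - (r * t - c) * D :=
      hc2.eventually (lt_mem_nhds (by linarith))
    obtain ⟨y, hy, hy'⟩ := mem_nhdsGT_iff_exists_Ioo_subset.1
      (inter_mem (mem_nhdsWithin_of_mem_nhds hev) (Ioo_mem_nhdsGT hw.2))
    have hy1 : w < min y ws := lt_min hy hw.2
    obtain ⟨x, hx, p, hp, hG⟩ := dense_pt hR hb hcont hv ha hs hw.1.le (min_le_right y ws) hy1
    have hxy : x ∈ Ioo w y := ⟨hx.1, lt_of_lt_of_le hx.2 (min_le_left _ _)⟩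
    have hx1 := (hy' hxy).1
    replace hx1 : 0 < lam * v x * Real.log (v x) - (r * x - c) * D := hx1
    have hxI := (hy' hxy).2
    have hxb : x ∈ Icc b ws := ⟨by linarith [hxI.1, hw.1], hxI.2.le⟩
    have hDp : D ≤ p := (hrs x hxb hx.1).trans
      (hv.slope_le_of_hasDerivAt (Ioo_subset_Icc_self hw) hxb hx.1 hp)
    have := hrc x hxI.2
    nlinarith
  have := hrc w hw.2
  nlinarith

lemma hasDerivAt_of_bounds {P : ℝ → ℝ} {x0 g0 : ℝ}
    (hup : ∀ M > g0, ∃ s ∈ 𝓝 x0, ∀ x ∈ s, ∀ y ∈ s, x < y → P y - P x ≤ M * (y - x))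
    (hlo : ∀ M < g0, ∃ s ∈ 𝓝 x0, ∀ x ∈ s, ∀ y ∈ s, x < y → M * (y - x) ≤ P y - P x) :
    HasDerivAt P g0 x0 := by
  rw [hasDerivAt_iff_tendsto_slope, tendsto_order]
  constructor
  · intro a hag
    obtain ⟨M, hM1, hM2⟩ := exists_between hag
    obtain ⟨s, hs, h⟩ := hlo M hM2
    filter_upwards [mem_nhdsWithin_of_mem_nhds hs, self_mem_nhdsWithin] with t ht ht'
    refine lt_of_lt_of_le hM1 ?_
    rcases lt_or_gt_of_ne (show t ≠ x0 from ht') with h1 | h1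
    · rw [slope_comm, slope_def_field, le_div_iff₀ (by linarith)]
      exact h t ht x0 (mem_of_mem_nhds hs) h1
    · rw [slope_def_field, le_div_iff₀ (by linarith)]
      exact h x0 (mem_of_mem_nhds hs) t ht h1
  · intro a hag
    obtain ⟨M, hM1, hM2⟩ := exists_between hag
    obtain ⟨s, hs, h⟩ := hup M hM1
    filter_upwards [mem_nhdsWithin_of_mem_nhds hs, self_mem_nhdsWithin] with t ht ht'
    refine lt_of_le_of_lt ?_ hM2
    rcases lt_or_gt_of_ne (show t ≠ x0 from ht') with h1 | h1
    · rw [slope_comm, slope_def_field, div_le_iff₀ (by linarith)]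
      exact h t ht x0 (mem_of_mem_nhds hs) h1
    · rw [slope_def_field, div_le_iff₀ (by linarith)]
      exact h x0 (mem_of_mem_nhds hs) t ht h1

lemma second_deriv {lam R r c b ws : ℝ} {v : ℝ → ℝ} (hR : 0 < R)
    (hs : IsViscSubsolG lam R r c b ws v)
    (hsup : IsViscSupersolG lam R r c b ws v)
    (hd : ∀ t ∈ Ioo b ws, DifferentiableAt ℝ v t)
    (hneg : ∀ t ∈ Ioo b ws, deriv v t < 0)
    (hc : ∀ t ∈ Ioo b ws, ContinuousAt (deriv v) t)
    (hpos : ∀ x ∈ Ioo b ws, 0 < v x)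
    {w : ℝ} (hw : w ∈ Ioo b ws)
    (hF : 0 < (r * w - c) * deriv v w - lam * v w * Real.log (v w)) :
    HasDerivAt (deriv v)
      (R * (deriv v w) ^ 2 / ((r * w - c) * deriv v w - lam * v w * Real.log (v w))) w := by
  set F : ℝ → ℝ := fun w => (r * w - c) * deriv v w - lam * v w * Real.log (v w) with hFdef
  have hcw := (hd w hw).continuousAt
  have hcl := hcw.log (hpos w hw).ne'
  have hcP := hc w hw
  have hFc : ContinuousAt F w := by
    simp only [hFdef]
    fun_prop
  have hgc : ContinuousAt (fun t => R * (deriv v t) ^ 2 / F t) w :=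
    ContinuousAt.div (by fun_prop) hFc hF.ne'
  have hFev : ∀ᶠ t in 𝓝 w, 0 < F t := hFc.eventually (lt_mem_nhds hF)
  have hnh : ∀ {Q : ℝ → Prop}, (∀ᶠ t in 𝓝 w, Q t) →
      ∃ α β, Ioo α β ∈ 𝓝 w ∧ ∀ t ∈ Ioo α β, t ∈ Ioo b ws ∧ 0 < F t ∧ Q t := by
    intro Q hQ
    have : ∀ᶠ t in 𝓝 w, t ∈ Ioo b ws ∧ 0 < F t ∧ Q t :=
      Filter.Eventually.and (Ioo_mem_nhds hw.1 hw.2) (hFev.and hQ)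
    obtain ⟨α, β, hαβ, hsub⟩ := mem_nhds_iff_exists_Ioo_subset.1 this
    exact ⟨α, β, Ioo_mem_nhds hαβ.1 hαβ.2, hsub⟩
  have hhd : ∀ M s : ℝ, ∀ t ∈ Ioo b ws,
      HasDerivAt (fun t => v t - (M / 2 * t ^ 2 + s * t)) (deriv v t - (M * t + s)) t :=
    fun M s t ht => (hd t ht).hasDerivAt.fun_sub (quad_hasDerivAt M s t)
  apply hasDerivAt_of_bounds
  · intro M hM
    have hM0 : 0 < M := by
      refine lt_of_le_of_lt ?_ hM
      positivity
    obtain ⟨α, β, hn, hJ⟩ := hnh (hgc.eventually (gt_mem_nhds hM))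
    refine ⟨_, hn, fun x hx y hy hxy => ?_⟩
    by_contra hcon
    push Not at hcon
    obtain ⟨s, hs1, hs2⟩ := exists_between
      (show deriv v x - M * x < deriv v y - M * y by linarith)
    have hsub : Icc x y ⊆ Ioo α β := fun t ht => ⟨lt_of_lt_of_le hx.1 ht.1, lt_of_le_of_lt ht.2 hy.2⟩
    obtain ⟨z, hz, hzm⟩ := exists_localMin_of_deriv hxy
      (fun t ht => (hhd M s t (hJ t (hsub ht)).1).continuousAt.continuousWithinAt)
      (hhd M s x (hJ x hx).1) (by linarith) (hhd M s y (hJ y hy).1) (by linarith)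
    obtain ⟨hzI, hzF, hzM⟩ := hJ z (hsub (Ioo_subset_Icc_self hz))
    have h0 := hzm.hasDerivAt_eq_zero (hhd M s z hzI)
    have h1 := super_quad_s9 hsup hzI hM0 hzm
    rw [← sub_eq_zero.1 h0] at h1
    rw [div_lt_iff₀ hzF] at hzM
    have h2 : F z ≤ R * deriv v z ^ 2 / M := by simp only [hFdef]; linarith
    rw [le_div_iff₀ hM0] at h2
    linarith
  · intro M hM
    obtain ⟨α, β, hn, hJ⟩ := hnh (hgc.eventually (lt_mem_nhds hM))
    refine ⟨_, hn, fun x hx y hy hxy => ?_⟩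
    by_contra hcon
    push Not at hcon
    obtain ⟨s, hs1, hs2⟩ := exists_between
      (show deriv v y - M * y < deriv v x - M * x by linarith)
    have hsub : Icc x y ⊆ Ioo α β := fun t ht => ⟨lt_of_lt_of_le hx.1 ht.1, lt_of_le_of_lt ht.2 hy.2⟩
    obtain ⟨z, hz, hzm⟩ := exists_localMax_of_deriv hxy
      (fun t ht => (hhd M s t (hJ t (hsub ht)).1).continuousAt.continuousWithinAt)
      (hhd M s x (hJ x hx).1) (by linarith) (hhd M s y (hJ y hy).1) (by linarith)
    obtain ⟨hzI, hzF, hzM⟩ := hJ z (hsub (Ioo_subset_Icc_self hz))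
    have h0 := hzm.hasDerivAt_eq_zero (hhd M s z hzI)
    have h0' := sub_eq_zero.1 h0
    obtain ⟨hM0, h1⟩ := sub_quad_s9 hs hzI hzm (by rw [← h0']; exact (hneg z hzI).ne)
    rw [← h0'] at h1
    rw [lt_div_iff₀ hzF] at hzM
    have h2 : R * deriv v z ^ 2 / M ≤ F z := by simp only [hFdef]; linarith
    rw [div_le_iff₀ hM0] at h2
    linarith

lemma F_pos {lam R r c b ws : ℝ} {v Q : ℝ → ℝ} (hR : 0 < R) (hb : b < ws)
    (hcont : ContinuousOn v (Icc b ws)) (hv : ConvexOn ℝ (Icc b ws) v)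
    (ha : StrictAntiOn v (Icc b ws)) (hs : IsViscSubsolG lam R r c b ws v)
    (hrc : ∀ x < ws, r * x - c < 0)
    (hpos : ∀ x ∈ Icc b ws, 0 < v x)
    (hd : ∀ t ∈ Ioo b ws, HasDerivAt v (Q t) t)
    (hneg : ∀ t ∈ Ico b ws, Q t < 0)
    (hQ : ContinuousOn Q (Ico b ws))
    (h2 : ∀ t ∈ Ioo b ws, 0 < (r * t - c) * Q t - lam * v t * Real.log (v t) →
      HasDerivAt Q (R * Q t ^ 2 / ((r * t - c) * Q t - lam * v t * Real.log (v t))) t)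
    {w : ℝ} (hw : w ∈ Ico b ws) :
    0 < (r * w - c) * Q w - lam * v w * Real.log (v w) := by
  set F : ℝ → ℝ := fun w => (r * w - c) * Q w - lam * v w * Real.log (v w) with hFdef
  have hcv : ContinuousOn v (Ico b ws) := hcont.mono Ico_subset_Icc_self
  have hcl : ContinuousOn (fun t => Real.log (v t)) (Ico b ws) :=
    hcv.log (fun t ht => (hpos t (Ico_subset_Icc_self ht)).ne')
  have hFc : ContinuousOn F (Ico b ws) := by
    simp only [hFdef]
    fun_prop
  set H : ℝ → ℝ := fun t => F t * (r * Q t - lam * (Q t * Real.log (v t) + Q t))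
    + (r * t - c) * (R * Q t ^ 2) with hHdef
  have hHc : ContinuousOn H (Ico b ws) := by
    simp only [hHdef]
    fun_prop
  have hdense : ∀ β, w < β → ∃ x ∈ Ioo w β, x ∈ Ioo b ws ∧ 0 < F x := by
    intro β hβ
    obtain ⟨x, hx, p, hp, hG⟩ := dense_pt hR hb hcont hv ha hs hw.1 (min_le_right β ws)
      (lt_min hβ hw.2)
    have hxI : x ∈ Ioo b ws := ⟨lt_of_le_of_lt hw.1 hx.1, lt_of_lt_of_le hx.2 (min_le_right _ _)⟩
    refine ⟨x, ⟨hx.1, lt_of_lt_of_le hx.2 (min_le_left _ _)⟩, hxI, ?_⟩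
    have := hp.unique (hd x hxI)
    rw [this] at hG
    simp only [hFdef]
    linarith
  have hnh : ∀ (f : ℝ → ℝ), ContinuousOn f (Ico b ws) → f w < 0 →
      ∃ β, w < β ∧ ∀ t ∈ Ioo w β, f t < 0 := by
    intro f hf hfw
    have h1 : ∀ᶠ t in 𝓝[Ico b ws] w, f t < 0 := (hf w hw).eventually (gt_mem_nhds hfw)
    have h3 : ∀ᶠ t in 𝓝[>] w, f t < 0 := by
      have h4 : 𝓝[>] w ≤ 𝓝[Ico b ws] w := by
        apply nhdsWithin_le_iff.2
        exact mem_of_superset (Ioo_mem_nhdsGT hw.2) (fun t ht => ⟨hw.1.trans ht.1.le, ht.2⟩)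
      exact h4 h1
    obtain ⟨β, hβ, hβ'⟩ := mem_nhdsGT_iff_exists_Ioo_subset.1 h3
    exact ⟨β, hβ, fun t ht => hβ' ht⟩
  by_contra hcon
  replace hcon : F w ≤ 0 := not_lt.1 hcon
  rcases hcon.lt_or_eq with hlt | heq
  · obtain ⟨β, hβ, h⟩ := hnh F hFc hlt
    obtain ⟨x, hx, -, hx'⟩ := hdense β hβ
    linarith [h x hx]
  · have hHw : H w < 0 := by
      simp only [hHdef]
      rw [heq, zero_mul, zero_add]
      have := hneg w hw
      exact mul_neg_of_neg_of_pos (hrc w hw.2) (by nlinarith [mul_pos_of_neg_of_neg this this])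
    obtain ⟨β, hβ, h⟩ := hnh H hHc hHw
    obtain ⟨x, hx, hxI, hx'⟩ := hdense β hβ
    have hsub : Icc w x ⊆ Ico b ws := fun t ht => ⟨hw.1.trans ht.1, lt_of_le_of_lt ht.2 hxI.2⟩
    obtain ⟨z, hz, hzmax⟩ := isCompact_Icc.exists_isMaxOn ⟨x, right_mem_Icc.2 hx.1.le⟩ (hFc.mono hsub)
    have hFz : 0 < F z := lt_of_lt_of_le hx' (hzmax (right_mem_Icc.2 hx.1.le))
    have hwz : w < z := by
      refine lt_of_le_of_ne hz.1 ?_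
      rintro rfl
      linarith
    have hzI : z ∈ Ioo b ws := ⟨lt_of_le_of_lt hw.1 hwz, lt_of_le_of_lt hz.2 hxI.2⟩
    have hvz := hpos z (Ioo_subset_Icc_self hzI)
    have hFd : HasDerivAt F (H z / F z) z := by
      have e1 := (((hasDerivAt_id' z).const_mul r).sub_const c).fun_mul (h2 z hzI hFz)
      have e2 := ((hd z hzI).const_mul lam).fun_mul ((hd z hzI).log hvz.ne')
      refine (e1.fun_sub e2).congr_deriv ?_
      change r * 1 * Q z + (r * z - c) * (R * Q z ^ 2 / F z) - _ = _
      simp only [hHdef]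
      field_simp
      ring
    obtain ⟨t, ht, ht'⟩ := deriv_neg_left hwz hFd
      (div_neg_of_neg_of_pos (h z ⟨hwz, lt_of_le_of_lt hz.2 hx.2⟩) hFz)
    have : F t ≤ F z := hzmax ⟨ht.1.le, ht.2.le.trans hz.2⟩
    linarith

/-- Regularity upgrade. A convex, strictly decreasing continuous viscosity
solution of the Cole–Hopf transformed Dirichlet problem is C¹ up to the boundary,
C² up to the left boundary, and solves the ODE classically. -/
theorem stmt_9 (r μ σ c b ws R lam eps d : ℝ)
    (hr : 0 < r) (hμ : r < μ) (hσ : 0 < σ) (hc : 0 < c)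
    (hws : ws = c / r) (hb : b < ws)
    (hR : R = (1 / 2) * ((μ - r) / σ) ^ 2)
    (hlam : 0 < lam) (heps : 0 < eps)
    (hd : d = (1 / (2 * r)) *
      ((r + lam + R) + Real.sqrt ((r + lam + R) ^ 2 - 4 * r * lam)))
    (ψ₀ : ℝ → ℝ)
    (hψ₀ : ∀ w, ψ₀ w = ((c - r * w) / (c - r * b)) ^ d)
    (p : ℝ → ℝ)
    (hp : ∀ w, p w = (1 / eps) *
      Real.log (1 + (Real.exp eps - 1) * ((c - r * w) / (c - r * b)) ^ (R / r + 1)))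
    (v : ℝ → ℝ)
    (hv_cont : ContinuousOn v (Set.Icc b ws))
    (hv_convex : ConvexOn ℝ (Set.Icc b ws) v)
    (hv_anti : StrictAntiOn v (Set.Icc b ws))
    (hv_sub : IsViscSubsolG lam R r c b ws v)
    (hv_super : IsViscSupersolG lam R r c b ws v)
    (hvb : v b = Real.exp eps) (hvws : v ws = 1)
    (hv_bounds : ∀ w ∈ Set.Ioo b ws,
      Real.exp (eps * ψ₀ w) ≤ v w ∧ v w ≤ Real.exp (eps * p w))
    (v' v'' : ℝ → ℝ)
    (hv' : v' = derivWithin v (Set.Icc b ws))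
    (hv'' : v'' = derivWithin v' (Set.Icc b ws)) :
    ContDiffOn ℝ 1 v (Set.Icc b ws) ∧
    ContDiffOn ℝ 2 v (Set.Ico b ws) ∧
    (∀ w ∈ Set.Ico b ws, v' w < 0 ∧ 0 < v'' w) ∧
    (∀ w ∈ Set.Ioo b ws,
      lam * v w * Real.log (v w) = - R * (v' w) ^ 2 / v'' w + (r * w - c) * v' w) := by
  have hR0 : 0 < R := by
    rw [hR]
    have : 0 < (μ - r) / σ := div_pos (by linarith) hσ
    positivity
  have hrc : ∀ x < ws, r * x - c < 0 := by
    intro x hx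
    rw [hws, lt_div_iff₀ hr] at hx
    linarith
  have hpos : ∀ x ∈ Icc b ws, 0 < v x := by
    intro x hx
    have := hv_anti.antitoneOn hx (right_mem_Icc.2 hb.le) hx.2
    linarith
  have hdi : ∀ t ∈ Ioo b ws, DifferentiableAt ℝ v t := fun t ht =>
    diff_interior hR0 hb hv_cont hv_convex hv_anti hv_sub hv_super hrc hpos ht
  have hmono : MonotoneOn (deriv v) (Ioo b ws) :=
    (hv_convex.subset Ioo_subset_Icc_self (convex_Ioo b ws)).monotoneOn_deriv hdi
  have hnegI : ∀ t ∈ Ioo b ws, deriv v t < 0 := fun t ht =>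
    deriv_neg_of_anti hb hv_convex hv_anti ht (hdi t ht).hasDerivAt
  have hcI : ∀ t ∈ Ioo b ws, ContinuousAt (deriv v) t := fun t ht =>
    continuousAt_deriv_of_mono ht hdi hmono
  -- lower bound for the derivative
  have hlow : ∃ B, ∀ t ∈ Ioo b ws, B ≤ deriv v t := by
    have hcb : 0 < c - r * b := by linarith [hrc b hb]
    have hψd : DifferentiableAt ℝ (fun w => Real.exp (eps * ψ₀ w)) b := by
      have e : ψ₀ = fun w => ((c - r * w) / (c - r * b)) ^ d := funext hψ₀
      rw [e]
      have : DifferentiableAt ℝ (fun w => ((c - r * w) / (c - r * b)) ^ d) b := by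
        apply DifferentiableAt.rpow_const
        · fun_prop
        · left
          rw [div_self hcb.ne']
          exact one_ne_zero
      fun_prop
    have hψb : ψ₀ b = 1 := by rw [hψ₀, div_self hcb.ne', Real.one_rpow]
    have hsl := hψd.hasDerivAt.tendsto_slope
    set e := deriv (fun w => Real.exp (eps * ψ₀ w)) b
    have h2 : ∀ᶠ t in 𝓝[>] b, e - 1 < slope (fun w => Real.exp (eps * ψ₀ w)) b t :=
      (hsl.mono_left (nhdsWithin_mono _ (fun t ht => ne_of_gt ht))).eventually
        (lt_mem_nhds (by linarith))
    obtain ⟨y, hy, hy'⟩ := mem_nhdsGT_iff_exists_Ioo_subset.1 h2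
    have hnear : ∀ t ∈ Ioo b ws, t < y → e - 1 ≤ deriv v t := by
      intro t ht hty
      have h3 : e - 1 < slope (fun w => Real.exp (eps * ψ₀ w)) b t := hy' ⟨ht.1, hty⟩
      have h4 := hv_convex.slope_le_of_hasDerivAt (left_mem_Icc.2 hb.le) (Ioo_subset_Icc_self ht)
        ht.1 (hdi t ht).hasDerivAt
      have h5 : slope (fun w => Real.exp (eps * ψ₀ w)) b t ≤ slope v b t := by
        rw [slope_def_field, slope_def_field]
        have h6 := (hv_bounds t ht).1
        have h7 : 0 < t - b := by linarith [ht.1]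
        have h8 : Real.exp (eps * ψ₀ b) = v b := by rw [hψb, hvb, mul_one]
        gcongr
        exact h8.symm.le
      linarith
    refine ⟨e - 1, fun t ht => ?_⟩
    obtain ⟨s, hs1, hs2⟩ := exists_between (lt_min (show b < y from hy) ht.1)
    have hsI : s ∈ Ioo b ws := ⟨hs1, by linarith [lt_of_lt_of_le hs2 (min_le_right y t), ht.2]⟩
    exact (hnear s hsI (lt_of_lt_of_le hs2 (min_le_left _ _))).trans
      (hmono hsI ht (lt_of_lt_of_le hs2 (min_le_right _ _)).le)
  obtain ⟨B, hB⟩ := hlow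
  obtain ⟨p0, hp0, hp0'⟩ := right_limit hb
    ((hv_cont b (left_mem_Icc.2 hb.le)).mono Ioo_subset_Icc_self) hdi hmono hB
  obtain ⟨p1, hp1, hp1'⟩ := left_limit hb
    ((hv_cont ws (right_mem_Icc.2 hb.le)).mono Ioo_subset_Icc_self) hdi hmono
    (fun t ht => (hnegI t ht).le)
  have huniq := uniqueDiffOn_Icc hb
  have hvI : ∀ t ∈ Ioo b ws, v' t = deriv v t := fun t ht => by
    rw [hv']; exact derivWithin_of_mem_nhds (Icc_mem_nhds ht.1 ht.2)
  have hWb : HasDerivWithinAt v p0 (Icc b ws) b := hp0'.mono Icc_subset_Ici_self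
  have hWs : HasDerivWithinAt v p1 (Icc b ws) ws := hp1'.mono Icc_subset_Iic_self
  have hvb' : v' b = p0 := by
    rw [hv']; exact hWb.derivWithin (huniq b (left_mem_Icc.2 hb.le))
  have hvs' : v' ws = p1 := by
    rw [hv']; exact hWs.derivWithin (huniq ws (right_mem_Icc.2 hb.le))
  have hdW : DifferentiableOn ℝ v (Icc b ws) := by
    intro t ht
    rcases ht.1.eq_or_lt with h | h
    · rw [← h]; exact hWb.differentiableWithinAt
    rcases ht.2.eq_or_lt with h' | h'
    · rw [h']; exact hWs.differentiableWithinAt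
    exact (hdi t ⟨h, h'⟩).differentiableWithinAt
  have hevI : ∀ t ∈ Ioo b ws, v' =ᶠ[𝓝 t] deriv v := fun t ht =>
    Filter.eventuallyEq_of_mem (Ioo_mem_nhds ht.1 ht.2) hvI
  have hcW : ContinuousOn v' (Icc b ws) := by
    have hb1 : Tendsto v' (𝓝[>] b) (𝓝 (v' b)) := by
      rw [hvb']
      exact hp0.congr' (Filter.eventuallyEq_of_mem (Ioo_mem_nhdsGT hb) (fun t ht => (hvI t ht).symm))
    have hs1 : Tendsto v' (𝓝[<] ws) (𝓝 (v' ws)) := by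
      rw [hvs']
      exact hp1.congr' (Filter.eventuallyEq_of_mem (Ioo_mem_nhdsLT hb) (fun t ht => (hvI t ht).symm))
    intro t ht
    rcases ht.1.eq_or_lt with h | h
    · rw [← h]
      exact (continuousWithinAt_Ioi_iff_Ici.1 hb1).mono Icc_subset_Ici_self
    rcases ht.2.eq_or_lt with h' | h'
    · rw [h']
      exact (continuousWithinAt_Iio_iff_Iic.1 hs1).mono Icc_subset_Iic_self
    exact ((hcI t ⟨h, h'⟩).congr (hevI t ⟨h, h'⟩).symm).continuousWithinAt
  have hneg : ∀ t ∈ Ico b ws, v' t < 0 := by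
    intro t ht
    rcases ht.1.eq_or_lt with h | h
    · rw [← h, hvb']
      obtain ⟨m, hm⟩ := exists_between hb
      refine lt_of_le_of_lt (le_of_tendsto hp0 ?_) (hnegI m hm)
      filter_upwards [Ioo_mem_nhdsGT hm.1] with s hs
      exact hmono ⟨hs.1, hs.2.trans hm.2⟩ hm hs.2.le
    · rw [hvI t ⟨h, ht.2⟩]
      exact hnegI t ⟨h, ht.2⟩
  have hdI' : ∀ t ∈ Ioo b ws, HasDerivAt v (v' t) t := fun t ht => by
    rw [hvI t ht]; exact (hdi t ht).hasDerivAt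
  have hsec : ∀ t ∈ Ioo b ws, 0 < (r * t - c) * v' t - lam * v t * Real.log (v t) →
      HasDerivAt v' (R * v' t ^ 2 / ((r * t - c) * v' t - lam * v t * Real.log (v t))) t := by
    intro t ht hF
    rw [hvI t ht] at hF ⊢
    exact (second_deriv hR0 hv_sub hv_super hdi hnegI hcI
      (fun x hx => hpos x (Ioo_subset_Icc_self hx)) ht hF).congr_of_eventuallyEq (hevI t ht)
  have hF : ∀ t ∈ Ico b ws, 0 < (r * t - c) * v' t - lam * v t * Real.log (v t) := fun t ht =>
    F_pos hR0 hb hv_cont hv_convex hv_anti hv_sub hrc hpos hdI' hneg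
      (hcW.mono Ico_subset_Icc_self) hsec ht
  set g : ℝ → ℝ := fun t => R * v' t ^ 2 / ((r * t - c) * v' t - lam * v t * Real.log (v t)) with hg
  have hcWo : ContinuousOn v' (Ico b ws) := hcW.mono Ico_subset_Icc_self
  have hgc : ContinuousOn g (Ico b ws) := by
    have hcv : ContinuousOn v (Ico b ws) := hv_cont.mono Ico_subset_Icc_self
    have hcl : ContinuousOn (fun t => Real.log (v t)) (Ico b ws) :=
      hcv.log (fun t ht => (hpos t (Ico_subset_Icc_self ht)).ne')
    exact ContinuousOn.div (by fun_prop) (by fun_prop) (fun t ht => (hF t ht).ne')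
  have hgpos : ∀ t ∈ Ico b ws, 0 < g t := by
    intro t ht
    apply div_pos _ (hF t ht)
    have := (hneg t ht).ne
    positivity
  have hgI : ∀ t ∈ Ioo b ws, HasDerivAt v' (g t) t := fun t ht =>
    hsec t ht (hF t (Ioo_subset_Ico_self ht))
  have hgb : HasDerivWithinAt v' (g b) (Ici b) b := by
    apply hasDerivWithinAt_Ici_of_tendsto_deriv (s := Ioo b ws)
    · exact fun t ht => (hgI t ht).differentiableAt.differentiableWithinAt
    · exact (hcW b (left_mem_Icc.2 hb.le)).mono Ioo_subset_Icc_self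
    · exact Ioo_mem_nhdsGT hb
    · have h1 : Tendsto g (𝓝[Ico b ws] b) (𝓝 (g b)) := hgc b (left_mem_Ico.2 hb)
      have h2 : 𝓝[>] b ≤ 𝓝[Ico b ws] b :=
        nhdsWithin_le_iff.2 (mem_of_superset (Ioo_mem_nhdsGT hb) Ioo_subset_Ico_self)
      exact (h1.mono_left h2).congr' (Filter.eventuallyEq_of_mem (Ioo_mem_nhdsGT hb)
        (fun t ht => (hgI t ht).deriv.symm))
  have hgW : ∀ t ∈ Ico b ws, HasDerivWithinAt v' (g t) (Icc b ws) t := by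
    intro t ht
    rcases ht.1.eq_or_lt with h | h
    · rw [← h]; exact hgb.mono Icc_subset_Ici_self
    · exact (hgI t ⟨h, ht.2⟩).hasDerivWithinAt
  have hv2 : ∀ t ∈ Ico b ws, v'' t = g t := fun t ht => by
    rw [hv'']
    exact (hgW t ht).derivWithin (huniq t (Ico_subset_Icc_self ht))
  have huniq2 : UniqueDiffOn ℝ (Ico b ws) := uniqueDiffOn_Ico b ws
  have hdw1 : ∀ t ∈ Ico b ws, derivWithin v (Ico b ws) t = v' t := fun t ht => by
    rw [hv']
    exact ((hdW t (Ico_subset_Icc_self ht)).hasDerivWithinAt.mono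
      Ico_subset_Icc_self).derivWithin (huniq2 t ht)
  refine ⟨?_, ?_, ?_, ?_⟩
  · rw [contDiffOn_one_iff_derivWithin huniq, ← hv']
    exact ⟨hdW, hcW⟩
  · have h1 : ContDiffOn ℝ 1 v' (Ico b ws) := by
      rw [contDiffOn_one_iff_derivWithin huniq2]
      refine ⟨fun t ht => ((hgW t ht).mono Ico_subset_Icc_self).differentiableWithinAt, ?_⟩
      exact hgc.congr (fun t ht => ((hgW t ht).mono Ico_subset_Icc_self).derivWithin (huniq2 t ht))
    rw [show (2 : WithTop ℕ∞) = 1 + 1 by norm_num, contDiffOn_succ_iff_derivWithin huniq2]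
    refine ⟨hdW.mono Ico_subset_Icc_self, by simp, h1.congr hdw1⟩
  · intro t ht
    exact ⟨hneg t ht, by rw [hv2 t ht]; exact hgpos t ht⟩
  · intro t ht
    have ht' := Ioo_subset_Ico_self ht
    rw [hv2 t ht']
    have h1 := (hneg t ht').ne
    have h2 := (hF t ht').ne'
    simp only [hg]
    have h3 : -R * v' t ^ 2 / (R * v' t ^ 2 / ((r * t - c) * v' t - lam * v t * Real.log (v t)))
        = -((r * t - c) * v' t - lam * v t * Real.log (v t)) := by
      generalize (r * t - c) * v' t - lam * v t * Real.log (v t) = X at h2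
      have := hR0.ne'
      field_simp
    rw [h3]
    ring
end
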